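/- arXiv:2509.14135 — 2 statements merged into one kernel-verified Lean document; each statement's English description precedes it below -/
import Mathlib

section
/- Let G be a connected (P2∪P4, C3)-free simple graph. Then χ(G) = 3 if and only if G contains an induced cycle of length 5 or an induced cycle of length 7, and G does not contain the Grötzsch graph F1 as an induced subgraph. -/
open SimpleGraph

/-- `H` is (isomorphic to) an induced subgraph of `G`. -/
def ContainsInduced {α β : Type*} (H : SimpleGraph α) (G : SimpleGraph β) : Prop :=
  ∃ f : α ↪ β, ∀ a b : α, G.Adj (f a) (f b) ↔ H.Adj a b

/-- The disjoint union `P2 ∪ P4`. -/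
def P2UnionP4 : SimpleGraph (Fin 6) :=
  SimpleGraph.fromEdgeSet {s(0,1), s(2,3), s(3,4), s(4,5)}

/-- The bull: a triangle with two disjoint pendant edges. -/
def BullGraph : SimpleGraph (Fin 5) :=
  SimpleGraph.fromEdgeSet {s(0,1), s(0,2), s(1,2), s(0,3), s(1,4)}

/-- The triangle `C3`. -/
def TriangleGraph : SimpleGraph (Fin 3) := ⊤

/-- The paw: a triangle with a pendant edge. -/
def PawGraph : SimpleGraph (Fin 4) :=
  SimpleGraph.fromEdgeSet {s(0,1), s(0,2), s(1,2), s(0,3)}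

/-- The diamond: `K4` minus an edge. -/
def DiamondGraph : SimpleGraph (Fin 4) :=
  SimpleGraph.fromEdgeSet {s(0,1), s(0,2), s(0,3), s(1,2), s(1,3)}

/-- The 5-cycle. -/
def Cycle5 : SimpleGraph (Fin 5) :=
  SimpleGraph.fromEdgeSet {s(0,1), s(1,2), s(2,3), s(3,4), s(0,4)}

/-- The 7-cycle. -/
def Cycle7 : SimpleGraph (Fin 7) :=
  SimpleGraph.fromEdgeSet {s(0,1), s(1,2), s(2,3), s(3,4), s(4,5), s(5,6), s(0,6)}

/-- The Grötzsch graph `F1`: vertex `0` is `v`, vertices `1,…,5` are `w1,…,w5`,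
vertices `6,…,10` are `v1,…,v5`; `v` is adjacent exactly to the `wᵢ`, the `vᵢ` form a
5-cycle, and `wᵢ` is adjacent exactly to `v`, `vᵢ` and `vᵢ₊₂` (indices mod 5). -/
def GrotzschGraph : SimpleGraph (Fin 11) :=
  SimpleGraph.fromEdgeSet
    {s(0,1), s(0,2), s(0,3), s(0,4), s(0,5),
     s(6,7), s(7,8), s(8,9), s(9,10), s(6,10),
     s(1,6), s(1,8), s(2,7), s(2,9), s(3,8), s(3,10), s(4,9), s(4,6), s(5,10), s(5,7)}

/-- The Clebsch graph `F2`: vertices are the elements of `(ℤ/2)⁴`, two vertices adjacent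
iff their difference is one of `e1, e2, e3, e4, e1+e2+e3+e4`. -/
def ClebschGraph : SimpleGraph (Fin 4 → ZMod 2) :=
  SimpleGraph.fromRel (fun x y =>
    x - y ∈ ({Pi.single 0 1, Pi.single 1 1, Pi.single 2 1, Pi.single 3 1, 1} :
      Set (Fin 4 → ZMod 2)))

/-- A graph is perfect if every induced subgraph has chromatic number equal to clique number. -/
def SimpleGraph.IsPerfect {V : Type*} (G : SimpleGraph V) : Prop :=
  ∀ S : Set V, (G.induce S).chromaticNumber = ((G.induce S).cliqueNum : ℕ∞)

/-- A graph is perfectly divisible if each nonempty induced subgraph `H` has a partition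
`(A, B)` of its vertex set such that `H[A]` is perfect and `ω(H[B]) < ω(H)`. -/
def SimpleGraph.PerfectlyDivisible {V : Type*} (G : SimpleGraph V) : Prop :=
  ∀ S : Set V, S.Nonempty → ∃ A B : Set V, A ∪ B = S ∧ A ∩ B = ∅ ∧
    (G.induce A).IsPerfect ∧ (G.induce B).cliqueNum < (G.induce S).cliqueNum

/-! ### Partially known graphs

A finite graph is encoded by the list of its lower triangular adjacency rows: row `j` is a
natural number whose bit `i < j` tells whether `i` and `j` are adjacent. -/

namespace PartialGraph

/-- What is known about a graph on `ℕ`: `t a b = some c` means that `a` and `b` are distinct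
vertices, adjacent exactly when `c` is `true`. -/
abbrev Table := ℕ → ℕ → Option Bool

/-- The table of the graph with the given lower triangular rows. -/
def ofRows (g : List ℕ) : Table := fun a b =>
  if a < b then g[b]?.map (·.testBit a) else if b < a then g[a]?.map (·.testBit b) else none

/-- Add a vertex `n` to a table; its adjacency to the vertices below `i` is given by the bits
of `m`. -/
def extend (t : Table) (n i m : ℕ) : Table := fun a b =>
  if a = n then (if b < i then some (m.testBit b) else none)
  else if b = n then (if a < i then some (m.testBit a) else none)
  else t a b

/-- The list `e` embeds the graph with rows `K` into every graph described by the table `t`. -/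
def embeds (t : Table) (K e : List ℕ) : Bool :=
  (List.range K.length).all fun j => (List.range j).all fun i =>
    t (e.getD i 0) (e.getD j 0) == some ((K.getD j 0).testBit i)

/-- A configuration: the index of a graph in a list, and an embedding of that graph. -/
abbrev Config := ℕ × List ℕ

/-- The configuration `c` is present in the table `t`. -/
def hits (forb : List (List ℕ)) (t : Table) (c : Config) : Bool :=
  match forb[c.1]? with
  | some K => embeds t K c.2
  | none => false

/-- Every way of extending the `n - k` known bits `m` to `n` bits either meets `ok` on the way
or ends in `leaf`. -/
def cover (ok : ℕ → ℕ → Bool) (leaf : ℕ → Bool) (n : ℕ) : ℕ → ℕ → Bool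
  | 0, m => ok n m || leaf m
  | k + 1, m => ok (n - (k + 1)) m ||
      (cover ok leaf n k m && cover ok leaf n k (m ||| 2 ^ (n - (k + 1))))

/-- A reason why a graph cannot occur in a non-3-colourable graph without dominated vertices
in which the graphs of a given list do not occur. The configurations in `bad` are listed by the
number of vertices of `g` whose adjacency to the new vertex is needed to recognize them. -/
inductive Step
  /-- In the graph `g`, the neighbourhood of `a` lies in that of `b`, and every new vertex
  adjacent to `a` but not to `b` creates one of the configurations `bad`. -/
  | dominated (g : List ℕ) (a b : ℕ) (bad : List (List Config))
  /-- The vertices of `g` are coloured by `own`. A new vertex creates one of the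
  configurations `bad` unless its neighbourhood in `g` is listed in `types`, where it is paired
  with a colour. Two adjacent new vertices with the same colour create a triangle or one of the
  configurations `badPair`. -/
  | coloured (g own : List ℕ) (types : List (ℕ × ℕ))
      (bad : List (List Config)) (badPair : List Config)

/-- The graph a step is about. -/
def Step.graph : Step → List ℕ
  | .dominated g _ _ _ => g
  | .coloured g _ _ _ _ => g

/-- Check that a step is justified, given the list `forb` of graphs that do not occur, which
starts with the triangle. -/
def Step.check (forb : List (List ℕ)) : Step → Bool
  | .dominated g a b bad =>
      let n := g.length
      let t := ofRows g
      a != b && a.blt n && b.blt n &&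
      ((List.range n).all fun c => t a c != some true || t b c == some true) &&
      cover (fun i m => (a.blt i && !m.testBit a) || (b.blt i && m.testBit b) ||
        (bad.getD i []).any (hits forb (extend t n i m))) (fun _ => false) n n 0
  | .coloured g own types bad badPair =>
      let n := g.length
      let t := ofRows g
      let triangles := (List.range n).map fun c => (0, [c, n, n + 1])
      ((List.range n).all fun c => (own.getD c 0).blt 3) &&
      (types.all fun x => x.2.blt 3) &&
      ((List.range n).all fun c => (List.range n).all fun d =>
        t c d != some true || own.getD c 0 != own.getD d 0) &&
      (types.all fun x => (List.range n).all fun c =>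
        !x.1.testBit c || x.2 != own.getD c 0) &&
      (types.all fun x => types.all fun y => x.2 != y.2 ||
        (triangles ++ badPair).any
          (hits forb (extend (extend t n n x.1) (n + 1) (n + 1) (y.1 ||| 2 ^ n)))) &&
      cover (fun i m => (bad.getD i []).any (hits forb (extend t n i m)))
        (fun m => types.any fun x => x.1 == m) n n 0

/-- Check a sequence of steps, where the graph of each step is excluded from then on. -/
def checkAll : List (List ℕ) → List Step → Bool
  | _, [] => true
  | forb, s :: ss => s.check forb && checkAll (forb ++ [s.graph]) ss

/-- The rows of the triangle, of `P2 ∪ P4` and of the Grötzsch graph. -/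
def baseRows : List (List ℕ) :=
  [[0, 1, 3], [0, 1, 0, 4, 8, 16], [0, 1, 1, 1, 1, 1, 18, 100, 138, 276, 616]]

/-- Steps excluding, among others, the 7-cycle and the 5-cycle with an isolated vertex added. -/
def exclusionSteps : List Step :=
  [.dominated [0, 1, 2, 4, 8, 16, 33, 0] 7 0
     [[], [], [], [(0, [8, 1, 2])], [], [(0, [8, 3, 4])], [], [(1, [3, 4, 8, 6, 0, 1]), (1, [0, 6,
     8, 4, 3, 2]), (0, [8, 5, 6]), (1, [2, 3, 8, 5, 6, 0])], [(1, [8, 7, 0, 1, 2, 3]), (1, [0, 1, 7,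
     8, 3, 4]), (1, [0, 1, 7, 8, 4, 3]), (1, [4, 5, 7, 8, 1, 0]), (1, [0, 6, 7, 8, 2, 3]), (1, [0,
     6, 7, 8, 3, 2]), (1, [2, 3, 7, 8, 6, 0])]],
   .coloured [0, 1, 2, 4, 9, 0, 52, 50, 41, 16, 834]
     [1, 2, 0, 1, 0, 0, 1, 1, 2, 1, 0]
     [(0, 0), (50, 1), (65, 0), (74, 0), (274, 1), (276, 1), (448, 0), (549, 2), (713, 0), (834, 0),
     (1040, 1), (1065, 2), (1076, 1), (1157, 2), (1160, 2)]
     [[], [], [(0, [11, 0, 1])], [(0, [11, 1, 2])], [(0, [11, 2, 3])], [(0, [11, 0, 4]), (0, [11, 3,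
     4])], [(1, [11, 5, 0, 1, 2, 3]), (1, [11, 5, 0, 4, 3, 2]), (1, [11, 5, 1, 2, 3, 4])], [(0, [11,
     2, 6]), (0, [11, 4, 6]), (0, [11, 5, 6]), (1, [0, 1, 3, 11, 6, 5]), (1, [11, 1, 3, 4, 6, 5])],
     [(0, [11, 1, 7]), (0, [11, 4, 7]), (0, [11, 5, 7]), (1, [11, 0, 2, 6, 5, 7])], [(0, [11, 0,
     8]), (0, [11, 3, 8]), (0, [11, 5, 8]), (1, [11, 2, 4, 0, 8, 5]), (1, [11, 1, 4, 3, 8, 5]), (1,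
     [11, 6, 1, 0, 8, 3]), (1, [11, 1, 3, 8, 5, 6]), (1, [11, 1, 4, 6, 5, 8]), (1, [11, 2, 0, 8, 5,
     7]), (1, [11, 2, 4, 7, 5, 8]), (1, [2, 6, 7, 11, 0, 8]), (1, [11, 8, 6, 2, 1, 7]), (1, [11, 7,
     6, 2, 3, 8]), (1, [11, 8, 1, 7, 4, 6])], [(1, [11, 9, 0, 1, 2, 3]), (0, [11, 4, 9]), (1, [11,
     5, 1, 0, 4, 9]), (1, [11, 9, 1, 2, 3, 8]), (1, [4, 9, 1, 11, 8, 5]), (1, [4, 9, 2, 11, 5, 8]),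
     (1, [11, 8, 1, 7, 4, 9]), (1, [11, 9, 0, 8, 5, 7])], [(0, [11, 1, 10]), (0, [11, 6, 10]), (1,
     [11, 3, 1, 10, 6, 5]), (1, [11, 3, 5, 7, 1, 10]), (1, [11, 10, 0, 4, 7, 5]), (1, [11, 3, 6, 10,
     1, 7]), (0, [11, 8, 10]), (1, [11, 2, 4, 0, 8, 10]), (1, [11, 4, 1, 10, 8, 5]), (1, [11, 7, 2,
     3, 8, 10]), (1, [11, 7, 3, 8, 10, 6]), (2, [1, 11, 0, 2, 7, 10, 5, 8, 3, 4, 6]), (2, [8, 11, 0,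
     5, 3, 10, 2, 1, 7, 4, 6]), (0, [11, 9, 10]), (1, [9, 10, 0, 11, 3, 2]), (1, [11, 5, 0, 1, 10,
     9]), (1, [11, 7, 2, 6, 10, 9])]]
     [(1, [11, 12, 0, 4, 3, 2]), (1, [11, 12, 1, 10, 8, 5]), (1, [11, 12, 0, 4, 7, 5]), (2, [11, 12,
     0, 2, 9, 5, 10, 8, 3, 4, 6]), (2, [12, 11, 0, 2, 9, 5, 10, 8, 3, 4, 6])],
   .dominated [0, 1, 2, 4, 9, 0, 52, 50, 41, 16] 9 7
     [[], [], [(0, [10, 0, 1])], [], [(0, [10, 2, 3])], [], [], [(0, [10, 5, 6]), (1, [10, 1, 3, 4,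
     6, 5])], [], [(0, [10, 5, 8]), (1, [10, 2, 7, 4, 0, 8])], [(0, [10, 4, 9]), (1, [10, 9, 2, 1,
     7, 5]), (1, [5, 7, 9, 10, 2, 3]), (1, [5, 7, 9, 10, 3, 2]), (1, [10, 9, 6, 2, 1, 7]), (1, [10,
     9, 0, 8, 3, 2]), (4, [6, 2, 1, 7, 4, 8, 0, 3, 5, 9, 10]), (4, [7, 1, 2, 6, 4, 8, 3, 0, 5, 9,
     10]), (4, [0, 1, 2, 3, 4, 5, 6, 7, 8, 9, 10])]],
   .dominated [0, 1, 2, 4, 9, 0, 52, 50, 41, 274] 9 0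
     [[], [], [], [], [(0, [10, 2, 3])], [], [(1, [10, 5, 1, 0, 4, 3])], [], [], [(1, [10, 2, 4, 0,
     8, 5]), (1, [10, 6, 7, 1, 0, 8]), (1, [0, 8, 7, 10, 6, 2])], [(0, [10, 1, 9]), (0, [10, 4, 9]),
     (0, [10, 8, 9]), (1, [2, 6, 10, 9, 8, 0])]],
   .coloured [0, 1, 2, 4, 9, 0, 52, 50, 41, 322]
     [0, 1, 0, 2, 1, 0, 2, 2, 1, 0]
     [(0, 0), (37, 2), (553, 1), (645, 1), (648, 1)]
     [[], [], [(0, [10, 0, 1])], [(0, [10, 1, 2])], [(0, [10, 2, 3])], [(0, [10, 0, 4]), (0, [10, 3,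
     4])], [(1, [10, 5, 0, 1, 2, 3]), (1, [10, 5, 2, 1, 0, 4])], [(0, [10, 2, 6]), (0, [10, 4, 6]),
     (0, [10, 5, 6]), (1, [10, 1, 3, 4, 6, 5])], [(0, [10, 1, 7]), (0, [10, 4, 7]), (1, [10, 3, 0,
     1, 7, 5]), (1, [10, 2, 0, 4, 7, 5]), (1, [10, 0, 2, 6, 5, 7])], [(0, [10, 0, 8]), (0, [10, 3,
     8]), (0, [10, 5, 8]), (1, [10, 2, 4, 0, 8, 5]), (1, [10, 1, 4, 3, 8, 5]), (1, [10, 8, 1, 2, 6,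
     4]), (1, [10, 1, 6, 4, 3, 8]), (1, [10, 1, 3, 8, 5, 6]), (1, [10, 1, 4, 6, 5, 8]), (1, [10, 8,
     2, 1, 7, 4]), (1, [10, 2, 0, 8, 5, 7]), (1, [10, 2, 4, 7, 5, 8]), (1, [2, 6, 7, 10, 0, 8]), (1,
     [10, 8, 6, 2, 1, 7]), (5, [0, 1, 2, 3, 4, 5, 6, 7, 8, 10]), (6, [10, 1, 2, 6, 4, 8, 3, 0, 5,
     7]), (6, [10, 2, 1, 7, 4, 8, 0, 3, 5, 6]), (6, [10, 1, 2, 3, 4, 5, 6, 7, 8, 0]), (6, [10, 2, 1,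
     0, 4, 5, 7, 6, 8, 3])], [(0, [10, 1, 9]), (1, [10, 9, 0, 4, 3, 2]), (1, [3, 4, 5, 10, 9, 1]),
     (0, [10, 6, 9]), (1, [10, 3, 0, 1, 9, 6]), (1, [10, 0, 3, 2, 6, 9]), (1, [10, 3, 5, 7, 1, 9]),
     (1, [10, 3, 6, 9, 1, 7]), (0, [10, 8, 9]), (1, [10, 2, 4, 0, 8, 9]), (1, [10, 7, 2, 3, 8, 9]),
     (1, [10, 7, 3, 8, 9, 6]), (5, [2, 1, 7, 4, 6, 8, 5, 9, 3, 10]), (6, [10, 1, 7, 4, 6, 8, 5, 9,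
     3, 2]), (6, [10, 3, 8, 5, 6, 1, 9, 2, 7, 4]), (6, [10, 1, 7, 5, 6, 3, 4, 2, 8, 9]), (6, [10, 7,
     1, 9, 6, 3, 2, 4, 8, 5]), (2, [1, 10, 0, 2, 7, 9, 5, 8, 3, 4, 6]), (2, [8, 10, 0, 5, 3, 9, 2,
     1, 7, 4, 6])]]
     [(1, [10, 11, 0, 1, 2, 3])],
   .coloured [0, 1, 2, 4, 9, 0, 52, 50, 41, 74]
     [0, 2, 1, 0, 1, 1, 0, 0, 2, 1]
     [(0, 0), (41, 2), (65, 1), (74, 1), (136, 2), (201, 1), (448, 1), (645, 2)]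
     [[], [], [(0, [10, 0, 1])], [], [(0, [10, 2, 3])], [(0, [10, 0, 4]), (0, [10, 3, 4])], [(1,
     [10, 5, 0, 1, 2, 3]), (1, [10, 5, 2, 1, 0, 4]), (1, [10, 5, 1, 2, 3, 4])], [(0, [10, 2, 6]),
     (0, [10, 4, 6]), (0, [10, 5, 6]), (1, [5, 6, 3, 10, 0, 1]), (1, [0, 1, 3, 10, 6, 5]), (1, [10,
     1, 3, 4, 6, 5])], [(0, [10, 1, 7]), (0, [10, 4, 7]), (0, [10, 5, 7]), (1, [10, 3, 0, 1, 7, 5]),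
     (1, [2, 3, 0, 10, 7, 5])], [(0, [10, 0, 8]), (0, [10, 3, 8]), (0, [10, 5, 8]), (1, [10, 2, 4,
     0, 8, 5]), (1, [10, 1, 4, 3, 8, 5]), (1, [10, 6, 1, 0, 8, 3]), (1, [10, 8, 1, 2, 6, 4]), (1,
     [10, 1, 6, 4, 3, 8]), (1, [10, 1, 3, 8, 5, 6]), (1, [10, 1, 4, 6, 5, 8]), (1, [10, 7, 0, 8, 3,
     2]), (1, [10, 2, 7, 4, 0, 8]), (1, [10, 8, 2, 1, 7, 4]), (1, [10, 2, 0, 8, 5, 7]), (1, [10, 2,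
     4, 7, 5, 8]), (1, [10, 8, 6, 2, 1, 7]), (1, [1, 7, 6, 10, 3, 8]), (5, [0, 1, 2, 3, 4, 5, 6, 7,
     8, 10]), (7, [10, 2, 3, 8, 0, 7, 4, 1, 5, 6]), (6, [10, 1, 2, 6, 4, 8, 3, 0, 5, 7]), (6, [10,
     2, 1, 7, 4, 8, 0, 3, 5, 6]), (6, [10, 1, 2, 3, 4, 5, 6, 7, 8, 0]), (6, [10, 2, 1, 0, 4, 5, 7,
     6, 8, 3]), (7, [10, 2, 6, 5, 7, 0, 4, 1, 8, 3])], [(0, [10, 1, 9]), (0, [10, 3, 9]), (0, [10,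
     6, 9]), (1, [10, 0, 3, 9, 6, 5]), (1, [5, 7, 10, 2, 3, 9]), (1, [10, 9, 0, 4, 7, 5]), (1, [5,
     8, 10, 9, 1, 2]), (1, [0, 8, 10, 2, 6, 9]), (6, [2, 6, 5, 10, 3, 0, 8, 4, 1, 9]), (6, [2, 3, 8,
     10, 6, 7, 5, 4, 1, 9])]]
     [(1, [10, 11, 0, 1, 2, 3])],
   .coloured [0, 1, 2, 4, 9, 0, 52, 50, 41, 136]
     [0, 1, 2, 0, 1, 1, 0, 0, 2, 1]
     [(0, 0), (136, 1), (201, 1), (577, 2)]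
     [[], [], [(0, [10, 0, 1])], [(0, [10, 1, 2])], [(0, [10, 2, 3])], [(0, [10, 0, 4]), (0, [10, 3,
     4])], [(1, [10, 5, 0, 1, 2, 3]), (1, [10, 5, 2, 1, 0, 4]), (1, [10, 5, 0, 4, 3, 2]), (1, [10,
     5, 1, 2, 3, 4])], [(0, [10, 2, 6]), (0, [10, 4, 6]), (0, [10, 5, 6]), (1, [0, 1, 3, 10, 6, 5]),
     (1, [10, 1, 3, 4, 6, 5])], [(0, [10, 1, 7]), (0, [10, 4, 7]), (0, [10, 5, 7]), (1, [10, 3, 0,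
     1, 7, 5]), (1, [2, 3, 0, 10, 7, 5]), (1, [10, 2, 0, 4, 7, 5]), (1, [10, 0, 2, 6, 5, 7])], [(0,
     [10, 0, 8]), (0, [10, 3, 8]), (0, [10, 5, 8]), (1, [10, 2, 4, 0, 8, 5]), (1, [10, 1, 4, 3, 8,
     5]), (1, [10, 6, 1, 0, 8, 3]), (1, [10, 8, 1, 2, 6, 4]), (1, [10, 1, 3, 8, 5, 6]), (1, [10, 1,
     4, 6, 5, 8]), (1, [10, 8, 2, 1, 7, 4]), (1, [10, 2, 0, 8, 5, 7]), (1, [10, 2, 4, 7, 5, 8]), (1,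
     [1, 7, 6, 10, 3, 8]), (1, [10, 7, 6, 2, 3, 8]), (5, [0, 1, 2, 3, 4, 5, 6, 7, 8, 10]), (7, [10,
     2, 3, 8, 0, 7, 4, 1, 5, 6]), (8, [6, 5, 10, 3, 4, 1, 0, 7, 2, 8]), (6, [10, 1, 2, 6, 4, 8, 3,
     0, 5, 7]), (6, [10, 2, 1, 7, 4, 8, 0, 3, 5, 6]), (8, [0, 1, 10, 3, 4, 5, 6, 7, 8, 2]), (8, [3,
     2, 10, 0, 4, 5, 7, 6, 8, 1]), (6, [10, 1, 2, 3, 4, 5, 6, 7, 8, 0]), (6, [10, 2, 1, 0, 4, 5, 7,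
     6, 8, 3]), (7, [10, 1, 7, 5, 6, 3, 4, 2, 8, 0]), (8, [0, 8, 10, 7, 4, 2, 6, 3, 1, 5])], [(0,
     [10, 3, 9]), (1, [10, 9, 0, 1, 2, 6]), (0, [10, 7, 9]), (1, [10, 0, 2, 3, 9, 7]), (1, [10, 2,
     0, 4, 7, 9]), (1, [2, 6, 0, 10, 7, 9]), (5, [10, 1, 0, 8, 3, 6, 4, 2, 5, 9]), (1, [0, 8, 2, 10,
     9, 7]), (1, [10, 8, 2, 1, 7, 9]), (5, [10, 2, 6, 5, 7, 0, 4, 1, 8, 9])]]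
     [(1, [10, 11, 0, 1, 2, 3])],
   .coloured [0, 1, 2, 4, 9, 0, 52, 50, 41, 201]
     [0, 1, 2, 0, 1, 1, 0, 0, 2, 1]
     [(0, 0), (201, 1)]
     [[], [], [(0, [10, 0, 1])], [(0, [10, 1, 2])], [(0, [10, 2, 3])], [(0, [10, 0, 4]), (0, [10, 3,
     4])], [(1, [10, 5, 0, 1, 2, 3]), (1, [10, 5, 2, 1, 0, 4]), (1, [10, 5, 1, 2, 3, 4])], [(0, [10,
     2, 6]), (0, [10, 4, 6]), (0, [10, 5, 6]), (1, [0, 1, 3, 10, 6, 5]), (1, [10, 1, 3, 4, 6, 5])],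
     [(0, [10, 1, 7]), (0, [10, 4, 7]), (0, [10, 5, 7]), (1, [10, 3, 0, 1, 7, 5]), (1, [2, 3, 0, 10,
     7, 5]), (1, [10, 2, 0, 4, 7, 5]), (1, [10, 0, 2, 6, 5, 7])], [(0, [10, 0, 8]), (0, [10, 3, 8]),
     (0, [10, 5, 8]), (1, [10, 2, 4, 0, 8, 5]), (1, [10, 1, 4, 3, 8, 5]), (1, [10, 6, 1, 0, 8, 3]),
     (1, [10, 8, 1, 2, 6, 4]), (1, [10, 1, 3, 8, 5, 6]), (1, [10, 1, 4, 6, 5, 8]), (1, [10, 8, 2, 1,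
     7, 4]), (1, [10, 2, 0, 8, 5, 7]), (1, [10, 2, 4, 7, 5, 8]), (1, [2, 6, 7, 10, 0, 8]), (1, [10,
     8, 6, 2, 1, 7]), (1, [1, 7, 6, 10, 3, 8]), (1, [10, 7, 6, 2, 3, 8]), (5, [0, 1, 2, 3, 4, 5, 6,
     7, 8, 10]), (8, [6, 5, 10, 3, 4, 1, 0, 7, 2, 8]), (9, [3, 2, 1, 0, 4, 5, 7, 6, 8, 10]), (8, [0,
     1, 10, 3, 4, 5, 6, 7, 8, 2]), (8, [3, 2, 10, 0, 4, 5, 7, 6, 8, 1]), (9, [0, 1, 2, 3, 4, 5, 6,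
     7, 8, 10]), (6, [10, 1, 2, 3, 4, 5, 6, 7, 8, 0]), (6, [10, 2, 1, 0, 4, 5, 7, 6, 8, 3]), (8, [0,
     8, 10, 7, 4, 2, 6, 3, 1, 5])], [(0, [10, 0, 9]), (0, [10, 3, 9]), (0, [10, 6, 9]), (0, [10, 7,
     9]), (1, [10, 1, 6, 9, 3, 8]), (6, [4, 0, 1, 2, 3, 5, 10, 8, 6, 9]), (1, [10, 2, 7, 9, 0, 8]),
     (6, [4, 3, 2, 1, 0, 5, 10, 8, 7, 9]), (5, [0, 1, 2, 3, 9, 5, 6, 7, 8, 10]), (6, [10, 1, 2, 6,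
     9, 8, 3, 0, 5, 7]), (6, [10, 2, 1, 7, 9, 8, 0, 3, 5, 6]), (6, [4, 0, 8, 5, 7, 2, 10, 1, 6, 9]),
     (6, [4, 3, 8, 5, 6, 1, 10, 2, 7, 9])]]
     [(1, [10, 11, 0, 1, 2, 3])],
   .coloured [0, 1, 2, 4, 9, 0, 52, 50, 41, 0]
     [1, 0, 1, 2, 0, 1, 2, 2, 0, 0]
     [(0, 0)]
     [[], [], [(0, [10, 0, 1])], [(0, [10, 1, 2])], [(0, [10, 2, 3])], [(0, [10, 0, 4]), (0, [10, 3,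
     4])], [(1, [10, 5, 0, 1, 2, 3]), (1, [10, 5, 2, 1, 0, 4]), (1, [10, 5, 1, 2, 3, 4])], [(0, [10,
     2, 6]), (0, [10, 4, 6]), (0, [10, 5, 6]), (1, [5, 6, 3, 10, 0, 1]), (1, [0, 1, 3, 10, 6, 5]),
     (1, [10, 1, 3, 4, 6, 5])], [(0, [10, 1, 7]), (0, [10, 4, 7]), (0, [10, 5, 7]), (1, [10, 3, 0,
     1, 7, 5]), (1, [2, 3, 0, 10, 7, 5]), (1, [10, 2, 0, 4, 7, 5]), (1, [10, 0, 2, 6, 5, 7])], [(0,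
     [10, 0, 8]), (0, [10, 3, 8]), (0, [10, 5, 8]), (1, [10, 2, 4, 0, 8, 5]), (1, [10, 1, 4, 3, 8,
     5]), (1, [10, 6, 1, 0, 8, 3]), (1, [10, 8, 1, 2, 6, 4]), (1, [10, 1, 6, 4, 3, 8]), (1, [10, 1,
     3, 8, 5, 6]), (1, [10, 1, 4, 6, 5, 8]), (1, [10, 7, 0, 8, 3, 2]), (1, [10, 2, 7, 4, 0, 8]), (1,
     [10, 8, 2, 1, 7, 4]), (1, [10, 2, 0, 8, 5, 7]), (1, [10, 2, 4, 7, 5, 8]), (1, [10, 8, 6, 2, 1,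
     7]), (1, [1, 7, 6, 10, 3, 8]), (5, [0, 1, 2, 3, 4, 5, 6, 7, 8, 10]), (7, [10, 2, 3, 8, 0, 7, 4,
     1, 5, 6]), (8, [6, 5, 10, 3, 4, 1, 0, 7, 2, 8]), (7, [10, 1, 0, 8, 3, 6, 4, 2, 5, 7]), (6, [10,
     1, 2, 6, 4, 8, 3, 0, 5, 7]), (6, [10, 2, 1, 7, 4, 8, 0, 3, 5, 6]), (9, [3, 2, 1, 0, 4, 5, 7, 6,
     8, 10]), (8, [0, 1, 10, 3, 4, 5, 6, 7, 8, 2]), (8, [3, 2, 10, 0, 4, 5, 7, 6, 8, 1]), (9, [0, 1,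
     2, 3, 4, 5, 6, 7, 8, 10]), (10, [0, 1, 2, 3, 10, 5, 6, 7, 8, 4]), (6, [10, 1, 2, 3, 4, 5, 6, 7,
     8, 0]), (6, [10, 2, 1, 0, 4, 5, 7, 6, 8, 3]), (7, [10, 1, 7, 5, 6, 3, 4, 2, 8, 0]), (7, [10, 2,
     6, 5, 7, 0, 4, 1, 8, 3]), (8, [0, 8, 10, 7, 4, 2, 6, 3, 1, 5])], [(1, [10, 9, 0, 4, 3, 2])]]
     [(1, [10, 11, 0, 1, 2, 3])],
   .coloured [0, 1, 2, 4, 9, 0, 52, 50, 41]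
     [1, 0, 1, 2, 0, 1, 2, 2, 0]
     []
     [[], [], [(0, [9, 0, 1])], [(0, [9, 1, 2])], [(0, [9, 2, 3])], [(0, [9, 0, 4]), (0, [9, 3,
     4])], [(1, [9, 5, 0, 1, 2, 3]), (1, [9, 5, 2, 1, 0, 4]), (1, [9, 5, 1, 2, 3, 4])], [(0, [9, 2,
     6]), (0, [9, 4, 6]), (0, [9, 5, 6]), (1, [0, 1, 3, 9, 6, 5]), (1, [9, 1, 3, 4, 6, 5])], [(0,
     [9, 1, 7]), (0, [9, 4, 7]), (0, [9, 5, 7]), (1, [9, 3, 0, 1, 7, 5]), (1, [2, 3, 0, 9, 7, 5]),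
     (1, [9, 2, 0, 4, 7, 5]), (1, [9, 0, 2, 6, 5, 7])], [(0, [9, 0, 8]), (0, [9, 3, 8]), (0, [9, 5,
     8]), (1, [9, 2, 4, 0, 8, 5]), (1, [9, 1, 4, 3, 8, 5]), (1, [9, 6, 1, 0, 8, 3]), (1, [9, 8, 1,
     2, 6, 4]), (1, [9, 1, 6, 4, 3, 8]), (1, [9, 1, 3, 8, 5, 6]), (1, [9, 1, 4, 6, 5, 8]), (1, [9,
     2, 7, 4, 0, 8]), (1, [9, 8, 2, 1, 7, 4]), (1, [9, 2, 0, 8, 5, 7]), (1, [9, 2, 4, 7, 5, 8]), (1,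
     [2, 6, 7, 9, 0, 8]), (1, [9, 8, 6, 2, 1, 7]), (1, [1, 7, 6, 9, 3, 8]), (1, [9, 7, 6, 2, 3, 8]),
     (11, [0, 1, 2, 3, 4, 5, 6, 7, 8, 9]), (5, [0, 1, 2, 3, 4, 5, 6, 7, 8, 9]), (7, [9, 2, 3, 8, 0,
     7, 4, 1, 5, 6]), (8, [6, 5, 9, 3, 4, 1, 0, 7, 2, 8]), (7, [9, 1, 0, 8, 3, 6, 4, 2, 5, 7]), (6,
     [9, 1, 2, 6, 4, 8, 3, 0, 5, 7]), (6, [9, 2, 1, 7, 4, 8, 0, 3, 5, 6]), (9, [3, 2, 1, 0, 4, 5, 7,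
     6, 8, 9]), (8, [0, 1, 9, 3, 4, 5, 6, 7, 8, 2]), (8, [3, 2, 9, 0, 4, 5, 7, 6, 8, 1]), (9, [0, 1,
     2, 3, 4, 5, 6, 7, 8, 9]), (10, [0, 1, 2, 3, 9, 5, 6, 7, 8, 4]), (6, [9, 1, 2, 3, 4, 5, 6, 7, 8,
     0]), (6, [9, 2, 1, 0, 4, 5, 7, 6, 8, 3]), (7, [9, 1, 7, 5, 6, 3, 4, 2, 8, 0]), (7, [9, 2, 6, 5,
     7, 0, 4, 1, 8, 3]), (8, [0, 8, 9, 7, 4, 2, 6, 3, 1, 5])]]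
     [],
   .coloured [0, 1, 2, 4, 9, 0, 52, 50, 42]
     [1, 0, 1, 2, 0, 0, 2, 1, 1]
     [(0, 0), (18, 1), (42, 1), (50, 1), (52, 2), (66, 1), (74, 1), (132, 0), (136, 0), (201, 0),
     (272, 2), (276, 2), (320, 0), (321, 0), (389, 0), (448, 0)]
     [[], [], [(0, [9, 0, 1])], [(0, [9, 1, 2])], [(0, [9, 2, 3])], [(0, [9, 0, 4]), (0, [9, 3,
     4])], [(1, [9, 5, 0, 1, 2, 3]), (1, [9, 5, 2, 1, 0, 4]), (1, [9, 5, 1, 0, 4, 3]), (1, [9, 5, 0,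
     4, 3, 2])], [(0, [9, 2, 6]), (0, [9, 4, 6]), (0, [9, 5, 6]), (1, [5, 6, 3, 9, 1, 0]), (1, [0,
     1, 3, 9, 6, 5]), (1, [9, 1, 3, 4, 6, 5])], [(0, [9, 1, 7]), (0, [9, 4, 7]), (1, [9, 3, 0, 1, 7,
     5]), (1, [5, 7, 0, 9, 2, 3]), (1, [5, 7, 0, 9, 3, 2]), (1, [2, 3, 0, 9, 7, 5]), (1, [9, 2, 0,
     4, 7, 5]), (1, [9, 0, 2, 6, 5, 7])], [(0, [9, 1, 8]), (0, [9, 3, 8]), (0, [9, 5, 8]), (1, [9,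
     0, 2, 3, 8, 5]), (1, [5, 8, 2, 9, 4, 0]), (1, [0, 4, 2, 9, 8, 5]), (1, [9, 4, 2, 1, 8, 5]), (1,
     [9, 6, 0, 1, 8, 3]), (1, [9, 0, 6, 2, 3, 8]), (1, [9, 8, 0, 4, 6, 2]), (1, [9, 0, 2, 6, 5, 8]),
     (1, [9, 0, 3, 8, 5, 6]), (12, [9, 0, 4, 6, 2, 8, 3, 1, 5]), (12, [9, 0, 1, 8, 3, 6, 2, 4, 5]),
     (1, [9, 7, 6, 2, 3, 8])]]
     [(1, [9, 10, 1, 0, 4, 3]), (1, [9, 10, 2, 1, 0, 4]), (1, [9, 10, 1, 2, 3, 4]), (1, [9, 10, 2,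
     1, 8, 5]), (1, [9, 10, 3, 4, 6, 5]), (7, [0, 10, 9, 7, 1, 3, 2, 8, 4, 6]), (7, [0, 10, 9, 7, 4,
     2, 3, 6, 1, 8]), (7, [0, 9, 10, 7, 1, 3, 2, 8, 4, 6]), (7, [0, 9, 10, 7, 4, 2, 3, 6, 1, 8])],
   .dominated [0, 1, 2, 4, 9, 0, 52, 50] 5 4
     [[], [], [(0, [8, 0, 1])], [(0, [8, 1, 2])], [(0, [8, 2, 3])], [], [(1, [8, 5, 2, 1, 0, 4]),
     (1, [8, 5, 1, 0, 4, 3]), (1, [8, 5, 0, 4, 3, 2]), (1, [8, 5, 1, 2, 3, 4])], [(0, [8, 5, 6])],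
     [(0, [8, 5, 7]), (13, [3, 4, 0, 1, 2, 5, 8, 6, 7]), (12, [0, 8, 5, 7, 4, 2, 6, 3, 1]), (13, [0,
     4, 3, 2, 1, 5, 8, 7, 6])]],
   .coloured [0, 1, 2, 4, 9, 0, 52, 42]
     [2, 1, 0, 1, 0, 2, 1, 0]
     [(0, 2), (4, 2), (8, 2), (18, 2), (42, 0), (52, 1), (66, 0), (73, 0), (74, 0), (133, 1), (144,
     1), (148, 1), (192, 2)]
     [[], [], [(0, [8, 0, 1])], [(0, [8, 1, 2])], [(0, [8, 2, 3])], [(0, [8, 0, 4]), (0, [8, 3,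
     4])], [(1, [8, 5, 0, 1, 2, 3]), (1, [8, 5, 2, 1, 0, 4]), (1, [8, 5, 1, 0, 4, 3]), (1, [8, 5, 0,
     4, 3, 2])], [(0, [8, 2, 6]), (0, [8, 4, 6]), (0, [8, 5, 6]), (1, [5, 6, 3, 8, 1, 0]), (1, [0,
     1, 3, 8, 6, 5]), (1, [8, 0, 3, 2, 6, 5]), (1, [8, 1, 3, 4, 6, 5])], [(0, [8, 1, 7]), (0, [8, 3,
     7]), (0, [8, 5, 7]), (1, [8, 0, 2, 3, 7, 5]), (1, [5, 7, 2, 8, 4, 0]), (1, [0, 4, 2, 8, 7, 5]),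
     (1, [8, 4, 2, 1, 7, 5]), (14, [2, 3, 4, 0, 1, 5, 8, 7]), (1, [8, 6, 0, 1, 7, 3]), (1, [8, 0, 6,
     2, 3, 7]), (1, [8, 7, 0, 4, 6, 2]), (14, [8, 0, 4, 6, 2, 7, 3, 1]), (14, [8, 0, 1, 7, 3, 6, 2,
     4]), (14, [2, 3, 7, 5, 6, 0, 8, 4])]]
     [(1, [8, 9, 0, 1, 7, 5]), (1, [8, 9, 1, 0, 4, 3]), (1, [8, 9, 2, 6, 5, 7]), (1, [8, 9, 2, 1, 0,
     4]), (1, [8, 9, 3, 7, 5, 6]), (13, [5, 6, 2, 3, 7, 8, 1, 9, 4]), (13, [0, 1, 2, 3, 4, 8, 6, 9,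
     7])],
   .dominated [0, 1, 2, 4, 9, 0, 52] 5 2
     [[], [], [(0, [7, 0, 1])], [], [], [(0, [7, 0, 4]), (0, [7, 3, 4])], [(1, [7, 5, 0, 1, 2, 3]),
     (1, [7, 5, 2, 1, 0, 4]), (1, [7, 5, 0, 4, 3, 2]), (1, [7, 5, 1, 2, 3, 4])], [(0, [7, 5, 6]),
     (15, [5, 7, 3, 4, 6, 1, 2, 0]), (15, [5, 7, 3, 2, 6, 0, 4, 1]), (14, [3, 2, 1, 0, 4, 5, 7,
     6])]],
   .dominated [0, 1, 2, 4, 9, 0] 5 3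
     [[], [], [(0, [6, 0, 1])], [(0, [6, 1, 2])], [], [(0, [6, 0, 4])], [(1, [6, 5, 0, 1, 2, 3]),
     (1, [6, 5, 1, 0, 4, 3]), (1, [6, 5, 0, 4, 3, 2]), (1, [6, 5, 1, 2, 3, 4]), (16, [3, 4, 0, 1, 2,
     5, 6]), (16, [2, 3, 4, 0, 1, 5, 6]), (16, [0, 1, 2, 3, 4, 5, 6])]]]

theorem checkAll_exclusionSteps : checkAll baseRows exclusionSteps = true := by
  decide +kernel

variable {V : Type*} {G : SimpleGraph V}

/-- The table `t` is correct for the vertices `f 0, f 1, …` of `G`. -/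
def Describes (G : SimpleGraph V) (f : ℕ → V) (t : Table) : Prop :=
  ∀ a b c, t a b = some c → f a ≠ f b ∧ (G.Adj (f a) (f b) ↔ c = true)

/-- The graph with the given rows is an induced subgraph of `G`. -/
def Occurs (G : SimpleGraph V) (g : List ℕ) : Prop :=
  ∃ f : ℕ → V, Describes G f (ofRows g)

theorem ofRows_isSome {g : List ℕ} {a b : ℕ} (ha : a < g.length) (hb : b < g.length)
    (hab : a ≠ b) : ∃ c, ofRows g a b = some c := by
  unfold ofRows
  rcases lt_or_gt_of_ne hab with h | h
  · simp [h, hb]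
  · simp [h, h.not_gt, ha]

theorem describes_ofRows {f : ℕ → V} {g : List ℕ}
    (h : ∀ j < g.length, ∀ i < j,
      f i ≠ f j ∧ (G.Adj (f i) (f j) ↔ (g.getD j 0).testBit i = true)) :
    Describes G f (ofRows g) := by
  intro a b c hc
  unfold ofRows at hc
  split_ifs at hc with h1 h2
  · obtain ⟨r, hr, rfl⟩ := Option.map_eq_some_iff.mp hc
    obtain ⟨hb, rfl⟩ := List.getElem?_eq_some_iff.mp hr
    simpa [hb] using h b hb a h1
  · obtain ⟨r, hr, rfl⟩ := Option.map_eq_some_iff.mp hc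
    obtain ⟨hb, rfl⟩ := List.getElem?_eq_some_iff.mp hr
    have := h a hb b h2
    rw [G.adj_comm]
    simpa [hb, ne_comm] using this

theorem Describes.adj_iff {f : ℕ → V} {g : List ℕ} (h : Describes G f (ofRows g)) {a b : ℕ}
    (ha : a < g.length) (hb : b < g.length) :
    G.Adj (f a) (f b) ↔ ofRows g a b = some true := by
  by_cases hab : a = b
  · subst hab
    simp [ofRows]
  · obtain ⟨c, hc⟩ := ofRows_isSome ha hb hab
    rw [(h a b c hc).2, hc]
    simp

theorem Describes.extend {f : ℕ → V} {t : Table} (h : Describes G f t) {n i m : ℕ} {x : V}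
    (hi : i ≤ n) (hx : ∀ j < n, f j ≠ x) (hm : ∀ j < i, G.Adj x (f j) ↔ m.testBit j = true) :
    Describes G (Function.update f n x) (extend t n i m) := by
  intro a b c hc
  unfold PartialGraph.extend at hc
  split_ifs at hc with h1 h2 h3 h4
  · obtain rfl : m.testBit b = c := by simpa using hc
    have hb : b ≠ n := by omega
    subst h1
    simpa [Function.update_of_ne hb] using ⟨(hx b (by omega)).symm, hm b h2⟩
  · obtain rfl : m.testBit a = c := by simpa using hc
    subst h3
    simpa [Function.update_of_ne h1, G.adj_comm] using ⟨hx a (by omega), hm a h4⟩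
  · simpa [Function.update_of_ne h1, Function.update_of_ne h3] using h a b c hc

theorem Describes.occurs {f : ℕ → V} {t : Table} (h : Describes G f t) {K e : List ℕ}
    (he : embeds t K e = true) : Occurs G K := by
  refine ⟨fun i => f (e.getD i 0), describes_ofRows fun j hj i hij => ?_⟩
  have := List.all_eq_true.mp (List.all_eq_true.mp he j (List.mem_range.mpr hj)) i
    (List.mem_range.mpr hij)
  exact h _ _ _ (by simpa using this)

theorem Describes.not_hits {f : ℕ → V} {t : Table} (h : Describes G f t)
    {forb : List (List ℕ)} (hforb : ∀ K ∈ forb, ¬ Occurs G K) (l : List Config) :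
    ¬ l.any (hits forb t) = true := by
  intro hl
  obtain ⟨c, -, hc⟩ := List.any_eq_true.mp hl
  unfold hits at hc
  split at hc
  · rename_i K hK
    exact hforb K (List.mem_of_getElem? hK) (h.occurs hc)
  · simp at hc

theorem exists_leaf_of_cover {ok : ℕ → ℕ → Bool} {leaf : ℕ → Bool} {n : ℕ} {P : ℕ → Prop}
    (hok : ∀ i m, i ≤ n → (∀ j < i, P j ↔ m.testBit j = true) → ¬ ok i m = true) :
    ∀ k m, k ≤ n → m < 2 ^ (n - k) → (∀ j < n - k, P j ↔ m.testBit j = true) →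
      cover ok leaf n k m = true →
      ∃ m, leaf m = true ∧ ∀ j < n, P j ↔ m.testBit j = true := by
  intro k
  induction k with
  | zero =>
    intro m _ _ hm hc
    have := hok n m le_rfl hm
    exact ⟨m, by simpa [cover, this] using hc, hm⟩
  | succ k ih =>
    intro m hk hlt hm hc
    have h0 := hok (n - (k + 1)) m (by omega) hm
    simp only [cover, h0, Bool.false_or, Bool.and_eq_true] at hc
    have hnk : n - k = n - (k + 1) + 1 := by omega
    have hle : 2 ^ (n - (k + 1)) ≤ 2 ^ (n - k) := Nat.pow_le_pow_right (by norm_num) (by omega)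
    by_cases hP : P (n - (k + 1))
    · refine ih _ (by omega) (Nat.or_lt_two_pow (by omega) ?_) ?_ hc.2
      · exact Nat.pow_lt_pow_right (by norm_num) (by omega)
      · intro j hj
        rcases Nat.lt_succ_iff_lt_or_eq.mp (hnk ▸ hj) with h | rfl
        · simp [hm j h, Nat.testBit_two_pow_of_ne h.ne']
        · simp [hP]
    · refine ih m (by omega) (by omega) ?_ hc.1
      intro j hj
      rcases Nat.lt_succ_iff_lt_or_eq.mp (hnk ▸ hj) with h | rfl
      · exact hm j h
      · simp [hP, Nat.testBit_lt_two_pow hlt]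

theorem exists_leaf_of_cover_zero {ok : ℕ → ℕ → Bool} {leaf : ℕ → Bool} {n : ℕ} {P : ℕ → Prop}
    (hok : ∀ i m, i ≤ n → (∀ j < i, P j ↔ m.testBit j = true) → ¬ ok i m = true)
    (hc : cover ok leaf n n 0 = true) :
    ∃ m, leaf m = true ∧ ∀ j < n, P j ↔ m.testBit j = true :=
  exists_leaf_of_cover hok n 0 le_rfl (by simp) (by simp) hc

theorem not_occurs_of_dominated {forb : List (List ℕ)} (hforb : ∀ K ∈ forb, ¬ Occurs G K)
    (hdom : ∀ u v, u ≠ v → ∃ x, G.Adj u x ∧ ¬ G.Adj v x) {g : List ℕ} {a b : ℕ}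
    {bad : List (List Config)} (hs : (Step.dominated g a b bad).check forb = true) :
    ¬ Occurs G g := by
  rintro ⟨f, hf⟩
  simp only [Step.check, Bool.and_eq_true, bne_iff_ne, ne_eq, Nat.blt_eq, List.all_eq_true,
    List.mem_range, Bool.or_eq_true, beq_iff_eq] at hs
  obtain ⟨⟨⟨⟨hab, ha⟩, hb⟩, hsub⟩, hcov⟩ := hs
  obtain ⟨c, hc⟩ := ofRows_isSome ha hb hab
  obtain ⟨x, hax, hbx⟩ := hdom (f a) (f b) (hf _ _ _ hc).1
  have hx : ∀ j < g.length, f j ≠ x := by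
    rintro j hj rfl
    rw [hf.adj_iff ha hj] at hax
    rw [hf.adj_iff hb hj] at hbx
    exact (hsub j hj).elim (fun h => h hax) hbx
  obtain ⟨m, hm, -⟩ := exists_leaf_of_cover_zero (P := fun j => G.Adj x (f j))
    (fun i m hi hm hok => by
      simp only [Bool.or_eq_true, Bool.and_eq_true, Nat.blt_eq, Bool.not_eq_true'] at hok
      rcases hok with (⟨h1, h2⟩ | ⟨h1, h2⟩) | h
      · have := (hm a h1).mp hax.symm
        simp [h2] at this
      · exact hbx ((hm b h1).mpr h2).symm
      · exact (hf.extend hi hx hm).not_hits hforb _ h) hcov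
  simp at hm

theorem colorable_of_coloured {forb : List (List ℕ)} (hforb : ∀ K ∈ forb, ¬ Occurs G K)
    {g own : List ℕ} {types : List (ℕ × ℕ)} {bad : List (List Config)} {badPair : List Config}
    (hs : (Step.coloured g own types bad badPair).check forb = true) (hg : Occurs G g) :
    G.Colorable 3 := by
  obtain ⟨f, hf⟩ := hg
  simp only [Step.check, Bool.and_eq_true, bne_iff_ne, ne_eq, Nat.blt_eq, List.all_eq_true,
    List.mem_range, Bool.or_eq_true, Bool.not_eq_true'] at hs
  obtain ⟨⟨⟨⟨⟨hown, htypes⟩, hoo⟩, hto⟩, htt⟩, hcov⟩ := hs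
  have key : ∀ x, ∃ k : ℕ, k < 3 ∧ ((∃ c < g.length, f c = x ∧ own.getD c 0 = k) ∨
      ((∀ c < g.length, f c ≠ x) ∧ ∃ m, (m, k) ∈ types ∧
        ∀ j < g.length, G.Adj x (f j) ↔ m.testBit j = true)) := by
    intro x
    by_cases hx : ∃ c < g.length, f c = x
    · obtain ⟨c, hc, rfl⟩ := hx
      exact ⟨_, hown c hc, Or.inl ⟨c, hc, rfl, rfl⟩⟩
    · push Not at hx
      obtain ⟨m, hm, hadj⟩ := exists_leaf_of_cover_zero (P := fun j => G.Adj x (f j))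
        (fun i m hi hm => (hf.extend hi hx hm).not_hits hforb _) hcov
      obtain ⟨⟨m', k⟩, hk, h⟩ := List.any_eq_true.mp hm
      obtain rfl : m' = m := by simpa using h
      exact ⟨k, htypes _ hk, Or.inr ⟨hx, m', hk, hadj⟩⟩
  choose col hcol3 hcol using key
  refine ⟨SimpleGraph.Coloring.mk (fun x => (⟨col x, hcol3 x⟩ : Fin 3)) ?_⟩
  intro x y hxy heq
  have heq : col x = col y := congrArg Fin.val heq
  rcases hcol x with ⟨c, hc, rfl, hcx⟩ | ⟨hx, m, hm, hmx⟩ <;>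
    rcases hcol y with ⟨d, hd, rfl, hdy⟩ | ⟨hy, m', hm', hmy⟩
  · exact (hoo c hc d hd).elim (fun h => h ((hf.adj_iff hc hd).mp hxy))
      (fun h => h (by rw [hcx, hdy, heq]))
  · rcases hto _ hm' c hc with h | h
    · have := (hmy c hc).mp hxy.symm
      simp [h] at this
    · exact h (by rw [hcx, heq])
  · rcases hto _ hm d hd with h | h
    · have := (hmx d hd).mp hxy
      simp [h] at this
    · exact h (by rw [hdy, heq])
  · rcases htt _ hm _ hm' with h | h
    · exact h heq
    · refine ((hf.extend le_rfl hx hmx).extend (x := y) le_rfl ?_ ?_).not_hits hforb _ h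
      · intro j hj
        rcases Nat.lt_succ_iff_lt_or_eq.mp hj with h | rfl
        · simpa [Function.update_of_ne h.ne] using hy j h
        · simpa using hxy.ne
      · intro j hj
        rcases Nat.lt_succ_iff_lt_or_eq.mp hj with h | rfl
        · simpa [Function.update_of_ne h.ne, Nat.testBit_two_pow_of_ne h.ne'] using hmy j h
        · simpa using hxy.symm

theorem not_occurs_of_checkAll (hcol : ¬ G.Colorable 3)
    (hdom : ∀ u v, u ≠ v → ∃ x, G.Adj u x ∧ ¬ G.Adj v x) :
    ∀ (steps : List Step) (forb : List (List ℕ)), (∀ K ∈ forb, ¬ Occurs G K) →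
      checkAll forb steps = true → ∀ s ∈ steps, ¬ Occurs G s.graph := by
  intro steps
  induction steps with
  | nil => simp
  | cons s steps ih =>
    intro forb hforb hc
    simp only [checkAll, Bool.and_eq_true] at hc
    have hs : ¬ Occurs G s.graph := by
      cases s with
      | dominated g a b bad => exact not_occurs_of_dominated hforb hdom hc.1
      | coloured g own types bad badPair => exact fun h => hcol (colorable_of_coloured hforb hc.1 h)
    intro s' hs'
    rcases List.mem_cons.mp hs' with rfl | h
    · exact hs
    · refine ih _ ?_ hc.2 s' h
      intro K hK
      rcases List.mem_append.mp hK with h | h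
      · exact hforb K h
      · rw [List.mem_singleton.mp h]
        exact hs

/-- A shortest odd cycle of `G`, as an induced cycle `p 0, …, p (L - 1)`. -/
theorem exists_induced_odd_cycle (h : ¬ G.Colorable 2) :
    ∃ (L : ℕ) (p : ℕ → V), Odd L ∧ 3 ≤ L ∧ ∀ j < L, ∀ i < j,
      p i ≠ p j ∧ (G.Adj (p i) (p j) ↔ j = i + 1 ∨ (i = 0 ∧ j + 1 = L)) := by
  classical
  have hex : ∃ L, Odd L ∧ ∃ (u : V) (w : G.Walk u u), w.length = L := by
    rw [two_colorable_iff_forall_loop_even] at h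
    push Not at h
    obtain ⟨u, w, hw⟩ := h
    exact ⟨w.length, by simpa using hw, u, w, rfl⟩
  have hmin : ∀ {u : V} (w : G.Walk u u), Odd w.length → Nat.find hex ≤ w.length :=
    fun w hw => Nat.find_min' hex ⟨hw, _, w, rfl⟩
  obtain ⟨hodd, u, w, hw⟩ := Nat.find_spec hex
  generalize Nat.find hex = L at *
  have hL : L ≠ 1 := by
    rintro rfl
    exact G.loopless.irrefl u (w.adj_of_length_eq_one hw)
  obtain ⟨k, hk⟩ := hodd
  refine ⟨L, w.getVert, ⟨k, hk⟩, by omega, fun j hj i hij => ?_⟩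
  obtain ⟨q, hq⟩ : ∃ q : G.Walk (w.getVert i) (w.getVert j), q.length = j - i := by
    refine ⟨((w.drop i).take (j - i)).copy rfl ?_, ?_⟩
    · rw [Walk.drop_getVert]
      congr 1
      omega
    · simp only [Walk.length_copy, Walk.take_length, Walk.drop_length]
      omega
  obtain ⟨r, hr⟩ : ∃ r : G.Walk (w.getVert j) (w.getVert i), r.length = L - (j - i) := by
    refine ⟨(w.drop j).append (w.take i), ?_⟩
    simp only [Walk.length_append, Walk.take_length, Walk.drop_length]
    omega
  refine ⟨fun heq => ?_, fun hadj => ?_, ?_⟩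
  · have h1 := hmin (q.copy rfl heq.symm)
    have h2 := hmin (r.copy rfl heq)
    simp only [Walk.length_copy, hq, hr, Nat.odd_iff] at h1 h2
    omega
  · have h1 := hmin (Walk.cons hadj.symm q)
    have h2 := hmin (Walk.cons hadj r)
    simp only [Walk.length_cons, hq, hr, Nat.odd_iff] at h1 h2
    omega
  · rintro (rfl | ⟨rfl, hj'⟩)
    · exact w.adj_getVert_succ (by omega)
    · have := w.adj_getVert_succ (i := j) (by omega)
      rw [hj', ← hw, w.getVert_length] at this
      simpa using this.symm

theorem containsInduced_of_occurs {k : ℕ} {H : SimpleGraph (Fin k)} {K : List ℕ}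
    (hK : ∀ a b : Fin k, a < b → ∃ c, ofRows K a b = some c ∧ (H.Adj a b ↔ c = true))
    (h : Occurs G K) : ContainsInduced H G := by
  obtain ⟨f, hf⟩ := h
  have key : ∀ a b : Fin k, a < b → f a ≠ f b ∧ (G.Adj (f a) (f b) ↔ H.Adj a b) := by
    intro a b hab
    obtain ⟨c, hc, hH⟩ := hK a b hab
    exact ⟨(hf _ _ _ hc).1, (hf _ _ _ hc).2.trans hH.symm⟩
  refine ⟨⟨fun a => f a, fun a b hab => ?_⟩, fun a b => ?_⟩
  · rcases lt_trichotomy a b with h | h | h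
    · exact absurd hab (key a b h).1
    · exact h
    · exact absurd hab.symm (key b a h).1
  · rcases lt_trichotomy a b with h | rfl | h
    · exact (key a b h).2
    · simp
    · rw [G.adj_comm, H.adj_comm]
      exact (key b a h).2

theorem containsInduced_triangle_of_occurs (h : Occurs G [0, 1, 3]) :
    ContainsInduced TriangleGraph G := by
  refine containsInduced_of_occurs ?_ h
  simp only [TriangleGraph, top_adj]
  decide

theorem containsInduced_P2UnionP4_of_occurs (h : Occurs G [0, 1, 0, 4, 8, 16]) :
    ContainsInduced P2UnionP4 G := by
  refine containsInduced_of_occurs ?_ h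
  simp only [P2UnionP4, fromEdgeSet_adj, Set.mem_insert_iff, Set.mem_singleton_iff]
  decide

theorem containsInduced_cycle5_of_occurs (h : Occurs G [0, 1, 2, 4, 9]) :
    ContainsInduced Cycle5 G := by
  refine containsInduced_of_occurs ?_ h
  simp only [Cycle5, fromEdgeSet_adj, Set.mem_insert_iff, Set.mem_singleton_iff]
  decide

theorem containsInduced_cycle7_of_occurs (h : Occurs G [0, 1, 2, 4, 8, 16, 33]) :
    ContainsInduced Cycle7 G := by
  refine containsInduced_of_occurs ?_ h
  simp only [Cycle7, fromEdgeSet_adj, Set.mem_insert_iff, Set.mem_singleton_iff]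
  decide

theorem containsInduced_grotzsch_of_occurs
    (h : Occurs G [0, 1, 1, 1, 1, 1, 18, 100, 138, 276, 616]) :
    ContainsInduced GrotzschGraph G := by
  refine containsInduced_of_occurs ?_ h
  simp only [GrotzschGraph, fromEdgeSet_adj, Set.mem_insert_iff, Set.mem_singleton_iff]
  decide +kernel

/-- A non-bipartite graph without triangles and induced `P2 ∪ P4` has an induced cycle of
length 5 or 7. -/
theorem exists_cycle5_or_cycle7 (hP : ¬ ContainsInduced P2UnionP4 G)
    (hC3 : ¬ ContainsInduced TriangleGraph G) (h : ¬ G.Colorable 2) :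
    Occurs G [0, 1, 2, 4, 9] ∨ Occurs G [0, 1, 2, 4, 8, 16, 33] := by
  obtain ⟨L, p, hodd, hL, hp⟩ := exists_induced_odd_cycle h
  obtain ⟨k, hk⟩ := hodd
  have hk : k = 1 ∨ k = 2 ∨ k = 3 ∨ 9 ≤ L := by omega
  rcases hk with rfl | rfl | rfl | hL
  · refine absurd (containsInduced_triangle_of_occurs ⟨p, describes_ofRows ?_⟩) hC3
    intro j hj i hij
    refine ⟨(hp j (by simp at hj; omega) i hij).1, ?_⟩
    rw [(hp j (by simp at hj; omega) i hij).2]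
    subst hk
    revert i j
    decide
  · refine Or.inl ⟨p, describes_ofRows ?_⟩
    intro j hj i hij
    refine ⟨(hp j (by simp at hj; omega) i hij).1, ?_⟩
    rw [(hp j (by simp at hj; omega) i hij).2]
    subst hk
    revert i j
    decide
  · refine Or.inr ⟨p, describes_ofRows ?_⟩
    intro j hj i hij
    refine ⟨(hp j (by simp at hj; omega) i hij).1, ?_⟩
    rw [(hp j (by simp at hj; omega) i hij).2]
    subst hk
    revert i j
    decide
  · have hs : ∀ j < 6, ∀ i < j, (if i < 2 then i else i + 1) < (if j < 2 then j else j + 1) := by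
      decide
    refine absurd (containsInduced_P2UnionP4_of_occurs
      ⟨fun i => p (if i < 2 then i else i + 1), describes_ofRows ?_⟩) hP
    intro j hj i hij
    have hj' : j < 6 := hj
    have := hp (if j < 2 then j else j + 1) (by split_ifs <;> omega) _ (hs j hj' i hij)
    refine ⟨this.1, this.2.trans ?_⟩
    have hne : ¬ ((if j < 2 then j else j + 1) + 1 = L) := by split_ifs <;> omega
    simp only [hne, and_false, or_false]
    clear hne this hj
    revert i hij
    revert j
    decide

theorem colorable_of_comap {W : Type*} {H : SimpleGraph W} {n : ℕ} (hH : ContainsInduced H G)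
    (h : G.Colorable n) : H.Colorable n := by
  obtain ⟨f, hf⟩ := hH
  exact h.of_hom (⟨f, fun hab => (hf _ _).mpr hab⟩ : H →g G)

theorem containsInduced_trans {U W : Type*} {F : SimpleGraph U} {H : SimpleGraph W}
    (hF : ContainsInduced F H) (hH : ContainsInduced H G) : ContainsInduced F G := by
  obtain ⟨f, hf⟩ := hF
  obtain ⟨g, hg⟩ := hH
  exact ⟨f.trans g, fun a b => (hg _ _).trans (hf a b)⟩

theorem containsInduced_induce (s : Set V) : ContainsInduced (G.induce s) G :=
  ⟨Function.Embedding.subtype _, fun _ _ => Iff.rfl⟩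

/-- The neighbours of a vertex can be given one colour when the rest is bipartite. -/
theorem colorable_three_of_induce (hC3 : ¬ ContainsInduced TriangleGraph G) (x : V)
    (h : (G.induce {y | ¬ G.Adj x y}).Colorable 2) : G.Colorable 3 := by
  classical
  obtain ⟨c⟩ := h
  refine ⟨SimpleGraph.Coloring.mk (fun y => if hy : G.Adj x y then 2 else (c ⟨y, hy⟩).castSucc) ?_⟩
  intro y z hyz heq
  by_cases hy : G.Adj x y <;> by_cases hz : G.Adj x z <;>
    simp only [hy, hz, dite_true, dite_false] at heq
  · refine hC3 (containsInduced_triangle_of_occurs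
      ⟨fun i => if i = 0 then x else if i = 1 then y else z, describes_ofRows ?_⟩)
    intro j hj i hij
    have hj : j < 3 := hj
    have h3 : Nat.testBit 3 1 = true := by decide
    interval_cases j <;> interval_cases i <;> simp [hy, hz, hyz, hy.ne, hz.ne, hyz.ne, h3]
  · exact (c ⟨z, hz⟩).castSucc_lt_last.ne' heq
  · exact (c ⟨y, hy⟩).castSucc_lt_last.ne heq
  · have hadj : (G.induce {y | ¬ G.Adj x y}).Adj ⟨y, hy⟩ ⟨z, hz⟩ := hyz
    exact c.valid hadj (Fin.castSucc_injective _ heq)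

theorem not_colorable_two_cycle5 : ¬ Cycle5.Colorable 2 := by
  rintro ⟨c⟩
  have h : ∀ a b, Cycle5.Adj a b → c a ≠ c b := fun a b => c.valid
  simp only [Cycle5, fromEdgeSet_adj, Set.mem_insert_iff, Set.mem_singleton_iff] at h
  have h01 := h 0 1 (by decide)
  have h12 := h 1 2 (by decide)
  have h23 := h 2 3 (by decide)
  have h34 := h 3 4 (by decide)
  have h04 := h 0 4 (by decide)
  omega

theorem not_colorable_two_cycle7 : ¬ Cycle7.Colorable 2 := by
  rintro ⟨c⟩
  have h : ∀ a b, Cycle7.Adj a b → c a ≠ c b := fun a b => c.valid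
  simp only [Cycle7, fromEdgeSet_adj, Set.mem_insert_iff, Set.mem_singleton_iff] at h
  have h01 := h 0 1 (by decide)
  have h12 := h 1 2 (by decide)
  have h23 := h 2 3 (by decide)
  have h34 := h 3 4 (by decide)
  have h45 := h 4 5 (by decide)
  have h56 := h 5 6 (by decide)
  have h06 := h 0 6 (by decide)
  omega

theorem not_colorable_three_grotzsch : ¬ GrotzschGraph.Colorable 3 := by
  rintro ⟨c⟩
  have h : ∀ a b, GrotzschGraph.Adj a b → c a ≠ c b := fun a b => c.valid
  simp only [GrotzschGraph, fromEdgeSet_adj, Set.mem_insert_iff, Set.mem_singleton_iff] at h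
  have key : ∀ x0 x6 x7 : Fin 3, x6 ≠ x7 → ∀ x8, x7 ≠ x8 → ∀ x9, x8 ≠ x9 → ∀ x10, x9 ≠ x10 →
      x6 ≠ x10 → ∀ x1, x0 ≠ x1 → x1 ≠ x6 → x1 ≠ x8 → ∀ x2, x0 ≠ x2 → x2 ≠ x7 → x2 ≠ x9 →
      ∀ x3, x0 ≠ x3 → x3 ≠ x8 → x3 ≠ x10 → ∀ x4, x0 ≠ x4 → x4 ≠ x9 → x4 ≠ x6 →
      ∀ x5, x0 ≠ x5 → x5 ≠ x10 → x5 ≠ x7 → False := by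
    decide +kernel
  exact key (c 0) (c 6) (c 7) (h 6 7 (by decide)) (c 8) (h 7 8 (by decide)) (c 9)
    (h 8 9 (by decide)) (c 10) (h 9 10 (by decide)) (h 6 10 (by decide))
    (c 1) (h 0 1 (by decide)) (h 1 6 (by decide)) (h 1 8 (by decide))
    (c 2) (h 0 2 (by decide)) (h 2 7 (by decide)) (h 2 9 (by decide))
    (c 3) (h 0 3 (by decide)) (h 3 8 (by decide)) (h 3 10 (by decide))
    (c 4) (h 0 4 (by decide)) (h 4 9 (by decide)) (h 4 6 (by decide))
    (c 5) (h 0 5 (by decide)) (h 5 10 (by decide)) (h 5 7 (by decide))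

theorem occurs_append_isolated {x : V} {g : List ℕ} (hg : Occurs (G.induce {y | ¬ G.Adj x y}) g)
    (hdeg : ∀ i < g.length, ∃ j < g.length, ofRows g i j = some true) :
    Occurs G (g ++ [0]) := by
  obtain ⟨f, hf⟩ := hg
  refine ⟨Function.update (fun i => (f i : V)) g.length x, describes_ofRows fun j hj i hij => ?_⟩
  have hj : j < g.length + 1 := by simpa using hj
  have hi : i < g.length := by omega
  rcases Nat.lt_succ_iff_lt_or_eq.mp hj with hj | rfl
  · obtain ⟨c, hc⟩ := ofRows_isSome hi hj hij.ne
    have h := hf i j c hc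
    have hc' : (g.getD j 0).testBit i = c := by simpa [ofRows, hij, hj] using hc
    simp only [Function.update_of_ne hi.ne, Function.update_of_ne hj.ne]
    rw [List.getD_append _ _ _ _ hj, hc']
    exact ⟨fun he => h.1 (Subtype.ext he), h.2⟩
  · simp only [Function.update_of_ne hi.ne, Function.update_self]
    have hfi : ¬ G.Adj x (f i) := (f i).2
    refine ⟨?_, by simpa [G.adj_comm] using hfi⟩
    intro he
    obtain ⟨k, hk, hik⟩ := hdeg i hi
    have hadj : G.Adj (f i) (f k) := (hf i k _ hik).2.mpr rfl
    rw [he] at hadj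
    exact (f k).2 hadj

theorem colorable_three_of_no_dominated (hP : ¬ ContainsInduced P2UnionP4 G)
    (hC3 : ¬ ContainsInduced TriangleGraph G) (hF : ¬ ContainsInduced GrotzschGraph G)
    (hdom : ∀ u v, u ≠ v → ∃ x, G.Adj u x ∧ ¬ G.Adj v x) : G.Colorable 3 := by
  by_contra hcol
  have hexcl := not_occurs_of_checkAll hcol hdom exclusionSteps baseRows (by
    simp only [baseRows, List.forall_mem_cons, List.not_mem_nil, false_imp_iff, implies_true,
      and_true]
    exact ⟨fun h => hC3 (containsInduced_triangle_of_occurs h),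
      fun h => hP (containsInduced_P2UnionP4_of_occurs h),
      fun h => hF (containsInduced_grotzsch_of_occurs h)⟩) checkAll_exclusionSteps
  rcases isEmpty_or_nonempty V with hV | ⟨⟨x⟩⟩
  · exact hcol (.of_isEmpty 3)
  have hx : ¬ (G.induce {y | ¬ G.Adj x y}).Colorable 2 :=
    fun h => hcol (colorable_three_of_induce hC3 x h)
  rcases exists_cycle5_or_cycle7 (fun h => hP (containsInduced_trans h (containsInduced_induce _)))
    (fun h => hC3 (containsInduced_trans h (containsInduced_induce _))) hx with h | h
  · have h5 : [0, 1, 2, 4, 9, 0] ∈ exclusionSteps.map Step.graph := by decide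
    obtain ⟨s, hs, hs'⟩ := List.mem_map.mp h5
    exact hexcl s hs (hs' ▸ occurs_append_isolated h (by decide))
  · have h7 : [0, 1, 2, 4, 8, 16, 33, 0] ∈ exclusionSteps.map Step.graph := by decide
    obtain ⟨s, hs, hs'⟩ := List.mem_map.mp h7
    exact hexcl s hs (hs' ▸ occurs_append_isolated h (by decide))

theorem colorable_three_of_free [Finite V] (hP : ¬ ContainsInduced P2UnionP4 G)
    (hC3 : ¬ ContainsInduced TriangleGraph G) (hF : ¬ ContainsInduced GrotzschGraph G) :
    G.Colorable 3 := by
  classical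
  induction hn : Nat.card V using Nat.strong_induction_on generalizing V with
  | _ n ih =>
  by_cases hdom : ∀ u v, u ≠ v → ∃ x, G.Adj u x ∧ ¬ G.Adj v x
  · exact colorable_three_of_no_dominated hP hC3 hF hdom
  push Not at hdom
  obtain ⟨u, v, huv, hN⟩ := hdom
  have hlt : Nat.card ↑{y | y ≠ u} < n := hn ▸ Finite.card_subtype_lt (x := u) (by simp)
  obtain ⟨c⟩ := ih _ hlt (G := G.induce {y | y ≠ u})
    (fun h => hP (containsInduced_trans h (containsInduced_induce _)))
    (fun h => hC3 (containsInduced_trans h (containsInduced_induce _)))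
    (fun h => hF (containsInduced_trans h (containsInduced_induce _))) rfl
  have hvalid : ∀ (y z : {y // y ≠ u}), G.Adj y z → c y ≠ c z := fun y z h => c.valid h
  refine ⟨SimpleGraph.Coloring.mk (fun y => if hy : y = u then c ⟨v, huv.symm⟩ else c ⟨y, hy⟩) ?_⟩
  intro y z hyz
  by_cases hy : y = u <;> by_cases hz : z = u <;> simp only [hy, hz, dite_true, dite_false]
  · exact absurd (hy.trans hz.symm) hyz.ne
  · exact hvalid ⟨v, huv.symm⟩ ⟨z, hz⟩ (hN z (hy ▸ hyz))
  · exact hvalid ⟨y, hy⟩ ⟨v, huv.symm⟩ (hN y (hz ▸ hyz.symm)).symm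
  · exact hvalid ⟨y, hy⟩ ⟨z, hz⟩ hyz

end PartialGraph

open PartialGraph

theorem statement_6 {V : Type*} [Fintype V] (G : SimpleGraph V)
    (hconn : G.Connected)
    (hP : ¬ ContainsInduced P2UnionP4 G)
    (hC3 : ¬ ContainsInduced TriangleGraph G) :
    G.chromaticNumber = 3 ↔
      ((ContainsInduced Cycle5 G ∨ ContainsInduced Cycle7 G) ∧
        ¬ ContainsInduced GrotzschGraph G) := by
  have hchi : G.chromaticNumber = 3 ↔ G.Colorable 3 ∧ ¬ G.Colorable 2 := by
    exact chromaticNumber_eq_iff_colorable_not_colorable (n := 2)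
  rw [hchi]
  constructor
  · rintro ⟨h3, h2⟩
    refine ⟨(exists_cycle5_or_cycle7 hP hC3 h2).imp containsInduced_cycle5_of_occurs
      containsInduced_cycle7_of_occurs, fun hF => ?_⟩
    exact not_colorable_three_grotzsch (colorable_of_comap hF h3)
  · rintro ⟨hC, hF⟩
    refine ⟨colorable_three_of_free hP hC3 hF, fun h2 => ?_⟩
    rcases hC with hC | hC
    · exact not_colorable_two_cycle5 (colorable_of_comap hC h2)
    · exact not_colorable_two_cycle7 (colorable_of_comap hC h2)
end

section
/- The Grötzsch graph F1 is, up to isomorphism, the unique 4-vertex-critical graph in the class of (P2∪P4, C3)-free simple graphs; that is, a (P2∪P4, C3)-free graph G satisfies χ(G) = 4 and χ(H) < 4 for every proper induced subgraph H of G, if and only if G is isomorphic to F1. -/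
open SimpleGraph

/-! ### Certified refutations

A graph on `0, …, n - 1` is coded by the list `A` of its rows, the bits `i < j` of `A[j]` being the
neighbours of `j`. Relative to `n` marked vertices, the *type* of another vertex is the number whose
bits are its marked neighbours. -/

namespace Refute

/-- Adjacency in the graph coded by `A`. -/
def adjB (A : List ℕ) (i j : ℕ) : Bool :=
  if i < j then (A.getD j 0).testBit i else if j < i then (A.getD i 0).testBit j else false

/-- `t` lists the images of the vertices of `K` under an induced embedding into `A`. -/
def isCopy (K A t : List ℕ) : Bool :=
  t.all (fun i => decide (i < A.length)) && ((List.range K.length).all fun j =>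
    (List.range j).all fun i => t.getD i 0 != t.getD j 0 &&
      adjB A (t.getD i 0) (t.getD j 0) == adjB K i j) && t.length == K.length

/-- A copy of the `idx`-th forbidden graph, to be tried on the types that agree with `pat`
on `mask`. -/
structure Copy where
  mask : ℕ
  pat : ℕ
  idx : ℕ
  img : List ℕ

/-- Some listed copy is a forbidden subgraph of the graph coded by `A`. -/
def excluded (forb : List (List ℕ)) (ws : List Copy) (Z : ℕ) (A : List ℕ) : Bool :=
  ws.any fun w => Z &&& w.mask == w.pat && (forb[w.idx]?).any fun K => isCopy K A w.img

/-- The refutations of a partial graph: a 3-colouring of the marked vertices and of the remaining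
types, a marked vertex dominated by another one, or a case distinction on the existence of a vertex
of a given type. -/
inductive Tree where
  | color (vs cs : List ℕ) (ws : List Copy)
  | dom (a b : ℕ)
  | split (M : ℕ) (ws : List Copy) (yes no : Tree)

/-- The types that remain possible after a vertex of type `M` has been marked. -/
def extend (forb : List (List ℕ)) (ws : List Copy) (A C : List ℕ) (M : ℕ) : List ℕ :=
  (C.flatMap fun X => if X &&& M == 0 then [X, 2 ^ A.length + X] else [X]).filter fun X =>
    !excluded forb ws X (A ++ [M, X])

/-- Vertices of the types `p.1` and `q.1` may receive the colours `p.2` and `q.2`. -/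
def compatible (forb : List (List ℕ)) (ws : List Copy) (A : List ℕ) (p q : ℕ × ℕ) : Bool :=
  p.2 != q.2 || p.1 &&& q.1 != 0 ||
    excluded forb ws (p.1 + q.1 <<< A.length) (A ++ [p.1, 2 ^ A.length + q.1])

/-- `r` relates every member of the list to itself and to all later members. -/
def allPairs {α : Type*} (r : α → α → Bool) : List α → Bool
  | [] => true
  | a :: l => (a :: l).all (r a) && allPairs r l

/-- Checks a colouring of the marked vertices and of the types. -/
def checkColor (forb : List (List ℕ)) (vs cs : List ℕ) (ws : List Copy) (A C : List ℕ) : Bool :=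
  decide (C.length ≤ cs.length) && vs.all (fun c => decide (c < 3)) &&
    cs.all (fun c => decide (c < 3)) &&
    ((List.range A.length).all fun j => (List.range j).all fun i =>
      !adjB A i j || vs.getD i 0 != vs.getD j 0) &&
    ((C.zip cs).all fun p => (List.range A.length).all fun i =>
      !p.1.testBit i || vs.getD i 0 != p.2) &&
    allPairs (compatible forb ws A) (C.zip cs)

/-- Checks a refutation of the partial graph `A` with remaining types `C`. -/
def check (forb : List (List ℕ)) : Tree → List ℕ → List ℕ → Bool
  | .color vs cs ws, A, C => checkColor forb vs cs ws A C
  | .dom a b, A, C => decide (a < A.length) && decide (b < A.length) && a != b &&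
      ((List.range A.length).all fun i => !adjB A a i || adjB A b i) &&
      C.all fun X => !X.testBit a || X.testBit b
  | .split M ws yes no, A, C =>
      check forb yes (A ++ [M]) (extend forb ws A C M) && check forb no A (C.filter (· != M))

/-- Checks a refutation of the graph coded by `A`, the copies `ws` bounding the initial types. -/
def checkStart (forb : List (List ℕ)) (A : List ℕ) (ws : List Copy) (t : Tree) : Bool :=
  check forb t A ((List.range (2 ^ A.length)).filter fun X => !excluded forb ws X (A ++ [X]))

variable {V : Type*} {G : SimpleGraph V}

/-- `v` is none of the first `n` marked vertices, and has type `X`. -/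
def HasType (G : SimpleGraph V) (f : ℕ → V) (n : ℕ) (v : V) (X : ℕ) : Prop :=
  ∀ i < n, f i ≠ v ∧ (G.Adj (f i) v ↔ X.testBit i = true)

/-- The marked vertices `f 0, f 1, …` induce the graph coded by `A`. -/
def Represents (G : SimpleGraph V) (f : ℕ → V) (A : List ℕ) : Prop :=
  ∀ j < A.length, HasType G f j (f j) (A.getD j 0)

/-- Every unmarked vertex has one of the types in `C`. -/
def Covers (G : SimpleGraph V) (f : ℕ → V) (n : ℕ) (C : List ℕ) : Prop :=
  ∀ v, (∀ i < n, f i ≠ v) → ∃ X ∈ C, X < 2 ^ n ∧ HasType G f n v X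

/-- `G` avoids the graphs in `forb`, is triangle-free and not 3-colourable, and no vertex of `G`
dominates another one. -/
structure Setting (G : SimpleGraph V) (forb : List (List ℕ)) : Prop where
  free : ∀ K ∈ forb, ∀ f, ¬ Represents G f K
  tri : ∀ a b c, G.Adj a b → G.Adj b c → ¬ G.Adj a c
  undominated : ∀ a b, a ≠ b → ∃ w, G.Adj a w ∧ ¬ G.Adj b w
  not_colorable : ¬ G.Colorable 3

theorem Represents.ne {f : ℕ → V} {A : List ℕ} (h : Represents G f A) {i j : ℕ}
    (hi : i < A.length) (hj : j < A.length) (hij : i ≠ j) : f i ≠ f j := by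
  rcases lt_or_gt_of_ne hij with h' | h'
  · exact (h j hj i h').1
  · exact ((h i hi j h').1).symm

theorem Represents.adj_iff {f : ℕ → V} {A : List ℕ} (h : Represents G f A) {i j : ℕ}
    (hi : i < A.length) (hj : j < A.length) : G.Adj (f i) (f j) ↔ adjB A i j = true := by
  unfold adjB
  rcases lt_trichotomy i j with h' | rfl | h'
  · simpa [h'] using (h j hj i h').2
  · simp
  · simpa [h', h'.le, not_lt_of_gt h', G.adj_comm (f i)] using (h i hi j h').2

theorem HasType.update {f : ℕ → V} {n m : ℕ} {v w : V} {X : ℕ} (h : HasType G f n v X)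
    (hm : n ≤ m) : HasType G (Function.update f m w) n v X := by
  intro i hi
  rw [Function.update_of_ne (by omega)]
  exact h i hi

theorem Represents.append {f : ℕ → V} {A : List ℕ} {w : V} {M : ℕ} (h : Represents G f A)
    (hw : HasType G f A.length w M) :
    Represents G (Function.update f A.length w) (A ++ [M]) := by
  intro j hj
  simp only [List.length_append, List.length_singleton] at hj
  rcases Nat.lt_succ_iff_lt_or_eq.1 hj with h' | rfl
  · rw [Function.update_of_ne h'.ne, List.getD_append _ _ _ _ h']
    exact (h j h').update h'.le
  · simpa using hw.update le_rfl

theorem HasType.succ {f : ℕ → V} {n : ℕ} {v w : V} {X : ℕ} (h : HasType G f n v X)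
    (hX : X < 2 ^ n) (hv : v ≠ w) :
    (¬ G.Adj w v → HasType G (Function.update f n w) (n + 1) v X) ∧
    (G.Adj w v → HasType G (Function.update f n w) (n + 1) v (2 ^ n + X)) := by
  refine ⟨fun hn i hi => ?_, fun ha i hi => ?_⟩ <;>
    rcases Nat.lt_succ_iff_lt_or_eq.1 hi with h' | rfl
  · exact h.update le_rfl i h'
  · simpa [hn, Nat.testBit_lt_two_pow hX] using hv.symm
  · simpa [Nat.testBit_two_pow_add_gt h'] using h.update (w := w) le_rfl i h'
  · simpa [ha, Nat.testBit_two_pow_add_eq, Nat.testBit_lt_two_pow hX] using hv.symm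

theorem Represents.of_isCopy {f : ℕ → V} {A K t : List ℕ} (h : Represents G f A)
    (hc : isCopy K A t = true) : Represents G (fun i => f (t.getD i 0)) K := by
  simp only [isCopy, Bool.and_eq_true, List.all_eq_true, decide_eq_true_eq, List.mem_range,
    bne_iff_ne, beq_iff_eq] at hc
  obtain ⟨⟨ht, hK⟩, hl⟩ := hc
  intro j hj i hi
  have hmem : ∀ k < K.length, t.getD k 0 < A.length := fun k hk => by
    rw [List.getD_eq_getElem _ _ (hl ▸ hk)]
    exact ht _ (List.getElem_mem _)
  obtain ⟨hne, hadj⟩ := hK j hj i hi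
  refine ⟨h.ne (hmem _ (hi.trans hj)) (hmem _ hj) hne, ?_⟩
  rw [h.adj_iff (hmem _ (hi.trans hj)) (hmem _ hj), hadj]
  simp [adjB, hi]

theorem Setting.not_excluded {forb : List (List ℕ)} (S : Setting G forb) {f : ℕ → V} {A : List ℕ}
    (h : Represents G f A) (ws : List Copy) (Z : ℕ) : excluded forb ws Z A = false := by
  rw [Bool.eq_false_iff]
  intro hex
  simp only [excluded, List.any_eq_true, Bool.and_eq_true, Option.any_eq_true] at hex
  obtain ⟨w, -, -, K, hK, hc⟩ := hex
  exact S.free K (List.mem_of_getElem? hK) _ (h.of_isCopy hc)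

theorem Setting.land_eq_zero {forb : List (List ℕ)} (S : Setting G forb) {f : ℕ → V} {n : ℕ}
    {u v : V} {X Y : ℕ} (hX : X < 2 ^ n) (hu : HasType G f n u X) (hv : HasType G f n v Y)
    (huv : G.Adj u v) : X &&& Y = 0 := by
  refine Nat.eq_of_testBit_eq fun i => ?_
  rw [Nat.zero_testBit, Nat.testBit_and, Bool.and_eq_false_iff]
  by_contra! hcon
  simp only [ne_eq, Bool.not_eq_false] at hcon
  have hi : i < n := by
    by_contra hi
    have := Nat.testBit_lt_two_pow (hX.trans_le (Nat.pow_le_pow_right two_pos (not_lt.1 hi)))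
    simp [this] at hcon
  exact S.tri _ _ _ ((hu i hi).2.2 hcon.1) huv ((hv i hi).2.2 hcon.2)

theorem Setting.covers_extend {forb : List (List ℕ)} (S : Setting G forb) {f : ℕ → V}
    {A C : List ℕ} {w : V} {M : ℕ} (hA : Represents G f A) (hC : Covers G f A.length C)
    (hw : HasType G f A.length w M) (ws : List Copy) :
    Covers G (Function.update f A.length w) (A ++ [M]).length (extend forb ws A C M) := by
  intro v hv
  simp only [List.length_append, List.length_singleton] at hv ⊢
  have hvw : v ≠ w := fun h => hv A.length (Nat.lt_succ_self _) (by simp [h])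
  obtain ⟨X, hXC, hX, hvX⟩ := hC v fun i hi => by
    have := hv i (hi.trans (Nat.lt_succ_self _))
    rwa [Function.update_of_ne hi.ne] at this
  have hpow : 2 ^ (A.length + 1) = 2 ^ A.length + 2 ^ A.length := by ring
  have key : ∀ Y, Y < 2 ^ (A.length + 1) →
      HasType G (Function.update f A.length w) (A.length + 1) v Y →
      (Y ∈ if X &&& M == 0 then [X, 2 ^ A.length + X] else [X]) →
      ∃ X ∈ extend forb ws A C M, X < 2 ^ (A.length + 1) ∧
        HasType G (Function.update f A.length w) (A.length + 1) v X := by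
    intro Y hY hvY hmem
    refine ⟨Y, ?_, hY, hvY⟩
    rw [extend, List.mem_filter, List.mem_flatMap]
    have := (hA.append hw).append (w := v) (M := Y) (by simpa using hvY)
    rw [List.append_assoc] at this
    exact ⟨⟨X, hXC, hmem⟩, by simpa using S.not_excluded this ws Y⟩
  by_cases ha : G.Adj w v
  · refine key _ (by omega) ((hvX.succ hX hvw).2 ha) ?_
    simp [S.land_eq_zero hX hvX hw ha.symm]
  · refine key _ (by omega) ((hvX.succ hX hvw).1 ha) ?_
    split <;> simp

theorem rel_of_allPairs {α : Type*} {r : α → α → Bool} {l : List α} (h : allPairs r l = true)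
    {a b : α} (ha : a ∈ l) (hb : b ∈ l) : r a b = true ∨ r b a = true := by
  induction l with
  | nil => simp at ha
  | cons c l ih =>
    simp only [allPairs, Bool.and_eq_true, List.all_eq_true] at h
    rcases List.mem_cons.1 ha with rfl | ha'
    · exact Or.inl (h.1 b hb)
    · rcases List.mem_cons.1 hb with rfl | hb'
      · exact Or.inr (h.1 a ha)
      · exact ih h.2 ha' hb'

theorem Setting.ne_of_compatible {forb : List (List ℕ)} (S : Setting G forb) {f : ℕ → V}
    {A : List ℕ} (hA : Represents G f A) {ws : List Copy} {p q : ℕ × ℕ}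
    (h : compatible forb ws A p q = true) {u v : V} (hp : p.1 < 2 ^ A.length)
    (hq : q.1 < 2 ^ A.length) (hu : HasType G f A.length u p.1) (hv : HasType G f A.length v q.1)
    (huv : G.Adj u v) : p.2 ≠ q.2 := by
  have hrep := (hA.append hu).append (w := v) (M := 2 ^ A.length + q.1)
    (by simpa using (hv.succ hq huv.ne').2 huv)
  rw [List.append_assoc, List.singleton_append] at hrep
  simpa [compatible, S.land_eq_zero hp hu hv huv, S.not_excluded hrep] using h

theorem Setting.not_checkColor {forb : List (List ℕ)} (S : Setting G forb) {f : ℕ → V}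
    {A C : List ℕ} (hA : Represents G f A) (hC : Covers G f A.length C) (vs cs : List ℕ)
    (ws : List Copy) : checkColor forb vs cs ws A C = false := by
  classical
  rw [Bool.eq_false_iff]
  intro h
  simp only [checkColor, Bool.and_eq_true, List.all_eq_true, decide_eq_true_eq, List.mem_range,
    Bool.or_eq_true, Bool.not_eq_true', bne_iff_ne, ne_eq] at h
  obtain ⟨⟨⟨⟨⟨hlen, hvs⟩, hcs⟩, hAA⟩, hAC⟩, hCC⟩ := h
  have htype : ∀ v, (∀ i < A.length, f i ≠ v) → ∃ p ∈ C.zip cs, p.1 < 2 ^ A.length ∧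
      HasType G f A.length v p.1 := by
    intro v hv
    obtain ⟨X, hXC, hX, hvX⟩ := hC v hv
    obtain ⟨k, hk, rfl⟩ := List.mem_iff_getElem.1 hXC
    refine ⟨(C[k], cs[k]), ?_, hX, hvX⟩
    rw [List.mem_iff_getElem]
    exact ⟨k, by simp; omega, by simp⟩
  have hvs' : ∀ i, vs.getD i 0 < 3 := fun i => by
    by_cases hi : i < vs.length
    · rw [List.getD_eq_getElem _ _ hi]
      exact hvs _ (List.getElem_mem _)
    · rw [List.getD_eq_default _ _ (not_lt.1 hi)]
      norm_num
  have hcol : ∀ v, ∃ c < 3, (∃ i < A.length, f i = v ∧ vs.getD i 0 = c) ∨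
      ∃ p ∈ C.zip cs, p.1 < 2 ^ A.length ∧ HasType G f A.length v p.1 ∧ p.2 = c := by
    intro v
    by_cases hv : ∃ i < A.length, f i = v
    · obtain ⟨i, hi, hv⟩ := hv
      exact ⟨_, hvs' i, Or.inl ⟨i, hi, hv, rfl⟩⟩
    · push Not at hv
      obtain ⟨p, hp, h1, h2⟩ := htype v hv
      exact ⟨p.2, hcs _ (List.of_mem_zip hp).2, Or.inr ⟨p, hp, h1, h2, rfl⟩⟩
  choose c hc3 hc using hcol
  refine S.not_colorable ⟨Coloring.mk (fun v => (⟨c v, hc3 v⟩ : Fin 3)) ?_⟩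
  intro u v huv heq
  rw [Fin.mk.injEq] at heq
  have mixed : ∀ i < A.length, ∀ p ∈ C.zip cs, ∀ w, HasType G f A.length w p.1 →
      G.Adj (f i) w → vs.getD i 0 ≠ p.2 := fun i hi p hp w hw hadj =>
    (hAC p hp i hi).resolve_left (by simpa using (hw i hi).2.1 hadj)
  rcases hc u with ⟨i, hi, rfl, hci⟩ | ⟨p, hp, hp2, hpu, hcp⟩ <;>
    rcases hc v with ⟨j, hj, rfl, hcj⟩ | ⟨q, hq, hq2, hqv, hcq⟩
  · rcases lt_trichotomy i j with h' | rfl | h'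
    · refine (hAA j hj i h').elim (fun h0 => ?_) (fun h0 => h0 (by omega))
      exact absurd ((hA.adj_iff hi hj).1 huv) (by simp [h0])
    · exact G.loopless.irrefl _ huv
    · refine (hAA i hi j h').elim (fun h0 => ?_) (fun h0 => h0 (by omega))
      exact absurd ((hA.adj_iff hj hi).1 huv.symm) (by simp [h0])
  · exact mixed i hi q hq v hqv huv (by omega)
  · exact mixed j hj p hp u hpu huv.symm (by omega)
  · rcases rel_of_allPairs hCC hp hq with h' | h'
    · exact S.ne_of_compatible hA h' hp2 hq2 hpu hqv huv (by omega)
    · exact S.ne_of_compatible hA h' hq2 hp2 hqv hpu huv.symm (by omega)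

theorem Setting.not_check {forb : List (List ℕ)} (S : Setting G forb) (t : Tree) {f : ℕ → V}
    {A C : List ℕ} (hA : Represents G f A) (hC : Covers G f A.length C) :
    check forb t A C = false := by
  induction t generalizing f A C with
  | color vs cs ws => exact S.not_checkColor hA hC vs cs ws
  | dom a b =>
    rw [Bool.eq_false_iff]
    intro h
    simp only [check, Bool.and_eq_true, List.all_eq_true, decide_eq_true_eq, List.mem_range,
      Bool.or_eq_true, Bool.not_eq_true', bne_iff_ne, ne_eq] at h
    obtain ⟨⟨⟨⟨ha, hb⟩, hab⟩, hAA⟩, hCC⟩ := h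
    obtain ⟨w, haw, hbw⟩ := S.undominated _ _ (hA.ne ha hb hab)
    by_cases hw : ∃ i < A.length, f i = w
    · obtain ⟨i, hi, rfl⟩ := hw
      rw [hA.adj_iff ha hi] at haw
      rw [hA.adj_iff hb hi] at hbw
      have := hAA i hi
      simp_all
    · push Not at hw
      obtain ⟨X, hXC, -, hwX⟩ := hC w hw
      rw [(hwX a ha).2] at haw
      rw [(hwX b hb).2] at hbw
      have := hCC X hXC
      simp_all
  | split M ws yes no ihy ihn =>
    by_cases hM : ∃ w, HasType G f A.length w M
    · obtain ⟨w, hw⟩ := hM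
      simp [check, ihy (hA.append hw) (S.covers_extend hA hC hw ws)]
    · have : Covers G f A.length (C.filter (· != M)) := by
        intro v hv
        obtain ⟨X, hXC, hX, hvX⟩ := hC v hv
        refine ⟨X, ?_, hX, hvX⟩
        rw [List.mem_filter]
        exact ⟨hXC, by simpa using fun h : X = M => hM ⟨v, h ▸ hvX⟩⟩
      simp [check, ihn hA this]

theorem exists_hasType (f : ℕ → V) (n : ℕ) (v : V) (hv : ∀ i < n, f i ≠ v) :
    ∃ X < 2 ^ n, HasType G f n v X := by
  classical
  induction n with
  | zero => exact ⟨0, by simp, fun i hi => by omega⟩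
  | succ n ih =>
    obtain ⟨X, hX, h⟩ := ih fun i hi => hv i (by omega)
    have hpow : 2 ^ (n + 1) = 2 ^ n + 2 ^ n := by ring
    have := h.succ hX (hv n (by omega)).symm
    rw [Function.update_eq_self] at this
    by_cases ha : G.Adj (f n) v
    · exact ⟨_, by omega, this.2 ha⟩
    · exact ⟨_, by omega, this.1 ha⟩

theorem Setting.not_represents {forb : List (List ℕ)} (S : Setting G forb) {A : List ℕ}
    {ws : List Copy} {t : Tree} (h : checkStart forb A ws t = true) (f : ℕ → V) :
    ¬ Represents G f A := by
  intro hA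
  refine Bool.eq_false_iff.1 (S.not_check t hA ?_) h
  intro v hv
  obtain ⟨X, hX, hvX⟩ := exists_hasType (G := G) f A.length v hv
  refine ⟨X, ?_, hX, hvX⟩
  rw [List.mem_filter]
  exact ⟨List.mem_range.2 hX, by simpa using S.not_excluded (hA.append hvX) ws X⟩

/-- Avoiding the graph coded by `A` may be added to the setting. -/
theorem Setting.cons {forb : List (List ℕ)} (S : Setting G forb) {A : List ℕ}
    {ws : List Copy} {t : Tree} (h : checkStart forb A ws t = true) : Setting G (forb ++ [A]) :=
  ⟨fun K hK => by
    rcases List.mem_append.1 hK with h' | h'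
    · exact S.free K h'
    · rw [List.mem_singleton.1 h']
      exact S.not_represents h, S.tri, S.undominated, S.not_colorable⟩
/-- The types that cannot occur next to an induced `C₅ ∪ 2K₁`. -/
def pentagonTwoIsolatedCopies : List Copy :=
  [⟨3, 3, 1, [7, 0, 1]⟩, ⟨6, 6, 1, [7, 1, 2]⟩, ⟨12, 12, 1, [7, 2, 3]⟩, ⟨17, 17, 1, [7, 0, 4]⟩, ⟨24,
  24, 1, [7, 3, 4]⟩, ⟨47, 32, 0, [7, 5, 0, 1, 2, 3]⟩, ⟨62, 32, 0, [7, 5, 1, 2, 3, 4]⟩, ⟨61, 32, 0,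
  [7, 5, 0, 4, 3, 2]⟩, ⟨59, 32, 0, [7, 5, 1, 0, 4, 3]⟩, ⟨55, 32, 0, [7, 5, 2, 1, 0, 4]⟩, ⟨79, 64,
  0, [7, 6, 0, 1, 2, 3]⟩, ⟨94, 64, 0, [7, 6, 1, 2, 3, 4]⟩, ⟨93, 64, 0, [7, 6, 0, 4, 3, 2]⟩, ⟨91,
  64, 0, [7, 6, 1, 0, 4, 3]⟩, ⟨87, 64, 0, [7, 6, 2, 1, 0, 4]⟩]

/-- The refutation of an induced `C₅ ∪ 2K₁`. -/
def pentagonTwoIsolatedTree : Tree :=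
  .split 37 [⟨186, 130, 0, [3, 4, 1, 8, 7, 5]⟩, ⟨171, 8, 0, [8, 3, 1, 0, 7, 5]⟩, ⟨186, 10, 0, [5, 7,
  1, 8, 3, 4]⟩, ⟨182, 16, 0, [8, 4, 1, 2, 7, 5]⟩, ⟨186, 18, 0, [5, 7, 1, 8, 4, 3]⟩, ⟨230, 64, 0,
  [8, 6, 1, 2, 7, 5]⟩, ⟨227, 64, 0, [8, 6, 1, 0, 7, 5]⟩, ⟨248, 96, 0, [3, 4, 6, 8, 5, 7]⟩, ⟨213,
  64, 0, [8, 6, 2, 7, 0, 4]⟩, ⟨205, 64, 0, [8, 6, 0, 7, 2, 3]⟩]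
  (.split 69 [⟨472, 384, 0, [3, 4, 7, 9, 8, 6]⟩, ⟨346, 258, 0, [3, 4, 1, 9, 8, 6]⟩, ⟨331, 8, 0, [9,
  3, 1, 0, 8, 6]⟩, ⟨346, 10, 0, [6, 8, 1, 9, 3, 4]⟩, ⟨342, 16, 0, [9, 4, 1, 2, 8, 6]⟩, ⟨346, 18,
  0, [6, 8, 1, 9, 4, 3]⟩, ⟨358, 32, 0, [9, 5, 1, 2, 8, 6]⟩, ⟨355, 32, 0, [9, 5, 1, 0, 8, 6]⟩]
  (.split 298 [⟨661, 512, 0, [10, 9, 2, 7, 0, 4]⟩, ⟨666, 128, 0, [10, 7, 1, 9, 3, 4]⟩, ⟨557, 1, 0,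
  [10, 0, 2, 3, 9, 5]⟩, ⟨565, 516, 0, [0, 4, 2, 10, 9, 5]⟩, ⟨565, 5, 0, [5, 9, 2, 10, 0, 4]⟩,
  ⟨566, 16, 0, [10, 4, 2, 1, 9, 5]⟩, ⟨690, 16, 0, [10, 4, 1, 9, 5, 7]⟩, ⟨820, 16, 0, [10, 4, 2, 8,
  9, 5]⟩, ⟨710, 64, 0, [10, 6, 7, 2, 1, 9]⟩, ⟨587, 64, 0, [10, 6, 0, 1, 9, 3]⟩]
  (.color [1, 0, 1, 0, 2, 2, 2, 0, 0, 1] [2, 2, 2, 0, 2, 2, 0, 1, 2, 1, 1, 0, 0, 1, 1, 0, 1]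
  [⟨15375, 0, 0, [11, 10, 0, 1, 2, 3]⟩, ⟨29725, 0, 0, [11, 10, 0, 4, 3, 2]⟩, ⟨536075, 0, 0, [11,
  10, 0, 1, 9, 3]⟩, ⟨170150, 0, 0, [11, 10, 1, 2, 7, 5]⟩, ⟨27675, 0, 0, [11, 10, 1, 0, 4, 3]⟩,
  ⟨334150, 0, 0, [11, 10, 1, 2, 8, 6]⟩, ⟨550425, 0, 0, [11, 10, 0, 4, 3, 9]⟩, ⟨692900, 0, 0, [11,
  10, 2, 7, 5, 9]⟩, ⟨690850, 0, 0, [11, 10, 1, 9, 5, 7]⟩])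
  (.split 306 [⟨653, 512, 0, [10, 9, 0, 7, 2, 3]⟩, ⟨666, 128, 0, [10, 7, 1, 9, 4, 3]⟩, ⟨557, 513, 0,
  [2, 3, 0, 10, 9, 5]⟩, ⟨565, 4, 0, [10, 2, 0, 4, 9, 5]⟩, ⟨557, 5, 0, [5, 9, 0, 10, 2, 3]⟩, ⟨555,
  8, 0, [10, 3, 0, 1, 9, 5]⟩, ⟨682, 8, 0, [10, 3, 1, 9, 5, 7]⟩, ⟨809, 8, 0, [10, 3, 0, 8, 9, 5]⟩,
  ⟨598, 64, 0, [10, 6, 2, 1, 9, 4]⟩, ⟨707, 64, 0, [10, 6, 7, 0, 1, 9]⟩]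
  (.color [0, 1, 0, 2, 1, 2, 2, 1, 1, 0] [2, 2, 2, 2, 2, 1, 1, 1, 0, 0, 0, 2, 1, 0, 1, 0] [⟨15375,
  0, 0, [11, 10, 0, 1, 2, 3]⟩, ⟨30750, 0, 0, [11, 10, 1, 2, 3, 4]⟩, ⟨29725, 0, 0, [11, 10, 0, 4,
  3, 2]⟩, ⟨560675, 0, 0, [11, 10, 0, 1, 9, 5]⟩, ⟨331075, 0, 0, [11, 10, 1, 0, 8, 6]⟩, ⟨553500, 0,
  0, [11, 10, 2, 3, 4, 9]⟩, ⟨690850, 0, 0, [11, 10, 1, 9, 5, 7]⟩, ⟨689825, 0, 0, [11, 10, 0, 7, 5,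
  9]⟩])
  (.split 116 [⟨824, 256, 0, [10, 8, 3, 4, 9, 5]⟩, ⟨728, 128, 0, [10, 7, 3, 4, 9, 6]⟩, ⟨557, 1, 0,
  [10, 0, 3, 2, 9, 5]⟩, ⟨570, 2, 0, [10, 1, 3, 4, 9, 5]⟩, ⟨707, 128, 0, [6, 9, 10, 7, 0, 1]⟩,
  ⟨555, 520, 0, [0, 1, 3, 10, 9, 5]⟩, ⟨872, 8, 0, [10, 3, 5, 9, 6, 8]⟩, ⟨555, 10, 0, [5, 9, 3, 10,
  1, 0]⟩, ⟨803, 2, 0, [5, 9, 10, 1, 0, 8]⟩]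
  (.color [1, 2, 0, 1, 0, 0, 0, 2, 2, 1] [1, 0, 0, 0, 0, 0, 1, 2, 0, 0, 1, 1, 2, 2, 2, 1] [⟨15375,
  0, 0, [11, 10, 0, 1, 2, 3]⟩, ⟨575025, 0, 0, [11, 10, 0, 4, 9, 5]⟩, ⟨569900, 0, 0, [11, 10, 3, 2,
  9, 5]⟩, ⟨689825, 0, 0, [11, 10, 0, 7, 5, 9]⟩, ⟨560675, 32768, 0, [0, 1, 10, 11, 5, 9]⟩, ⟨560675,
  2048, 0, [5, 9, 10, 11, 1, 0]⟩])
  (.dom 5 0))))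
  (.split 105 [⟨472, 128, 0, [9, 7, 4, 3, 8, 6]⟩, ⟨426, 2, 0, [9, 1, 3, 8, 5, 7]⟩, ⟨309, 4, 0, [9,
  2, 4, 0, 8, 5]⟩, ⟨454, 128, 0, [6, 8, 9, 7, 2, 1]⟩, ⟨310, 272, 0, [1, 2, 4, 9, 8, 5]⟩, ⟨310, 18,
  0, [5, 8, 4, 9, 1, 2]⟩, ⟨496, 16, 0, [9, 4, 6, 8, 5, 7]⟩, ⟨358, 32, 0, [1, 2, 9, 5, 8, 6]⟩,
  ⟨454, 2, 0, [6, 8, 9, 1, 2, 7]⟩, ⟨342, 20, 0, [6, 8, 4, 9, 2, 1]⟩]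
  (.color [1, 2, 0, 1, 0, 1, 1, 2, 0] [0, 1, 1, 0, 1, 1, 2, 0, 0, 1, 1, 2, 0, 0, 2] [⟨7695, 0, 0,
  [10, 9, 0, 1, 2, 3]⟩, ⟨15390, 0, 0, [10, 9, 1, 2, 3, 4]⟩, ⟨85158, 0, 0, [10, 9, 1, 2, 7, 5]⟩,
  ⟨156465, 0, 0, [10, 9, 4, 0, 8, 5]⟩, ⟨150822, 16384, 0, [1, 2, 9, 10, 5, 8]⟩, ⟨150822, 1024, 0,
  [5, 8, 9, 10, 1, 2]⟩])
  (.split 116 [⟨472, 128, 0, [9, 7, 3, 4, 8, 6]⟩, ⟨301, 1, 0, [9, 0, 3, 2, 8, 5]⟩, ⟨314, 2, 0, [9,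
  1, 3, 4, 8, 5]⟩, ⟨451, 128, 0, [6, 8, 9, 7, 0, 1]⟩, ⟨299, 264, 0, [0, 1, 3, 9, 8, 5]⟩, ⟨488, 8,
  0, [9, 3, 6, 8, 5, 7]⟩, ⟨299, 10, 0, [5, 8, 3, 9, 1, 0]⟩, ⟨331, 9, 0, [6, 8, 3, 9, 0, 1]⟩, ⟨451,
  2, 0, [6, 8, 9, 1, 0, 7]⟩, ⟨355, 32, 0, [0, 1, 9, 5, 8, 6]⟩]
  (.color [0, 2, 1, 0, 1, 1, 1, 2, 0] [0, 1, 1, 1, 1, 0, 2, 1, 1, 0, 0, 2, 0, 0] [⟨7695, 0, 0, [10,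
  9, 0, 1, 2, 3]⟩, ⟨156465, 0, 0, [10, 9, 0, 4, 8, 5]⟩, ⟨153900, 0, 0, [10, 9, 3, 2, 8, 5]⟩,
  ⟨213921, 0, 0, [10, 9, 0, 7, 5, 8]⟩, ⟨149283, 16384, 0, [0, 1, 9, 10, 5, 8]⟩, ⟨149283, 1024, 0,
  [5, 8, 9, 10, 1, 0]⟩])
  (.dom 6 1))))
  (.split 41 [⟨186, 2, 0, [8, 1, 4, 3, 7, 5]⟩, ⟨181, 4, 0, [8, 2, 4, 0, 7, 5]⟩, ⟨182, 144, 0, [1, 2,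
  4, 8, 7, 5]⟩, ⟨182, 18, 0, [5, 7, 4, 8, 1, 2]⟩, ⟨182, 20, 0, [5, 7, 4, 8, 2, 1]⟩, ⟨248, 64, 0,
  [8, 6, 4, 3, 7, 5]⟩, ⟨241, 64, 0, [8, 6, 4, 0, 7, 5]⟩, ⟨230, 96, 0, [1, 2, 6, 8, 5, 7]⟩, ⟨205,
  64, 0, [8, 6, 0, 7, 3, 2]⟩, ⟨203, 64, 0, [8, 6, 1, 0, 7, 3]⟩]
  (.split 73 [⟨454, 384, 0, [1, 2, 7, 9, 8, 6]⟩, ⟨346, 2, 0, [9, 1, 4, 3, 8, 6]⟩, ⟨341, 4, 0, [9, 2,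
  4, 0, 8, 6]⟩, ⟨342, 272, 0, [1, 2, 4, 9, 8, 6]⟩, ⟨482, 130, 0, [6, 8, 1, 9, 7, 5]⟩, ⟨484, 132,
  0, [6, 8, 2, 9, 7, 5]⟩, ⟨369, 32, 0, [9, 5, 4, 0, 8, 6]⟩, ⟨458, 2, 0, [9, 1, 6, 8, 3, 7]⟩, ⟨453,
  4, 0, [9, 2, 6, 8, 0, 7]⟩]
  (.split 306 [⟨653, 512, 0, [10, 9, 0, 7, 3, 2]⟩, ⟨962, 128, 0, [10, 7, 1, 9, 8, 6]⟩, ⟨557, 513, 0,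
  [2, 3, 0, 10, 9, 5]⟩, ⟨565, 4, 0, [10, 2, 0, 4, 9, 5]⟩, ⟨692, 4, 0, [10, 2, 4, 9, 5, 7]⟩, ⟨555,
  8, 0, [10, 3, 0, 1, 9, 5]⟩, ⟨557, 9, 0, [5, 9, 0, 10, 3, 2]⟩, ⟨805, 4, 0, [10, 2, 0, 8, 9, 5]⟩,
  ⟨602, 64, 0, [10, 6, 1, 9, 4, 3]⟩, ⟨721, 64, 0, [10, 6, 7, 0, 4, 9]⟩]
  (.color [1, 0, 2, 1, 0, 2, 2, 0, 0, 1] [2, 2, 2, 2, 1, 0, 0, 0, 2, 2, 1, 1, 0, 1, 1, 0, 1]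
  [⟨15375, 0, 0, [11, 10, 0, 1, 2, 3]⟩, ⟨30750, 0, 0, [11, 10, 1, 2, 3, 4]⟩, ⟨575025, 0, 0, [11,
  10, 0, 4, 9, 5]⟩, ⟨345425, 0, 0, [11, 10, 4, 0, 8, 6]⟩, ⟨705200, 0, 0, [11, 10, 4, 9, 5, 7]⟩,
  ⟨145550, 0, 0, [11, 10, 1, 2, 3, 7]⟩, ⟨689825, 0, 0, [11, 10, 0, 7, 5, 9]⟩])
  (.split 308 [⟨651, 512, 0, [10, 9, 1, 0, 7, 3]⟩, ⟨662, 128, 0, [10, 7, 1, 2, 9, 4]⟩, ⟨557, 1, 0,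
  [10, 0, 3, 2, 9, 5]⟩, ⟨570, 2, 0, [10, 1, 3, 4, 9, 5]⟩, ⟨555, 520, 0, [0, 1, 3, 10, 9, 5]⟩,
  ⟨555, 9, 0, [5, 9, 3, 10, 0, 1]⟩, ⟨690, 2, 0, [10, 1, 4, 9, 5, 7]⟩, ⟨810, 2, 0, [10, 1, 3, 8, 9,
  5]⟩, ⟨728, 64, 0, [10, 6, 7, 3, 4, 9]⟩, ⟨597, 64, 0, [10, 6, 0, 4, 9, 2]⟩]
  (.color [0, 2, 1, 0, 1, 2, 2, 1, 1, 0] [2, 2, 2, 1, 0, 2, 2, 1, 1, 2, 0, 0, 1, 0, 1, 0] [⟨15375,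
  0, 0, [11, 10, 0, 1, 2, 3]⟩, ⟨582200, 0, 0, [11, 10, 3, 4, 9, 5]⟩, ⟨531975, 0, 0, [11, 10, 0, 1,
  2, 9]⟩, ⟨352600, 0, 0, [11, 10, 4, 3, 8, 6]⟩, ⟨331075, 0, 0, [11, 10, 1, 0, 8, 6]⟩, ⟨705200, 0,
  0, [11, 10, 4, 9, 5, 7]⟩, ⟨697000, 0, 0, [11, 10, 3, 7, 5, 9]⟩])
  (.split 106 [⟨930, 256, 0, [10, 8, 1, 9, 5, 7]⟩, ⟨962, 128, 0, [10, 7, 1, 9, 6, 8]⟩, ⟨557, 1, 0,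
  [10, 0, 2, 3, 9, 5]⟩, ⟨721, 128, 0, [6, 9, 10, 7, 0, 4]⟩, ⟨565, 516, 0, [0, 4, 2, 10, 9, 5]⟩,
  ⟨868, 4, 0, [10, 2, 5, 9, 6, 8]⟩, ⟨690, 16, 0, [10, 4, 1, 9, 5, 7]⟩, ⟨565, 20, 0, [5, 9, 2, 10,
  4, 0]⟩, ⟨817, 16, 0, [5, 9, 10, 4, 0, 8]⟩]
  (.color [1, 0, 1, 0, 2, 0, 0, 2, 2, 1] [1, 0, 0, 0, 0, 0, 1, 2, 1, 0, 1, 0, 2, 2, 2, 1] [⟨15375,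
  0, 0, [11, 10, 0, 1, 2, 3]⟩, ⟨560675, 0, 0, [11, 10, 0, 1, 9, 5]⟩, ⟨689825, 0, 0, [11, 10, 0, 7,
  5, 9]⟩, ⟨569900, 0, 0, [11, 10, 2, 3, 9, 5]⟩, ⟨575025, 32768, 0, [0, 4, 10, 11, 5, 9]⟩, ⟨575025,
  16384, 0, [5, 9, 10, 11, 4, 0]⟩])
  (.dom 5 0))))
  (.split 101 [⟨454, 128, 0, [9, 7, 1, 2, 8, 6]⟩, ⟨472, 128, 0, [6, 8, 9, 7, 3, 4]⟩, ⟨314, 258, 0,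
  [3, 4, 1, 9, 8, 5]⟩, ⟨299, 8, 0, [9, 3, 1, 0, 8, 5]⟩, ⟨482, 2, 0, [9, 1, 6, 8, 5, 7]⟩, ⟨310, 16,
  0, [9, 4, 1, 2, 8, 5]⟩, ⟨314, 18, 0, [5, 8, 1, 9, 4, 3]⟩, ⟨346, 10, 0, [6, 8, 1, 9, 3, 4]⟩,
  ⟨472, 16, 0, [6, 8, 9, 4, 3, 7]⟩]
  (.color [1, 0, 1, 0, 2, 1, 1, 2, 0] [0, 1, 1, 0, 0, 1, 2, 1, 1, 1, 0, 2, 0, 0, 2] [⟨7695, 0, 0,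
  [10, 9, 0, 1, 2, 3]⟩, ⟨15390, 0, 0, [10, 9, 1, 2, 3, 4]⟩, ⟨217512, 0, 0, [10, 9, 3, 7, 5, 8]⟩,
  ⟨149283, 0, 0, [10, 9, 1, 0, 8, 5]⟩, ⟨160056, 16384, 0, [3, 4, 9, 10, 5, 8]⟩, ⟨160056, 8192, 0,
  [5, 8, 9, 10, 4, 3]⟩])
  (.split 106 [⟨454, 128, 0, [9, 7, 2, 1, 8, 6]⟩, ⟨301, 1, 0, [9, 0, 2, 3, 8, 5]⟩, ⟨465, 128, 0, [6,
  8, 9, 7, 0, 4]⟩, ⟨309, 260, 0, [0, 4, 2, 9, 8, 5]⟩, ⟨484, 4, 0, [9, 2, 6, 8, 5, 7]⟩, ⟨434, 16,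
  0, [9, 4, 1, 8, 5, 7]⟩, ⟨309, 20, 0, [5, 8, 2, 9, 4, 0]⟩, ⟨369, 32, 0, [0, 4, 9, 5, 8, 6]⟩,
  ⟨465, 16, 0, [6, 8, 9, 4, 0, 7]⟩]
  (.color [0, 1, 0, 1, 2, 1, 1, 2, 0] [0, 1, 1, 1, 1, 0, 2, 0, 1, 0, 1, 2, 0, 0] [⟨7695, 0, 0, [10,
  9, 0, 1, 2, 3]⟩, ⟨149283, 0, 0, [10, 9, 0, 1, 8, 5]⟩, ⟨213921, 0, 0, [10, 9, 0, 7, 5, 8]⟩,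
  ⟨153900, 0, 0, [10, 9, 2, 3, 8, 5]⟩, ⟨156465, 16384, 0, [0, 4, 9, 10, 5, 8]⟩, ⟨156465, 8192, 0,
  [5, 8, 9, 10, 4, 0]⟩])
  (.dom 6 4))))
  (.split 42 [⟨173, 1, 0, [8, 0, 2, 3, 7, 5]⟩, ⟨181, 132, 0, [0, 4, 2, 8, 7, 5]⟩, ⟨181, 5, 0, [5, 7,
  2, 8, 0, 4]⟩, ⟨182, 16, 0, [8, 4, 2, 1, 7, 5]⟩, ⟨181, 20, 0, [5, 7, 2, 8, 4, 0]⟩, ⟨230, 64, 0,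
  [8, 6, 2, 1, 7, 5]⟩, ⟨236, 64, 0, [8, 6, 2, 3, 7, 5]⟩, ⟨218, 64, 0, [8, 6, 1, 7, 3, 4]⟩, ⟨241,
  96, 0, [0, 4, 6, 8, 5, 7]⟩, ⟨203, 64, 0, [8, 6, 0, 1, 7, 3]⟩]
  (.split 52 [⟨395, 256, 0, [9, 8, 0, 1, 7, 3]⟩, ⟨405, 128, 0, [9, 7, 0, 4, 8, 2]⟩, ⟨301, 1, 0, [9,
  0, 3, 2, 8, 5]⟩, ⟨314, 2, 0, [9, 1, 3, 4, 8, 5]⟩, ⟨299, 264, 0, [0, 1, 3, 9, 8, 5]⟩, ⟨421, 1, 0,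
  [9, 0, 2, 8, 5, 7]⟩, ⟨299, 10, 0, [5, 8, 3, 9, 1, 0]⟩, ⟨376, 64, 0, [9, 6, 3, 4, 8, 5]⟩, ⟨342,
  64, 0, [9, 6, 1, 2, 8, 4]⟩, ⟨460, 64, 0, [9, 6, 7, 3, 2, 8]⟩]
  (.split 212 [⟨589, 1, 0, [10, 0, 3, 2, 9, 6]⟩, ⟨602, 2, 0, [10, 1, 3, 4, 9, 6]⟩, ⟨587, 520, 0, [0,
  1, 3, 10, 9, 6]⟩, ⟨677, 1, 0, [10, 0, 2, 9, 7, 5]⟩, ⟨866, 258, 0, [6, 9, 1, 10, 8, 5]⟩, ⟨850, 2,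
  0, [10, 1, 6, 9, 4, 8]⟩, ⟨620, 32, 0, [10, 5, 3, 2, 9, 6]⟩]
  (.color [2, 1, 0, 1, 0, 2, 2, 0, 1, 1] [2, 2, 2, 0, 2, 1, 2, 0, 0, 1, 2, 1, 0, 1, 0, 1] [⟨15375,
  0, 0, [11, 10, 0, 1, 2, 3]⟩, ⟨142475, 0, 0, [11, 10, 0, 1, 7, 3]⟩, ⟨269575, 0, 0, [11, 10, 0, 1,
  2, 8]⟩, ⟨176300, 0, 0, [11, 10, 2, 3, 7, 5]⟩, ⟨607825, 0, 0, [11, 10, 0, 4, 9, 6]⟩, ⟨602700, 0,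
  0, [11, 10, 3, 2, 9, 6]⟩, ⟨434600, 0, 0, [11, 10, 3, 7, 5, 8]⟩, ⟨430500, 0, 0, [11, 10, 2, 8, 5,
  7]⟩])
  (.dom 6 1))
  (.split 105 [⟨465, 128, 0, [9, 7, 4, 0, 8, 6]⟩, ⟨454, 128, 0, [6, 8, 9, 7, 1, 2]⟩, ⟨314, 2, 0, [9,
  1, 4, 3, 8, 5]⟩, ⟨421, 4, 0, [9, 2, 0, 8, 5, 7]⟩, ⟨310, 272, 0, [1, 2, 4, 9, 8, 5]⟩, ⟨496, 16,
  0, [9, 4, 6, 8, 5, 7]⟩, ⟨310, 20, 0, [5, 8, 4, 9, 2, 1]⟩, ⟨342, 18, 0, [6, 8, 4, 9, 1, 2]⟩]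
  (.color [0, 1, 2, 0, 1, 0, 0, 2, 1] [1, 0, 0, 0, 0, 1, 1, 1, 2, 0, 0, 2, 1, 2, 1, 2] [⟨7695, 0, 0,
  [10, 9, 0, 1, 2, 3]⟩, ⟨160056, 0, 0, [10, 9, 4, 3, 8, 5]⟩, ⟨83619, 0, 0, [10, 9, 0, 1, 7, 5]⟩,
  ⟨214434, 0, 0, [10, 9, 1, 7, 5, 8]⟩, ⟨150822, 16384, 0, [1, 2, 9, 10, 5, 8]⟩, ⟨150822, 4, 0, [5,
  8, 10, 9, 2, 1]⟩, ⟨150822, 2048, 0, [5, 8, 9, 10, 2, 1]⟩])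
  (.dom 5 1)))
  (.split 50 [⟨173, 129, 0, [2, 3, 0, 8, 7, 5]⟩, ⟨181, 4, 0, [8, 2, 0, 4, 7, 5]⟩, ⟨173, 5, 0, [5, 7,
  0, 8, 2, 3]⟩, ⟨171, 8, 0, [8, 3, 0, 1, 7, 5]⟩, ⟨173, 9, 0, [5, 7, 0, 8, 3, 2]⟩, ⟨241, 64, 0, [8,
  6, 0, 4, 7, 5]⟩, ⟨227, 64, 0, [8, 6, 0, 1, 7, 5]⟩, ⟨218, 64, 0, [8, 6, 1, 7, 4, 3]⟩, ⟨214, 64,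
  0, [8, 6, 2, 1, 7, 4]⟩, ⟨236, 96, 0, [2, 3, 6, 8, 5, 7]⟩]
  (.split 106 [⟨460, 128, 0, [9, 7, 2, 3, 8, 6]⟩, ⟨301, 1, 0, [9, 0, 2, 3, 8, 5]⟩, ⟨465, 128, 0, [6,
  8, 9, 7, 4, 0]⟩, ⟨309, 260, 0, [0, 4, 2, 9, 8, 5]⟩, ⟨309, 5, 0, [5, 8, 2, 9, 0, 4]⟩, ⟨310, 16,
  0, [9, 4, 2, 1, 8, 5]⟩, ⟨484, 4, 0, [9, 2, 6, 8, 5, 7]⟩, ⟨341, 20, 0, [6, 8, 2, 9, 4, 0]⟩]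
  (.color [2, 0, 1, 0, 1, 0, 0, 2, 1] [1, 0, 0, 0, 1, 0, 1, 1, 0, 2, 0, 2, 1, 2, 1, 2] [⟨7695, 0, 0,
  [10, 9, 0, 1, 2, 3]⟩, ⟨14877, 0, 0, [10, 9, 0, 4, 3, 2]⟩, ⟨150822, 0, 0, [10, 9, 2, 1, 8, 5]⟩,
  ⟨90801, 0, 0, [10, 9, 0, 4, 7, 5]⟩, ⟨156465, 16384, 0, [0, 4, 9, 10, 5, 8]⟩, ⟨156465, 512, 0,
  [5, 8, 9, 10, 0, 4]⟩])
  (.dom 5 4))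
  (.split 52 [⟨173, 1, 0, [8, 0, 3, 2, 7, 5]⟩, ⟨186, 2, 0, [8, 1, 3, 4, 7, 5]⟩, ⟨171, 136, 0, [0, 1,
  3, 8, 7, 5]⟩, ⟨171, 9, 0, [5, 7, 3, 8, 0, 1]⟩, ⟨171, 10, 0, [5, 7, 3, 8, 1, 0]⟩, ⟨248, 64, 0,
  [8, 6, 3, 4, 7, 5]⟩, ⟨236, 64, 0, [8, 6, 3, 2, 7, 5]⟩, ⟨214, 64, 0, [8, 6, 1, 2, 7, 4]⟩, ⟨213,
  64, 0, [8, 6, 0, 4, 7, 2]⟩, ⟨227, 96, 0, [0, 1, 6, 8, 5, 7]⟩]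
  (.split 114 [⟨451, 128, 0, [9, 7, 0, 1, 8, 6]⟩, ⟨460, 128, 0, [6, 8, 9, 7, 2, 3]⟩, ⟨301, 257, 0,
  [2, 3, 0, 9, 8, 5]⟩, ⟨309, 4, 0, [9, 2, 0, 4, 8, 5]⟩, ⟨481, 1, 0, [9, 0, 6, 8, 5, 7]⟩, ⟨299, 8,
  0, [9, 3, 0, 1, 8, 5]⟩, ⟨301, 9, 0, [5, 8, 0, 9, 3, 2]⟩]
  (.color [1, 0, 1, 2, 0, 0, 0, 2, 1] [1, 0, 0, 0, 0, 0, 0, 1, 1, 1, 2, 2, 1, 2, 2, 1] [⟨7695, 0, 0,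
  [10, 9, 0, 1, 2, 3]⟩, ⟨156465, 0, 0, [10, 9, 0, 4, 8, 5]⟩, ⟨215460, 0, 0, [10, 9, 2, 7, 5, 8]⟩,
  ⟨153900, 16384, 0, [2, 3, 9, 10, 5, 8]⟩, ⟨153900, 8, 0, [5, 8, 10, 9, 3, 2]⟩, ⟨153900, 4096, 0,
  [5, 8, 9, 10, 3, 2]⟩])
  (.dom 5 2))
  (.dom 5 6)))))

/-- The types that cannot occur next to an induced `C₅ ∪ K₁`. -/
def pentagonIsolatedCopies : List Copy :=
  [⟨63, 0, 3, [0, 1, 2, 3, 4, 6, 5]⟩, ⟨3, 3, 1, [6, 0, 1]⟩, ⟨6, 6, 1, [6, 1, 2]⟩, ⟨12, 12, 1, [6, 2,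
  3]⟩, ⟨17, 17, 1, [6, 0, 4]⟩, ⟨24, 24, 1, [6, 3, 4]⟩, ⟨47, 32, 0, [6, 5, 0, 1, 2, 3]⟩, ⟨62, 32,
  0, [6, 5, 1, 2, 3, 4]⟩, ⟨61, 32, 0, [6, 5, 0, 4, 3, 2]⟩, ⟨59, 32, 0, [6, 5, 1, 0, 4, 3]⟩, ⟨55,
  32, 0, [6, 5, 2, 1, 0, 4]⟩]

/-- The refutation of an induced `C₅ ∪ K₁`. -/
def pentagonIsolatedTree : Tree :=
  .split 42 [⟨109, 1, 0, [7, 0, 2, 3, 6, 5]⟩, ⟨117, 68, 0, [0, 4, 2, 7, 6, 5]⟩, ⟨117, 5, 0, [5, 6,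
  2, 7, 0, 4]⟩, ⟨118, 16, 0, [7, 4, 2, 1, 6, 5]⟩, ⟨117, 20, 0, [5, 6, 2, 7, 4, 0]⟩]
  (.split 4 [⟨229, 65, 0, [2, 7, 0, 8, 6, 5]⟩, ⟨217, 128, 0, [8, 7, 0, 4, 3, 6]⟩, ⟨219, 0, 3, [0, 1,
  6, 3, 4, 8, 7]⟩, ⟨227, 128, 0, [8, 7, 0, 1, 6, 5]⟩, ⟨229, 129, 0, [5, 6, 0, 8, 7, 2]⟩, ⟨187, 10,
  3, [8, 1, 0, 4, 3, 5, 7]⟩, ⟨244, 80, 0, [2, 7, 4, 8, 6, 5]⟩, ⟨244, 144, 0, [5, 6, 4, 8, 7, 2]⟩,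
  ⟨229, 33, 0, [2, 7, 0, 8, 5, 6]⟩, ⟨181, 160, 0, [0, 4, 5, 8, 7, 2]⟩, ⟨244, 48, 0, [2, 7, 4, 8,
  5, 6]⟩]
  (.split 37 [⟨314, 258, 0, [3, 4, 1, 9, 8, 5]⟩, ⟨299, 8, 0, [9, 3, 1, 0, 8, 5]⟩, ⟨374, 0, 3, [1, 2,
  8, 5, 6, 9, 4]⟩, ⟨481, 128, 0, [9, 7, 0, 8, 5, 6]⟩, ⟨310, 16, 0, [9, 4, 1, 2, 8, 5]⟩, ⟨372, 16,
  0, [9, 4, 2, 8, 5, 6]⟩]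
  (.split 193 [⟨812, 512, 0, [10, 9, 3, 2, 8, 5]⟩, ⟨651, 8, 0, [10, 3, 1, 0, 9, 7]⟩, ⟨724, 16, 0,
  [10, 4, 2, 7, 9, 6]⟩, ⟨905, 8, 0, [10, 3, 7, 9, 0, 8]⟩, ⟨722, 16, 0, [10, 4, 1, 6, 9, 7]⟩]
  (.split 193 [⟨1324, 1024, 0, [11, 10, 3, 2, 8, 5]⟩, ⟨1163, 8, 0, [11, 3, 1, 0, 10, 7]⟩, ⟨1820,
  272, 3, [11, 4, 3, 2, 8, 9, 10]⟩, ⟨1236, 16, 0, [11, 4, 2, 7, 10, 6]⟩, ⟨1836, 40, 3, [11, 3, 2,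
  8, 5, 9, 10]⟩, ⟨1417, 8, 0, [11, 3, 7, 10, 0, 8]⟩, ⟨1566, 18, 3, [11, 1, 2, 3, 4, 9, 10]⟩,
  ⟨1234, 16, 0, [11, 4, 1, 6, 10, 7]⟩]
  (.color [0, 1, 0, 1, 2, 2, 0, 1, 1, 2, 2] [2, 2, 1, 0, 0, 0, 1, 1, 0, 1] [⟨614700, 0, 0, [12, 11,
  3, 2, 8, 5]⟩])
  (.split 394 [⟨1249, 65, 0, [7, 10, 0, 11, 6, 5]⟩, ⟨1621, 80, 3, [11, 4, 0, 9, 6, 2, 10]⟩, ⟨1682,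
  16, 0, [11, 4, 1, 10, 7, 9]⟩, ⟨1225, 1, 0, [11, 0, 6, 3, 10, 7]⟩, ⟨1637, 33, 3, [11, 0, 9, 6, 5,
  2, 10]⟩, ⟨1234, 16, 0, [11, 4, 6, 1, 10, 7]⟩]
  (.color [2, 0, 1, 0, 1, 1, 2, 0, 0, 1, 1] [1, 0, 2, 1, 2, 0, 0, 2, 2, 0] [⟨3190293, 33280, 3, [12,
  4, 0, 9, 11, 2, 10]⟩])
  (.split 464 [⟨1178, 2, 0, [11, 1, 3, 4, 10, 7]⟩, ⟨1229, 0, 3, [2, 3, 6, 10, 7, 11, 0]⟩, ⟨1929, 0,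
  3, [0, 8, 10, 7, 9, 11, 3]⟩, ⟨1225, 1, 0, [11, 0, 3, 6, 10, 7]⟩, ⟨2015, 137, 2, [0, 11, 8, 9, 4,
  1, 3, 2, 7, 10, 6]⟩, ⟨1417, 8, 0, [11, 3, 0, 8, 10, 7]⟩, ⟨2015, 532, 2, [2, 11, 1, 7, 3, 8, 4,
  0, 9, 6, 10]⟩]
  (.color [0, 1, 0, 1, 2, 1, 0, 2, 2, 1, 1] [2, 1, 0, 1, 2, 0, 0] [⟨3143166, 364808, 2, [12, 1, 4,
  5, 7, 11, 2, 3, 6, 10, 8]⟩])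
  (.split 786 [⟨1140, 68, 0, [4, 10, 2, 11, 6, 5]⟩, ⟨1620, 4, 0, [11, 2, 4, 10, 9, 6]⟩, ⟨1078, 32,
  0, [11, 5, 2, 1, 10, 4]⟩, ⟨1133, 36, 3, [11, 2, 3, 6, 5, 0, 10]⟩]
  (.color [1, 0, 1, 2, 0, 2, 1, 2, 0, 0, 1] [2, 0, 1, 1, 2, 0, 0, 1, 1] [⟨1641249, 0, 0, [12, 11, 5,
  8, 0, 9]⟩, ⟨2313321, 65544, 3, [12, 5, 6, 3, 11, 0, 10]⟩])
  (.split 84 [⟨1825, 1024, 0, [11, 10, 5, 8, 0, 9]⟩, ⟨1362, 256, 0, [11, 8, 1, 6, 10, 4]⟩, ⟨1078,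
  32, 0, [11, 5, 1, 2, 10, 4]⟩, ⟨1077, 32, 0, [11, 5, 0, 4, 10, 2]⟩, ⟨1323, 34, 3, [11, 1, 0, 8,
  5, 3, 10]⟩, ⟨1833, 544, 3, [11, 5, 8, 0, 9, 3, 10]⟩]
  (.color [1, 2, 0, 1, 0, 1, 0, 1, 2, 2, 1] [1, 2, 0, 1, 2, 0, 0] [⟨1641249, 0, 0, [12, 11, 5, 8, 0,
  9]⟩])
  (.split 37 [⟨1736, 1024, 0, [11, 10, 3, 6, 9, 7]⟩, ⟨1067, 8, 0, [11, 3, 1, 0, 10, 5]⟩, ⟨1992, 136,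
  3, [11, 3, 6, 9, 7, 8, 10]⟩, ⟨1370, 18, 3, [11, 1, 6, 3, 4, 8, 10]⟩, ⟨1880, 528, 3, [11, 4, 3,
  6, 9, 8, 10]⟩]
  (.color [0, 1, 0, 1, 2, 1, 0, 2, 2, 1, 2] [2, 1, 0, 2, 0] [⟨1458888, 0, 0, [12, 11, 3, 6, 9, 7]⟩])
  (.split 169 [⟨1322, 2, 0, [11, 1, 3, 10, 5, 8]⟩, ⟨1477, 0, 3, [0, 8, 2, 7, 10, 11, 6]⟩, ⟨2031,
  548, 2, [2, 11, 1, 7, 8, 3, 5, 6, 9, 0, 10]⟩]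
  (.color [0, 1, 0, 2, 1, 2, 0, 2, 1, 1, 1] [2, 1, 0, 1, 0] [⟨3014079, 364808, 2, [12, 1, 5, 4, 7,
  11, 2, 8, 0, 10, 3]⟩])
  (.split 564 [⟨1082, 2, 0, [11, 1, 3, 4, 10, 5]⟩, ⟨1365, 0, 3, [0, 4, 10, 2, 8, 11, 6]⟩]
  (.color [0, 1, 0, 1, 2, 2, 0, 1, 1, 2, 1] [2, 1, 0, 0, 1] [⟨3667710, 365064, 2, [12, 1, 4, 7, 5,
  11, 6, 3, 2, 10, 9]⟩])
  (.color [1, 0, 1, 0, 2, 2, 1, 2, 0, 0] [1, 0, 2, 1, 1] [])))))))))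
  (.split 464 [⟨666, 2, 0, [10, 1, 3, 4, 9, 7]⟩, ⟨717, 0, 3, [2, 3, 6, 9, 7, 10, 0]⟩, ⟨713, 1, 0,
  [10, 0, 3, 6, 9, 7]⟩, ⟨905, 8, 0, [10, 3, 0, 8, 9, 7]⟩]
  (.split 169 [⟨1322, 2, 0, [11, 1, 3, 10, 5, 8]⟩, ⟨2015, 1538, 2, [9, 11, 4, 7, 6, 8, 1, 0, 10, 3,
  2]⟩, ⟨1690, 0, 3, [3, 4, 9, 7, 10, 11, 1]⟩, ⟨1551, 0, 3, [0, 1, 2, 3, 10, 11, 9]⟩, ⟨1456, 16, 0,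
  [11, 4, 7, 10, 5, 8]⟩, ⟨1862, 0, 3, [1, 2, 8, 9, 6, 11, 10]⟩, ⟨1477, 0, 3, [0, 8, 2, 7, 10, 11,
  6]⟩]
  (.split 178 [⟨2091, 8, 0, [12, 3, 0, 1, 11, 5]⟩, ⟨3455, 2312, 2, [3, 12, 6, 4, 2, 10, 8, 5, 11, 1,
  0]⟩, ⟨3125, 0, 3, [0, 4, 11, 5, 10, 12, 2]⟩, ⟨2347, 0, 3, [0, 1, 11, 5, 8, 12, 3]⟩, ⟨2394, 0, 3,
  [1, 6, 3, 4, 11, 12, 8]⟩, ⟨3341, 0, 3, [0, 8, 2, 3, 10, 12, 11]⟩, ⟨3070, 52, 2, [2, 12, 1, 8, 3,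
  7, 4, 11, 5, 6, 9]⟩]
  (.color [0, 1, 0, 1, 2, 1, 2, 1, 2, 0, 2, 0] [] [])
  (.color [0, 1, 0, 1, 2, 0, 2, 1, 1, 0, 2] [0, 0, 1, 1, 1] []))
  (.split 178 [⟨1697, 1, 0, [11, 0, 5, 10, 7, 9]⟩, ⟨1067, 8, 0, [11, 3, 0, 1, 10, 5]⟩, ⟨1919, 1288,
  2, [8, 11, 0, 5, 2, 9, 3, 4, 10, 1, 6]⟩, ⟨1652, 0, 3, [4, 9, 6, 5, 10, 11, 2]⟩, ⟨1323, 0, 3, [0,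
  1, 10, 5, 8, 11, 3]⟩, ⟨1370, 0, 3, [1, 6, 3, 4, 10, 11, 8]⟩, ⟨1868, 0, 3, [2, 3, 6, 9, 8, 11,
  10]⟩, ⟨2046, 52, 2, [2, 11, 1, 8, 3, 7, 4, 10, 5, 6, 9]⟩]
  (.color [1, 0, 1, 0, 2, 0, 1, 2, 2, 0, 1] [1, 0, 0, 1] [])
  (.dom 7 8)))
  (.split 169 [⟨810, 2, 0, [10, 1, 3, 9, 5, 8]⟩, ⟨692, 16, 0, [10, 4, 2, 7, 9, 5]⟩, ⟨944, 16, 0,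
  [10, 4, 7, 9, 5, 8]⟩, ⟨965, 0, 3, [0, 8, 2, 7, 9, 10, 6]⟩]
  (.split 178 [⟨1588, 4, 0, [11, 2, 4, 10, 5, 9]⟩, ⟨1067, 8, 0, [11, 3, 0, 1, 10, 5]⟩, ⟨1919, 1288,
  2, [3, 11, 6, 4, 2, 9, 8, 5, 10, 1, 0]⟩, ⟨1589, 0, 3, [0, 4, 10, 5, 9, 11, 2]⟩, ⟨1323, 0, 3, [0,
  1, 10, 5, 8, 11, 3]⟩, ⟨1370, 0, 3, [1, 6, 3, 4, 10, 11, 8]⟩, ⟨1805, 0, 3, [0, 8, 2, 3, 9, 11,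
  10]⟩, ⟨1983, 52, 2, [2, 11, 7, 8, 3, 1, 4, 10, 5, 9, 0]⟩]
  (.color [0, 1, 0, 2, 1, 2, 0, 2, 1, 1, 0] [0, 1, 0, 1] [])
  (.dom 7 3))
  (.dom 7 1))))
  (.split 169 [⟨314, 2, 0, [9, 1, 4, 3, 8, 5]⟩, ⟨436, 16, 0, [9, 4, 2, 7, 8, 5]⟩, ⟨310, 20, 0, [5,
  8, 4, 9, 2, 1]⟩]
  (.split 178 [⟨820, 4, 0, [10, 2, 4, 9, 5, 8]⟩, ⟨555, 8, 0, [10, 3, 0, 1, 9, 5]⟩, ⟨677, 1, 0, [10,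
  0, 2, 7, 9, 5]⟩, ⟨821, 0, 3, [0, 4, 9, 5, 8, 10, 2]⟩, ⟨977, 0, 3, [0, 4, 9, 7, 8, 10, 6]⟩]
  (.split 193 [⟨1566, 0, 3, [1, 2, 3, 4, 9, 11, 10]⟩, ⟨1564, 1024, 0, [11, 10, 2, 3, 4, 9]⟩, ⟨1163,
  8, 0, [11, 3, 1, 0, 10, 7]⟩, ⟨2015, 1544, 2, [3, 11, 8, 6, 4, 2, 9, 7, 10, 0, 1]⟩, ⟨1238, 0, 3,
  [1, 2, 7, 10, 6, 11, 4]⟩, ⟨2043, 208, 2, [6, 11, 5, 10, 3, 1, 4, 9, 7, 8, 0]⟩, ⟨1236, 16, 0,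
  [11, 4, 2, 7, 10, 6]⟩, ⟨1675, 0, 3, [0, 1, 9, 7, 10, 11, 3]⟩, ⟨1865, 0, 3, [0, 8, 3, 6, 10, 11,
  9]⟩]
  (.color [0, 1, 2, 0, 1, 1, 2, 0, 2, 2, 1] [0, 1, 0, 2, 0] [⟨4046775, 2203906, 2, [12, 2, 4, 11,
  10, 5, 7, 9, 1, 0, 8]⟩])
  (.color [1, 2, 0, 1, 0, 2, 0, 2, 0, 1] [1, 2, 0, 0, 1, 1, 1, 0, 1, 1] [⟨1015775, 213250, 2, [1, 6,
  0, 2, 10, 9, 11, 4, 3, 8, 7]⟩, ⟨917375, 53506, 2, [1, 2, 0, 6, 10, 9, 11, 4, 3, 8, 5]⟩]))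
  (.split 52 [⟨557, 1, 0, [10, 0, 3, 2, 9, 5]⟩, ⟨570, 2, 0, [10, 1, 3, 4, 9, 5]⟩, ⟨826, 0, 3, [3, 4,
  9, 5, 8, 10, 1]⟩, ⟨899, 512, 0, [10, 9, 1, 0, 8, 7]⟩, ⟨613, 1, 0, [10, 0, 2, 9, 5, 6]⟩, ⟨818, 2,
  0, [10, 1, 4, 9, 5, 8]⟩, ⟨621, 0, 3, [2, 3, 6, 5, 9, 10, 0]⟩, ⟨843, 0, 3, [0, 1, 6, 3, 8, 10,
  9]⟩]
  (.split 705 [⟨2031, 770, 2, [8, 11, 7, 5, 0, 3, 1, 2, 9, 10, 6]⟩, ⟨1577, 8, 0, [11, 3, 0, 10, 9,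
  5]⟩, ⟨1238, 0, 3, [1, 2, 7, 10, 6, 11, 4]⟩, ⟨1381, 0, 3, [0, 8, 5, 6, 10, 11, 2]⟩, ⟨1862, 0, 3,
  [1, 2, 9, 10, 6, 11, 8]⟩, ⟨1682, 2, 0, [11, 1, 4, 9, 10, 7]⟩]
  (.color [0, 1, 2, 1, 2, 1, 0, 0, 2, 0, 1] [1, 0, 1, 1, 0] [])
  (.split 208 [⟨1178, 2, 0, [11, 1, 3, 4, 10, 7]⟩, ⟨1543, 1024, 0, [11, 10, 0, 1, 2, 9]⟩, ⟨1221, 1,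
  0, [11, 0, 2, 7, 10, 6]⟩, ⟨1295, 0, 3, [0, 1, 2, 3, 8, 11, 10]⟩, ⟨1426, 2, 0, [11, 1, 4, 10, 7,
  8]⟩]
  (.color [0, 1, 2, 0, 2, 0, 2, 0, 1, 1, 1] [0, 1, 2, 2, 0, 1, 2] [])
  (.dom 7 3)))
  (.dom 5 3)))
  (.split 52 [⟨301, 1, 0, [9, 0, 3, 2, 8, 5]⟩, ⟨314, 2, 0, [9, 1, 3, 4, 8, 5]⟩, ⟨299, 264, 0, [0, 1,
  3, 9, 8, 5]⟩, ⟨357, 1, 0, [9, 0, 2, 8, 5, 6]⟩, ⟨433, 128, 0, [9, 7, 0, 4, 8, 5]⟩, ⟨365, 0, 3,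
  [2, 3, 6, 5, 8, 9, 0]⟩]
  (.split 449 [⟨809, 8, 0, [10, 3, 0, 9, 8, 5]⟩, ⟨726, 0, 3, [1, 2, 7, 9, 6, 10, 4]⟩, ⟨914, 2, 0,
  [10, 1, 4, 8, 9, 7]⟩, ⟨722, 16, 0, [10, 4, 1, 6, 9, 7]⟩]
  (.split 178 [⟨1566, 0, 3, [1, 2, 3, 4, 10, 11, 9]⟩, ⟨1441, 1, 0, [11, 0, 7, 10, 5, 8]⟩, ⟨1067, 8,
  0, [11, 3, 0, 1, 10, 5]⟩, ⟨2015, 1544, 2, [9, 11, 0, 7, 6, 8, 3, 4, 10, 1, 2]⟩, ⟨2015, 208, 2,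
  [4, 11, 8, 10, 3, 0, 6, 9, 7, 2, 1]⟩, ⟨1675, 0, 3, [0, 1, 10, 7, 9, 11, 3]⟩, ⟨1492, 0, 3, [2, 7,
  10, 4, 8, 11, 6]⟩, ⟨1868, 0, 3, [2, 3, 6, 9, 8, 11, 10]⟩]
  (.color [2, 0, 1, 0, 1, 1, 2, 0, 0, 1, 2] [1, 0, 1, 0] [])
  (.dom 5 9))
  (.split 208 [⟨666, 2, 0, [10, 1, 3, 4, 9, 7]⟩, ⟨775, 512, 0, [10, 9, 0, 1, 2, 8]⟩, ⟨709, 1, 0,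
  [10, 0, 2, 7, 9, 6]⟩, ⟨914, 2, 0, [10, 1, 7, 9, 4, 8]⟩]
  (.color [1, 2, 0, 1, 0, 2, 0, 2, 1, 1] [0, 2, 2, 0, 0, 1, 1, 0, 1, 1] [⟨836400, 0, 0, [11, 10, 5,
  8, 4, 9]⟩])
  (.dom 7 1)))
  (.dom 5 1))))
  (.split 37 [⟨186, 130, 0, [3, 4, 1, 8, 7, 5]⟩, ⟨171, 8, 0, [8, 3, 1, 0, 7, 5]⟩, ⟨246, 0, 3, [1, 2,
  7, 5, 6, 8, 4]⟩, ⟨186, 10, 0, [5, 7, 1, 8, 3, 4]⟩, ⟨182, 16, 0, [8, 4, 1, 2, 7, 5]⟩, ⟨244, 16,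
  0, [8, 4, 2, 7, 5, 6]⟩]
  (.split 84 [⟨440, 256, 0, [5, 7, 9, 8, 4, 3]⟩, ⟨466, 128, 0, [9, 7, 1, 6, 8, 4]⟩, ⟨434, 130, 0,
  [4, 8, 1, 9, 7, 5]⟩, ⟨310, 32, 0, [9, 5, 1, 2, 8, 4]⟩, ⟨309, 32, 0, [9, 5, 0, 4, 8, 2]⟩, ⟨427,
  34, 3, [9, 1, 0, 7, 5, 3, 8]⟩]
  (.color [2, 1, 0, 1, 0, 2, 0, 1, 1] [1, 2, 1, 0, 0, 2, 2, 1, 1, 0, 0, 1] [⟨218025, 16385, 3, [10,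
  5, 7, 0, 9, 3, 8]⟩, ⟨202635, 65538, 3, [10, 7, 0, 1, 9, 3, 8]⟩])
  (.split 37 [⟨457, 256, 0, [3, 6, 9, 8, 0, 7]⟩, ⟨299, 8, 0, [9, 3, 1, 0, 8, 5]⟩, ⟨314, 10, 0, [5,
  8, 1, 9, 3, 4]⟩, ⟨310, 16, 0, [9, 4, 1, 2, 8, 5]⟩, ⟨372, 16, 0, [9, 4, 2, 8, 5, 6]⟩, ⟨474, 18,
  3, [9, 1, 6, 3, 4, 7, 8]⟩]
  (.color [0, 1, 0, 1, 2, 0, 2, 1, 1] [1, 2, 1, 0, 0, 0, 0, 1, 2, 2, 1] [⟨242136, 8256, 3, [10, 4,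
  3, 6, 9, 7, 8]⟩, ⟨234954, 4098, 3, [10, 3, 6, 1, 9, 7, 8]⟩])
  (.split 52 [⟨301, 1, 0, [9, 0, 3, 2, 8, 5]⟩, ⟨314, 2, 0, [9, 1, 3, 4, 8, 5]⟩, ⟨299, 264, 0, [0, 1,
  3, 9, 8, 5]⟩, ⟨299, 10, 0, [5, 8, 3, 9, 1, 0]⟩, ⟨365, 0, 3, [2, 3, 6, 5, 8, 9, 0]⟩, ⟨469, 0, 3,
  [0, 4, 8, 2, 7, 9, 6]⟩]
  (.split 69 [⟨841, 256, 0, [10, 8, 0, 9, 6, 3]⟩, ⟨803, 512, 0, [5, 8, 10, 9, 0, 1]⟩, ⟨809, 264, 0,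
  [0, 9, 3, 10, 8, 5]⟩, ⟨946, 144, 3, [10, 4, 8, 5, 7, 1, 9]⟩, ⟨826, 40, 3, [10, 3, 4, 8, 5, 1,
  9]⟩, ⟨724, 16, 0, [10, 4, 6, 9, 2, 7]⟩]
  (.color [0, 1, 0, 1, 2, 2, 0, 1, 1, 1] [2, 0, 1, 2, 0, 0, 1] [⟨813850, 8448, 3, [11, 3, 4, 8, 10,
  1, 9]⟩])
  (.split 52 [⟨557, 1, 0, [10, 0, 3, 2, 9, 5]⟩, ⟨570, 2, 0, [10, 1, 3, 4, 9, 5]⟩, ⟨850, 512, 0, [1,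
  6, 10, 9, 4, 8]⟩, ⟨555, 10, 0, [5, 9, 3, 10, 1, 0]⟩, ⟨963, 192, 3, [10, 6, 1, 0, 7, 8, 9]⟩,
  ⟨843, 9, 3, [10, 0, 1, 6, 3, 8, 9]⟩]
  (.color [2, 0, 1, 0, 1, 1, 2, 0, 0, 0] [1, 1, 2, 1, 2, 0] [⟨921475, 2176, 3, [11, 1, 0, 7, 10, 8,
  9]⟩])
  (.split 321 [⟨809, 8, 0, [10, 3, 0, 9, 8, 5]⟩, ⟨1023, 208, 2, [6, 10, 1, 5, 3, 9, 4, 0, 7, 2, 8]⟩,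
  ⟨1023, 41, 2, [0, 10, 9, 7, 4, 1, 3, 6, 5, 8, 2]⟩, ⟨724, 528, 0, [2, 7, 4, 10, 9, 6]⟩]
  (.split 258 [⟨1181, 0, 3, [0, 4, 3, 2, 7, 11, 10]⟩, ⟨1291, 8, 0, [11, 3, 0, 1, 10, 8]⟩]
  (.color [1, 0, 1, 0, 2, 2, 1, 0, 0, 2, 2] [2, 1, 1, 1] [⟨3866463, 38408, 2, [1, 12, 6, 10, 0, 2,
  4, 3, 11, 9, 8]⟩])
  (.color [0, 2, 1, 2, 1, 1, 0, 2, 0, 2] [2, 1, 1, 0] []))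
  (.split 50 [⟨555, 8, 0, [10, 3, 0, 1, 9, 5]⟩, ⟨1023, 208, 2, [4, 10, 8, 0, 3, 9, 6, 5, 7, 2, 1]⟩,
  ⟨1023, 41, 2, [5, 10, 8, 6, 7, 9, 0, 4, 3, 2, 1]⟩]
  (.color [2, 0, 1, 0, 1, 1, 2, 0, 0, 2] [2, 1, 1, 2] [])
  (.split 258 [⟨669, 0, 3, [0, 4, 3, 2, 7, 10, 9]⟩, ⟨779, 8, 0, [10, 3, 0, 1, 9, 8]⟩, ⟨690, 144, 0,
  [1, 9, 4, 10, 7, 5]⟩, ⟨841, 9, 0, [8, 9, 0, 10, 3, 6]⟩]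
  (.split 648 [⟨1303, 0, 3, [0, 1, 2, 8, 4, 11, 10]⟩]
  (.split 720 [⟨3807, 521, 2, [3, 12, 6, 10, 4, 2, 0, 1, 9, 11, 7]⟩]
  (.color [2, 0, 1, 0, 1, 2, 1, 0, 0, 1, 2, 2] [1, 2] [])
  (.color [1, 0, 1, 0, 2, 1, 2, 0, 0, 1, 2] [1, 2] []))
  (.split 720 []
  (.color [1, 0, 2, 1, 2, 1, 2, 0, 0, 2, 1] [2, 1, 0] [])
  (.split 553 []
  (.color [1, 0, 1, 0, 2, 1, 2, 0, 0, 1, 2] [1, 2] [])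
  (.dom 9 2))))
  (.color [1, 0, 1, 0, 2, 1, 2, 0, 0] [1, 1, 1, 2] []))))))
  (.split 136 [⟨426, 2, 0, [9, 1, 3, 8, 7, 5]⟩, ⟨466, 18, 0, [7, 8, 4, 9, 1, 6]⟩]
  (.split 321 [⟨880, 16, 0, [10, 4, 5, 6, 9, 8]⟩, ⟨817, 32, 0, [10, 5, 4, 0, 9, 8]⟩]
  (.split 65 [⟨1377, 256, 0, [11, 8, 0, 10, 6, 5]⟩, ⟨1196, 1024, 0, [11, 10, 3, 2, 7, 5]⟩, ⟨1798,
  1536, 0, [1, 2, 10, 11, 9, 8]⟩, ⟨1798, 1026, 0, [8, 9, 10, 11, 1, 2]⟩, ⟨1365, 80, 3, [11, 4, 0,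
  10, 6, 2, 8]⟩, ⟨1291, 2, 0, [3, 8, 11, 1, 0, 10]⟩, ⟨1381, 33, 3, [11, 0, 10, 6, 5, 2, 8]⟩,
  ⟨1474, 2, 0, [7, 8, 11, 1, 6, 10]⟩, ⟨1293, 256, 0, [0, 10, 11, 8, 3, 2]⟩, ⟨1549, 1024, 0, [2, 3,
  11, 10, 0, 9]⟩]
  (.color [1, 0, 1, 0, 2, 2, 1, 0, 1, 0, 0] [0, 0, 0, 0, 1, 1, 1, 1, 1, 1, 1, 1] [])
  (.split 321 [⟨1798, 1024, 0, [1, 2, 11, 10, 8, 9]⟩, ⟨1798, 512, 0, [1, 2, 11, 9, 8, 10]⟩, ⟨1692,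
  144, 3, [11, 4, 3, 2, 7, 9, 10]⟩, ⟨1392, 16, 0, [11, 4, 5, 6, 10, 8]⟩, ⟨1708, 40, 3, [11, 3, 2,
  7, 5, 9, 10]⟩, ⟨1329, 32, 0, [11, 5, 4, 0, 10, 8]⟩, ⟨1566, 18, 3, [11, 1, 2, 3, 4, 9, 10]⟩]
  (.color [1, 0, 1, 0, 2, 2, 1, 0, 1, 0, 0] [0, 2, 0, 0, 1, 1, 1, 1, 1, 1, 1, 1] [])
  (.split 69 [⟨1377, 256, 0, [11, 8, 0, 10, 6, 5]⟩, ⟨1798, 1024, 0, [8, 9, 11, 10, 2, 1]⟩, ⟨1798, 2,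
  0, [8, 9, 11, 1, 2, 10]⟩, ⟨1434, 144, 3, [11, 4, 3, 8, 7, 1, 10]⟩, ⟨1140, 16, 0, [11, 4, 2, 10,
  6, 5]⟩, ⟨1450, 40, 3, [11, 3, 8, 7, 5, 1, 10]⟩, ⟨1077, 32, 0, [11, 5, 2, 10, 0, 4]⟩, ⟨1620, 16,
  0, [11, 4, 2, 10, 6, 9]⟩]
  (.color [1, 0, 1, 0, 2, 2, 1, 0, 2, 0, 0] [1, 0, 0, 1, 2, 1, 1, 1, 1, 1, 1, 1] [⟨1247841, 0, 0,
  [12, 11, 0, 9, 6, 5]⟩, ⟨1075725, 8, 0, [0, 9, 12, 11, 3, 2]⟩])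
  (.split 325 [⟨1334, 258, 3, [11, 1, 2, 10, 8, 4, 5]⟩, ⟨1302, 16, 0, [11, 4, 1, 2, 10, 8]⟩, ⟨1140,
  16, 0, [11, 4, 2, 10, 6, 5]⟩, ⟨1318, 32, 0, [11, 5, 1, 2, 10, 8]⟩, ⟨1077, 32, 0, [11, 5, 2, 10,
  0, 4]⟩, ⟨1620, 16, 0, [11, 4, 2, 10, 6, 9]⟩]
  (.color [1, 0, 1, 0, 2, 2, 1, 0, 1, 0, 0] [0, 1, 1, 1, 1, 1, 1, 1, 1, 1, 1] [])
  (.split 136 [⟨1194, 2, 0, [11, 1, 3, 10, 7, 5]⟩, ⟨1633, 1024, 0, [11, 10, 0, 9, 6, 5]⟩, ⟨1363, 80,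
  3, [11, 4, 0, 1, 6, 8, 10]⟩, ⟨1379, 33, 3, [11, 0, 1, 6, 5, 8, 10]⟩, ⟨1547, 2, 0, [3, 10, 11, 1,
  0, 9]⟩, ⟨1549, 1024, 0, [0, 9, 11, 10, 3, 2]⟩]
  (.color [1, 0, 1, 0, 2, 2, 1, 0, 1, 0, 1] [1, 1, 1, 1, 1, 1] [])
  (.split 648 [⟨1194, 2, 0, [11, 1, 3, 10, 7, 5]⟩, ⟨1363, 80, 3, [11, 4, 0, 1, 6, 8, 10]⟩, ⟨1379,
  33, 3, [11, 0, 1, 6, 5, 8, 10]⟩, ⟨1684, 16, 0, [11, 4, 2, 7, 10, 9]⟩]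
  (.color [2, 0, 2, 1, 0, 0, 2, 1, 0, 1, 0] [1, 0, 2, 2, 2, 2, 1] [])
  (.split 138 [⟨1621, 80, 3, [11, 4, 0, 9, 6, 2, 10]⟩, ⟨1637, 33, 3, [11, 0, 9, 6, 5, 2, 10]⟩,
  ⟨1813, 272, 3, [11, 4, 0, 9, 8, 2, 10]⟩]
  (.color [1, 0, 1, 0, 2, 2, 1, 0, 1, 0, 1] [2, 1, 1, 1, 1] [])
  (.split 650 [⟨1842, 258, 3, [11, 1, 10, 9, 8, 4, 5]⟩, ⟨1810, 16, 0, [11, 4, 1, 10, 9, 8]⟩, ⟨1826,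
  32, 0, [11, 5, 1, 10, 9, 8]⟩, ⟨1684, 16, 0, [11, 4, 2, 7, 10, 9]⟩]
  (.color [1, 0, 1, 0, 2, 2, 1, 0, 1, 0, 1] [1, 1, 1] [])
  (.split 208 [⟨1178, 2, 0, [11, 1, 3, 4, 10, 7]⟩, ⟨1078, 1056, 0, [1, 2, 5, 11, 10, 4]⟩, ⟨1426, 2,
  0, [11, 1, 4, 10, 7, 8]⟩, ⟨2043, 306, 2, [6, 1, 10, 9, 5, 3, 11, 4, 0, 7, 8]⟩]
  (.color [1, 0, 1, 0, 2, 1, 2, 0, 1, 0, 1] [2, 1, 1, 2, 2] [⟨4120539, 19714, 2, [0, 12, 7, 1, 4, 9,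
  3, 8, 11, 10, 6]⟩])
  (.split 41 [⟨1194, 2, 0, [11, 1, 3, 10, 5, 7]⟩, ⟨1322, 2, 0, [11, 1, 5, 10, 3, 8]⟩, ⟨2043, 306, 2,
  [0, 1, 10, 9, 4, 7, 11, 5, 6, 3, 8]⟩]
  (.color [0, 1, 2, 0, 1, 0, 2, 1, 2, 1, 1] [0, 0, 1, 2] [])
  (.color [1, 0, 1, 0, 2, 2, 1, 0, 2, 0] [1, 1, 1, 1] [])))))))))))
  (.split 258 [⟨781, 1, 0, [10, 0, 2, 3, 8, 9]⟩, ⟨684, 512, 0, [10, 9, 3, 2, 7, 5]⟩, ⟨669, 0, 3, [0,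
  4, 3, 2, 7, 10, 9]⟩, ⟨865, 65, 0, [8, 9, 0, 10, 6, 5]⟩, ⟨573, 5, 3, [10, 0, 4, 3, 2, 5, 9]⟩,
  ⟨682, 136, 0, [1, 9, 3, 10, 7, 5]⟩, ⟨790, 16, 0, [10, 4, 2, 1, 9, 8]⟩, ⟨806, 32, 0, [10, 5, 2,
  1, 9, 8]⟩]
  (.split 581 [⟨1704, 136, 0, [9, 10, 3, 11, 7, 5]⟩, ⟨1434, 144, 3, [11, 4, 3, 8, 7, 1, 10]⟩, ⟨1140,
  16, 0, [11, 4, 2, 10, 6, 5]⟩, ⟨1450, 40, 3, [11, 3, 8, 7, 5, 1, 10]⟩, ⟨1673, 8, 0, [11, 3, 7, 0,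
  10, 9]⟩, ⟨1236, 16, 0, [11, 4, 6, 10, 2, 7]⟩]
  (.color [1, 0, 1, 0, 2, 2, 1, 0, 2, 1, 0] [0, 2, 1, 1, 1, 1] [])
  (.split 648 [⟨1363, 80, 3, [11, 4, 0, 1, 6, 8, 10]⟩, ⟨1379, 33, 3, [11, 0, 1, 6, 5, 8, 10]⟩,
  ⟨1684, 16, 0, [11, 4, 2, 7, 10, 9]⟩]
  (.color [2, 0, 2, 1, 0, 0, 2, 1, 0, 1, 0] [0, 2, 2, 2, 1] [])
  (.split 720 [⟨1865, 0, 3, [3, 6, 10, 9, 8, 11, 0]⟩, ⟨2015, 521, 2, [3, 11, 6, 8, 4, 2, 0, 1, 9,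
  10, 7]⟩, ⟨1426, 2, 0, [11, 1, 4, 10, 7, 8]⟩, ⟨2015, 274, 2, [1, 11, 2, 9, 0, 6, 4, 3, 8, 7,
  10]⟩]
  (.color [2, 1, 2, 1, 0, 1, 0, 0, 2, 0, 1] [2, 1, 0] [])
  (.split 553 [⟨1322, 2, 0, [11, 1, 5, 10, 3, 8]⟩, ⟨1985, 0, 3, [0, 7, 8, 9, 10, 11, 6]⟩, ⟨2031,
  290, 2, [1, 11, 2, 9, 6, 0, 5, 7, 8, 3, 10]⟩]
  (.color [0, 1, 2, 0, 1, 0, 2, 1, 2, 0, 1] [2, 0, 1] [])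
  (.color [2, 0, 2, 1, 0, 0, 2, 1, 0, 1] [2, 2, 2, 1] [])))))
  (.split 306 [⟨781, 1, 0, [10, 0, 2, 3, 8, 9]⟩, ⟨557, 513, 0, [2, 3, 0, 10, 9, 5]⟩, ⟨809, 1, 0,
  [10, 0, 3, 8, 9, 5]⟩, ⟨557, 5, 0, [5, 9, 0, 10, 2, 3]⟩, ⟨555, 8, 0, [10, 3, 0, 1, 9, 5]⟩, ⟨1023,
  208, 2, [7, 10, 2, 5, 0, 8, 4, 3, 6, 1, 9]⟩, ⟨873, 0, 3, [3, 6, 5, 9, 8, 10, 0]⟩, ⟨1023, 41, 2,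
  [3, 10, 8, 6, 4, 2, 0, 7, 5, 9, 1]⟩, ⟨977, 0, 3, [0, 4, 9, 8, 7, 10, 6]⟩]
  (.color [1, 0, 1, 0, 2, 2, 1, 0, 2, 1] [0, 2, 1, 1] [])
  (.dom 8 2))))
  (.color [1, 0, 1, 0, 2, 0, 1, 2] [0, 1, 0, 1, 0, 1, 2, 1, 1] [])))))
  (.split 52 [⟨173, 1, 0, [8, 0, 3, 2, 7, 5]⟩, ⟨186, 2, 0, [8, 1, 3, 4, 7, 5]⟩, ⟨171, 136, 0, [0, 1,
  3, 8, 7, 5]⟩, ⟨229, 1, 0, [8, 0, 2, 7, 5, 6]⟩, ⟨171, 10, 0, [5, 7, 3, 8, 1, 0]⟩, ⟨237, 0, 3, [2,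
  3, 6, 5, 7, 8, 0]⟩]
  (.split 69 [⟨457, 128, 0, [9, 7, 0, 8, 6, 3]⟩, ⟨419, 256, 0, [5, 7, 9, 8, 0, 1]⟩, ⟨425, 136, 0,
  [0, 8, 3, 9, 7, 5]⟩, ⟨442, 40, 3, [9, 3, 4, 7, 5, 1, 8]⟩, ⟨309, 32, 0, [9, 5, 2, 8, 0, 4]⟩,
  ⟨301, 32, 0, [9, 5, 0, 8, 2, 3]⟩]
  (.color [0, 1, 0, 1, 2, 2, 0, 1, 1] [2, 0, 1, 2, 2, 0, 1, 1, 0, 0, 1] [⟨210330, 4224, 3, [10, 3,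
  4, 7, 9, 1, 8]⟩])
  (.split 52 [⟨301, 1, 0, [9, 0, 3, 2, 8, 5]⟩, ⟨314, 2, 0, [9, 1, 3, 4, 8, 5]⟩, ⟨466, 256, 0, [1, 6,
  9, 8, 4, 7]⟩, ⟨357, 1, 0, [9, 0, 2, 8, 5, 6]⟩, ⟨299, 10, 0, [5, 8, 3, 9, 1, 0]⟩, ⟨459, 9, 3, [9,
  0, 1, 6, 3, 7, 8]⟩]
  (.color [2, 1, 0, 1, 0, 0, 2, 1, 1] [0, 0, 2, 0, 0, 1, 1, 2, 2, 1] [⟨234954, 1032, 3, [10, 1, 6,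
  3, 9, 7, 8]⟩])
  (.split 130 [⟨395, 8, 0, [9, 3, 0, 1, 8, 7]⟩, ⟨457, 9, 0, [7, 8, 0, 9, 3, 6]⟩]
  (.split 264 [⟨781, 1, 0, [10, 0, 2, 3, 9, 8]⟩, ⟨682, 130, 0, [3, 9, 1, 10, 7, 5]⟩, ⟨663, 0, 3, [0,
  1, 2, 7, 4, 10, 9]⟩, ⟨790, 16, 0, [10, 4, 2, 1, 8, 9]⟩, ⟨647, 512, 0, [10, 9, 0, 1, 2, 7]⟩,
  ⟨789, 20, 0, [8, 9, 2, 10, 4, 0]⟩, ⟨567, 20, 3, [10, 2, 1, 0, 4, 5, 9]⟩, ⟨812, 32, 0, [10, 5, 2,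
  3, 9, 8]⟩]
  (.split 705 [⟨1369, 0, 3, [0, 4, 3, 6, 10, 11, 8]⟩, ⟨1874, 0, 3, [1, 6, 10, 9, 8, 11, 4]⟩, ⟨1419,
  0, 3, [0, 1, 8, 7, 10, 11, 3]⟩, ⟨2015, 265, 2, [3, 11, 2, 9, 4, 6, 0, 1, 8, 7, 10]⟩, ⟨1682, 2,
  0, [11, 1, 4, 7, 10, 9]⟩, ⟨2015, 530, 2, [1, 11, 6, 8, 0, 2, 4, 3, 9, 10, 7]⟩]
  (.color [0, 1, 2, 1, 2, 1, 0, 0, 2, 0, 1] [1, 2, 1, 0] [])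
  (.split 297 [⟨1082, 2, 0, [11, 1, 4, 3, 10, 5]⟩, ⟨1394, 0, 3, [1, 6, 5, 10, 8, 11, 4]⟩, ⟨1330, 16,
  0, [11, 4, 1, 8, 10, 5]⟩, ⟨1489, 0, 3, [0, 4, 7, 8, 10, 11, 6]⟩, ⟨1535, 50, 2, [1, 11, 8, 6, 0,
  2, 4, 7, 5, 10, 3]⟩]
  (.color [0, 1, 2, 0, 2, 0, 2, 1, 0, 1, 1] [0, 2, 1, 0, 1] [])
  (.color [1, 0, 1, 0, 2, 2, 1, 0, 1, 2] [1, 2, 1, 0, 0, 1, 1] [])))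
  (.split 336 [⟨865, 1, 0, [10, 0, 5, 6, 9, 8]⟩, ⟨817, 32, 0, [10, 5, 0, 4, 9, 8]⟩]
  (.split 297 [⟨2043, 193, 2, [6, 11, 9, 5, 1, 3, 0, 4, 7, 8, 10]⟩, ⟨1082, 2, 0, [11, 1, 4, 3, 10,
  5]⟩, ⟨1586, 1026, 0, [4, 9, 1, 11, 10, 5]⟩, ⟨1394, 0, 3, [1, 6, 5, 10, 8, 11, 4]⟩, ⟨1813, 0, 3,
  [0, 4, 9, 8, 10, 11, 2]⟩, ⟨1586, 514, 0, [5, 10, 1, 11, 9, 4]⟩, ⟨1330, 16, 0, [11, 4, 1, 8, 10,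
  5]⟩, ⟨1078, 1040, 0, [1, 2, 4, 11, 10, 5]⟩, ⟨1551, 0, 3, [0, 1, 2, 3, 10, 11, 9]⟩, ⟨1588, 20, 0,
  [5, 10, 2, 11, 4, 9]⟩, ⟨1489, 0, 3, [0, 4, 7, 8, 10, 11, 6]⟩, ⟨1535, 50, 2, [1, 11, 8, 6, 0, 2,
  4, 7, 5, 10, 3]⟩]
  (.color [2, 1, 0, 1, 0, 2, 0, 1, 2, 1, 0] [2, 1, 0] [])
  (.color [2, 0, 1, 0, 1, 0, 1, 2, 1, 0] [0, 1, 1, 1, 1, 1, 0, 0, 0, 0, 1, 2] []))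
  (.split 297 [⟨1023, 193, 2, [7, 10, 2, 5, 4, 8, 0, 1, 6, 3, 9]⟩, ⟨570, 2, 0, [10, 1, 4, 3, 9, 5]⟩,
  ⟨882, 0, 3, [1, 6, 5, 9, 8, 10, 4]⟩, ⟨818, 16, 0, [10, 4, 1, 8, 9, 5]⟩, ⟨566, 528, 0, [1, 2, 4,
  10, 9, 5]⟩, ⟨566, 20, 0, [5, 9, 4, 10, 2, 1]⟩, ⟨977, 0, 3, [0, 4, 7, 8, 9, 10, 6]⟩, ⟨1023, 50,
  2, [1, 10, 8, 6, 0, 2, 4, 7, 5, 9, 3]⟩]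
  (.color [1, 0, 2, 1, 2, 1, 2, 0, 1, 0] [1, 2, 1, 0] [])
  (.dom 8 2))))
  (.color [2, 0, 1, 0, 1, 0, 1, 2] [0, 1, 1, 1, 0, 0, 1, 1, 2] []))))
  (.dom 2 6))))
  (.split 50 [⟨109, 65, 0, [2, 3, 0, 7, 6, 5]⟩, ⟨117, 4, 0, [7, 2, 0, 4, 6, 5]⟩, ⟨109, 5, 0, [5, 6,
  0, 7, 2, 3]⟩, ⟨107, 8, 0, [7, 3, 0, 1, 6, 5]⟩, ⟨109, 9, 0, [5, 6, 0, 7, 3, 2]⟩]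
  (.split 37 [⟨186, 130, 0, [3, 4, 1, 8, 7, 5]⟩, ⟨171, 8, 0, [8, 3, 1, 0, 7, 5]⟩, ⟨233, 8, 0, [8, 3,
  0, 7, 5, 6]⟩, ⟨182, 16, 0, [8, 4, 1, 2, 7, 5]⟩, ⟨186, 18, 0, [5, 7, 1, 8, 4, 3]⟩, ⟨235, 0, 3,
  [0, 1, 6, 5, 7, 8, 3]⟩]
  (.split 41 [⟨426, 2, 0, [9, 1, 3, 8, 5, 7]⟩, ⟨309, 4, 0, [9, 2, 4, 0, 8, 5]⟩, ⟨373, 0, 3, [0, 4,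
  6, 5, 8, 9, 2]⟩, ⟨310, 272, 0, [1, 2, 4, 9, 8, 5]⟩, ⟨310, 18, 0, [5, 8, 4, 9, 1, 2]⟩, ⟨461, 0,
  3, [0, 7, 2, 3, 8, 9, 6]⟩]
  (.split 324 [⟨613, 1, 0, [10, 0, 2, 9, 6, 5]⟩, ⟨1023, 200, 2, [6, 10, 1, 5, 4, 9, 3, 2, 7, 0, 8]⟩,
  ⟨948, 0, 3, [2, 7, 5, 8, 9, 10, 4]⟩, ⟨790, 16, 0, [10, 4, 1, 2, 9, 8]⟩, ⟨984, 0, 3, [3, 4, 6, 9,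
  8, 10, 7]⟩, ⟨713, 9, 0, [6, 9, 3, 10, 0, 7]⟩, ⟨1023, 52, 2, [2, 10, 9, 7, 3, 1, 4, 6, 5, 8, 0]⟩]
  (.color [0, 2, 1, 0, 2, 0, 1, 2, 1, 0] [1, 0, 0, 2, 1, 0, 1] [])
  (.split 200 [⟨589, 1, 0, [10, 0, 2, 3, 9, 6]⟩, ⟨682, 2, 0, [10, 1, 3, 9, 7, 5]⟩, ⟨938, 0, 3, [3,
  8, 5, 7, 9, 10, 1]⟩, ⟨837, 5, 0, [6, 9, 2, 10, 0, 8]⟩, ⟨966, 0, 3, [1, 2, 7, 9, 6, 10, 8]⟩,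
  ⟨837, 516, 0, [0, 8, 2, 10, 9, 6]⟩]
  (.split 770 [⟨1181, 0, 3, [0, 4, 3, 2, 7, 11, 10]⟩, ⟨1194, 136, 0, [1, 10, 3, 11, 7, 5]⟩, ⟨1686,
  0, 3, [1, 2, 7, 9, 10, 11, 4]⟩, ⟨1194, 1032, 0, [5, 7, 3, 11, 10, 1]⟩, ⟨1330, 16, 0, [11, 4, 1,
  10, 8, 5]⟩, ⟨1797, 4, 0, [11, 2, 0, 8, 10, 9]⟩]
  (.split 1168 [⟨2318, 2048, 0, [12, 11, 1, 2, 3, 8]⟩, ⟨2319, 0, 3, [0, 1, 2, 3, 8, 12, 11]⟩, ⟨3348,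
  4, 0, [12, 2, 4, 11, 10, 8]⟩, ⟨3807, 1044, 2, [4, 12, 6, 11, 3, 0, 2, 1, 10, 9, 7]⟩]
  (.color [1, 0, 1, 2, 0, 1, 2, 0, 0, 1, 2, 1] [0, 1, 1, 0] [])
  (.color [0, 1, 2, 0, 2, 2, 0, 1, 1, 2, 0] [1, 2, 0, 1, 1] [⟨3653367, 2204161, 2, [12, 2, 4, 10, 5,
  11, 7, 0, 1, 6, 9]⟩]))
  (.color [0, 1, 2, 0, 1, 2, 0, 1, 1, 2] [1, 2, 1, 0, 0, 1, 0] []))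
  (.color [0, 2, 1, 0, 1, 1, 0, 2, 2] [1, 1, 2, 1, 0, 0, 2, 2, 0] [⟨47196, 0, 0, [10, 9, 2, 3, 4,
  6]⟩, ⟨87210, 4098, 0, [5, 7, 3, 10, 9, 1]⟩])))
  (.split 200 [⟨333, 1, 0, [9, 0, 2, 3, 8, 6]⟩, ⟨426, 2, 0, [9, 1, 3, 8, 7, 5]⟩, ⟨299, 33, 0, [3, 8,
  5, 9, 0, 1]⟩, ⟨299, 34, 0, [3, 8, 5, 9, 1, 0]⟩, ⟨299, 288, 0, [0, 1, 5, 9, 8, 3]⟩]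
  (.split 52 [⟨613, 1, 0, [10, 0, 2, 9, 5, 6]⟩, ⟨570, 2, 0, [10, 1, 3, 4, 9, 5]⟩, ⟨791, 0, 3, [0, 1,
  2, 9, 4, 10, 8]⟩, ⟨555, 520, 0, [0, 1, 3, 10, 9, 5]⟩, ⟨809, 9, 0, [5, 9, 0, 10, 3, 8]⟩, ⟨810,
  10, 0, [5, 9, 1, 10, 3, 8]⟩, ⟨963, 0, 3, [0, 1, 6, 8, 7, 10, 9]⟩]
  (.split 769 [⟨1118, 0, 3, [1, 2, 3, 4, 6, 11, 10]⟩, ⟨2015, 770, 2, [8, 11, 3, 10, 6, 7, 1, 2, 9,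
  4, 0]⟩, ⟨1301, 4, 0, [11, 2, 4, 0, 10, 8]⟩, ⟨2015, 1092, 2, [2, 11, 7, 9, 1, 3, 6, 8, 10, 0,
  4]⟩, ⟨1818, 0, 3, [3, 4, 9, 10, 8, 11, 1]⟩, ⟨1365, 0, 3, [0, 4, 6, 8, 10, 11, 2]⟩, ⟨1126, 1024,
  0, [11, 10, 2, 1, 6, 5]⟩, ⟨1802, 2, 0, [11, 1, 3, 8, 10, 9]⟩, ⟨1733, 0, 3, [0, 7, 2, 9, 10, 11,
  6]⟩]
  (.color [0, 1, 0, 2, 1, 0, 2, 1, 0, 2, 1] [1, 0, 0, 1] [])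
  (.color [1, 0, 1, 2, 0, 0, 1, 2, 0, 2] [1, 0, 0, 0, 1, 1, 1, 2, 1] [⟨1015775, 148226, 2, [4, 11,
  6, 9, 0, 3, 7, 8, 10, 1, 2]⟩]))
  (.dom 5 8))
  (.color [1, 0, 1, 0, 2, 2, 1, 0] [2, 2, 0, 0, 2, 1, 1, 1, 0, 1, 0] [⟨23644, 0, 0, [9, 8, 2, 3, 4,
  6]⟩, ⟨43690, 2050, 0, [5, 7, 3, 9, 8, 1]⟩])))
  (.split 41 [⟨186, 2, 0, [8, 1, 4, 3, 7, 5]⟩, ⟨181, 4, 0, [8, 2, 4, 0, 7, 5]⟩, ⟨245, 0, 3, [0, 4,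
  6, 5, 7, 8, 2]⟩, ⟨182, 144, 0, [1, 2, 4, 8, 7, 5]⟩, ⟨182, 18, 0, [5, 7, 4, 8, 1, 2]⟩, ⟨229, 4,
  0, [8, 2, 0, 7, 5, 6]⟩]
  (.split 196 [⟨357, 1, 0, [9, 0, 2, 8, 6, 5]⟩, ⟨406, 16, 0, [9, 4, 1, 2, 8, 7]⟩, ⟨309, 33, 0, [2,
  8, 5, 9, 0, 4]⟩, ⟨309, 48, 0, [2, 8, 5, 9, 4, 0]⟩]
  (.color [1, 0, 2, 1, 0, 0, 1, 2, 0] [2, 1, 0, 0, 0, 0, 2, 1, 1, 2, 1, 1] [⟨262143, 26754, 2, [7,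
  5, 0, 8, 9, 3, 10, 4, 6, 1, 2]⟩])
  (.color [1, 2, 0, 1, 0, 0, 1, 2] [0, 1, 2, 2, 0, 2, 1, 1, 2, 1, 2] [⟨42662, 4, 0, [5, 7, 9, 8, 2,
  1]⟩, ⟨41891, 0, 0, [9, 8, 1, 0, 7, 5]⟩, ⟨50629, 1088, 0, [0, 7, 2, 9, 8, 6]⟩, ⟨13878, 8208, 0,
  [1, 2, 5, 9, 8, 4]⟩]))
  (.dom 5 4)))
  (.split 52 [⟨109, 1, 0, [7, 0, 3, 2, 6, 5]⟩, ⟨122, 2, 0, [7, 1, 3, 4, 6, 5]⟩, ⟨107, 72, 0, [0, 1,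
  3, 7, 6, 5]⟩, ⟨107, 9, 0, [5, 6, 3, 7, 0, 1]⟩, ⟨107, 10, 0, [5, 6, 3, 7, 1, 0]⟩]
  (.split 41 [⟨186, 2, 0, [8, 1, 4, 3, 7, 5]⟩, ⟨181, 4, 0, [8, 2, 4, 0, 7, 5]⟩, ⟨250, 0, 3, [3, 4,
  6, 5, 7, 8, 1]⟩, ⟨182, 144, 0, [1, 2, 4, 8, 7, 5]⟩, ⟨234, 2, 0, [8, 1, 3, 7, 5, 6]⟩, ⟨182, 20,
  0, [5, 7, 4, 8, 2, 1]⟩]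
  (.split 194 [⟨331, 8, 0, [9, 3, 0, 1, 8, 6]⟩, ⟨434, 16, 0, [9, 4, 1, 8, 7, 5]⟩, ⟨314, 288, 0, [3,
  4, 5, 9, 8, 1]⟩, ⟨314, 40, 0, [1, 8, 5, 9, 3, 4]⟩, ⟨314, 48, 0, [1, 8, 5, 9, 4, 3]⟩]
  (.split 37 [⟨797, 0, 3, [0, 4, 3, 2, 9, 10, 8]⟩, ⟨570, 514, 0, [3, 4, 1, 10, 9, 5]⟩, ⟨617, 8, 0,
  [10, 3, 0, 9, 5, 6]⟩, ⟨570, 10, 0, [5, 9, 1, 10, 3, 4]⟩, ⟨566, 16, 0, [10, 4, 1, 2, 9, 5]⟩,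
  ⟨570, 18, 0, [5, 9, 1, 10, 4, 3]⟩, ⟨984, 0, 3, [3, 4, 6, 8, 7, 10, 9]⟩]
  (.split 776 [⟨1293, 1, 0, [11, 0, 2, 3, 10, 8]⟩, ⟨2015, 1089, 2, [0, 11, 7, 9, 4, 1, 6, 8, 10, 3,
  2]⟩, ⟨1137, 1024, 0, [11, 10, 0, 4, 6, 5]⟩, ⟨1111, 0, 3, [0, 1, 2, 6, 4, 11, 10]⟩, ⟨1814, 0, 3,
  [1, 2, 9, 10, 8, 11, 4]⟩, ⟨2015, 784, 2, [8, 11, 1, 10, 6, 7, 4, 0, 9, 2, 3]⟩, ⟨1357, 0, 3, [2,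
  3, 10, 8, 6, 11, 0]⟩, ⟨1810, 16, 0, [11, 4, 1, 8, 10, 9]⟩, ⟨1737, 0, 3, [0, 7, 3, 10, 9, 11,
  6]⟩]
  (.color [1, 2, 0, 1, 0, 1, 2, 0, 1, 2, 0] [1, 0, 1, 0] [])
  (.color [0, 2, 1, 0, 1, 1, 0, 2, 1, 2] [1, 0, 1, 1, 0, 0, 0, 2, 0] [⟨1046525, 802948, 2, [7, 8, 3,
  5, 10, 0, 11, 4, 6, 2, 9]⟩]))
  (.dom 5 8))
  (.color [1, 0, 2, 1, 0, 2, 1, 0] [0, 1, 2, 0, 2, 2, 1, 1, 0, 0, 1] [⟨18247, 0, 0, [9, 8, 0, 1, 2,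
  6]⟩, ⟨42662, 2, 0, [5, 7, 9, 8, 1, 2]⟩]))
  (.dom 5 2))
  (.dom 5 0)))

/-- The types that cannot occur next to an induced `C₇ ∪ K₁`. -/
def heptagonIsolatedCopies : List Copy :=
  [⟨61, 1, 0, [8, 0, 2, 3, 4, 5]⟩, ⟨122, 2, 0, [8, 1, 3, 4, 5, 6]⟩, ⟨117, 4, 0, [8, 2, 0, 6, 5, 4]⟩,
  ⟨107, 8, 0, [8, 3, 1, 0, 6, 5]⟩, ⟨55, 1, 0, [4, 5, 8, 0, 1, 2]⟩, ⟨3, 3, 1, [8, 0, 1]⟩, ⟨12, 12,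
  1, [8, 2, 3]⟩, ⟨87, 16, 0, [8, 4, 2, 1, 0, 6]⟩, ⟨109, 1, 0, [2, 3, 8, 0, 6, 5]⟩, ⟨110, 2, 0, [5,
  6, 8, 1, 2, 3]⟩, ⟨241, 17, 4, [8, 0, 6, 5, 4, 7]⟩, ⟨6, 6, 1, [8, 1, 2]⟩, ⟨24, 24, 1, [8, 3, 4]⟩,
  ⟨47, 32, 0, [8, 5, 0, 1, 2, 3]⟩, ⟨91, 2, 0, [3, 4, 8, 1, 0, 6]⟩, ⟨93, 4, 0, [0, 6, 8, 2, 3, 4]⟩,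
  ⟨188, 36, 4, [8, 2, 3, 4, 5, 7]⟩, ⟨143, 9, 4, [8, 0, 1, 2, 3, 7]⟩, ⟨227, 34, 4, [8, 1, 0, 6, 5,
  7]⟩, ⟨48, 48, 1, [8, 4, 5]⟩, ⟨94, 64, 0, [8, 6, 1, 2, 3, 4]⟩, ⟨55, 4, 0, [4, 5, 8, 2, 1, 0]⟩,
  ⟨65, 65, 1, [8, 0, 6]⟩, ⟨59, 8, 0, [0, 1, 8, 3, 4, 5]⟩, ⟨248, 72, 4, [8, 3, 4, 5, 6, 7]⟩, ⟨158,
  18, 4, [8, 1, 2, 3, 4, 7]⟩, ⟨199, 68, 4, [8, 2, 1, 0, 6, 7]⟩, ⟨96, 96, 1, [8, 5, 6]⟩, ⟨143, 128,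
  0, [8, 7, 0, 1, 2, 3]⟩, ⟨248, 128, 0, [8, 7, 3, 4, 5, 6]⟩, ⟨241, 128, 0, [8, 7, 0, 6, 5, 4]⟩,
  ⟨227, 128, 0, [8, 7, 1, 0, 6, 5]⟩, ⟨230, 132, 0, [5, 6, 7, 8, 2, 1]⟩, ⟨158, 128, 0, [8, 7, 1, 2,
  3, 4]⟩, ⟨155, 129, 0, [3, 4, 7, 8, 0, 1]⟩, ⟨199, 128, 0, [8, 7, 2, 1, 0, 6]⟩, ⟨182, 160, 0, [1,
  2, 7, 8, 5, 4]⟩, ⟨205, 136, 0, [0, 6, 7, 8, 3, 2]⟩, ⟨188, 128, 0, [8, 7, 2, 3, 4, 5]⟩, ⟨179,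
  130, 0, [4, 5, 7, 8, 1, 0]⟩, ⟨205, 192, 0, [2, 3, 7, 8, 6, 0]⟩, ⟨155, 144, 0, [0, 1, 7, 8, 4,
  3]⟩]

/-- The refutation of an induced `C₇ ∪ K₁`. -/
def heptagonIsolatedTree : Tree :=
  .color [0, 1, 0, 1, 0, 1, 2, 0] [0, 1, 0, 1, 2, 0, 0, 1] [⟨3855, 0, 0, [9, 8, 0, 1, 2, 3]⟩,
  ⟨29041, 0, 0, [9, 8, 0, 6, 5, 4]⟩, ⟨18247, 0, 0, [9, 8, 2, 1, 0, 6]⟩, ⟨15420, 0, 0, [9, 8, 2, 3,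
  4, 5]⟩, ⟨40092, 4100, 4, [9, 4, 3, 2, 8, 7]⟩, ⟨36494, 520, 4, [9, 1, 2, 3, 8, 7]⟩]


/-- The code of the Grötzsch graph. -/
def grotzschCode : List ℕ := [62, 321, 641, 1281, 577, 1153, 1170, 356, 650, 1300, 616]

/-- The codes of `P₂ ∪ P₄`, of the triangle and of the Grötzsch graph. -/
def forbidden : List (List ℕ) :=
  [[2, 1, 8, 20, 40, 16], [6, 5, 3], grotzschCode]

/-- The code of `C₅ ∪ 2K₁`. -/
def pentagonTwoIsolated : List ℕ := [18, 5, 10, 20, 9, 0, 0]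

/-- The code of `C₅ ∪ K₁`. -/
def pentagonIsolated : List ℕ := [18, 5, 10, 20, 9, 0]

/-- The code of `C₇ ∪ K₁`. -/
def heptagonIsolated : List ℕ := [66, 5, 10, 20, 40, 80, 33, 0]

theorem checkStart_pentagonTwoIsolated :
    checkStart forbidden pentagonTwoIsolated pentagonTwoIsolatedCopies
      pentagonTwoIsolatedTree = true := by
  decide +kernel

theorem checkStart_pentagonIsolated :
    checkStart (forbidden ++ [pentagonTwoIsolated]) pentagonIsolated pentagonIsolatedCopies
      pentagonIsolatedTree = true := by
  decide +kernel

theorem checkStart_heptagonIsolated :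
    checkStart (forbidden ++ [pentagonTwoIsolated] ++ [pentagonIsolated]) heptagonIsolated
      heptagonIsolatedCopies heptagonIsolatedTree = true := by
  decide +kernel

/-! ### Odd cycles -/

/-- The vertices `g 0, …, g (n - 1)` form an induced cycle of length `n`. -/
def IsInducedCycle (G : SimpleGraph V) (n : ℕ) (g : ℕ → V) : Prop :=
  ∀ j < n, ∀ i < j, g i ≠ g j ∧ (G.Adj (g i) (g j) ↔ j = i + 1 ∨ (i = 0 ∧ j + 1 = n))

/-- The part of a walk between two of its vertices. -/
theorem exists_walk_getVert {u v : V} (p : G.Walk u v) (i k : ℕ) (h : i + k ≤ p.length) :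
    ∃ q : G.Walk (p.getVert i) (p.getVert (i + k)), q.length = k := by
  induction k with
  | zero => exact ⟨.nil, rfl⟩
  | succ k ih =>
    obtain ⟨q, hq⟩ := ih (by omega)
    exact ⟨q.concat (p.adj_getVert_succ (by omega)), by simp [hq]⟩

/-- A shortest odd closed walk is an induced cycle. -/
theorem exists_isInducedCycle (h : ¬ G.Colorable 2) :
    ∃ n g, Odd n ∧ 3 ≤ n ∧ IsInducedCycle G n g := by
  classical
  rw [two_colorable_iff_forall_loop_even] at h
  push Not at h
  obtain ⟨u₀, p₀, hp₀⟩ := h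
  have hex : ∃ n, Odd n ∧ ∃ (u : V) (p : G.Walk u u), p.length = n :=
    ⟨_, Nat.not_even_iff_odd.1 hp₀, u₀, p₀, rfl⟩
  obtain ⟨hodd, u, p, hp⟩ := Nat.find_spec hex
  have hmin : ∀ m, Odd m → m < Nat.find hex → ∀ (w : V) (q : G.Walk w w), q.length ≠ m :=
    fun m hm hlt w q hq => Nat.find_min hex hlt ⟨hm, w, q, hq⟩
  generalize Nat.find hex = n at hodd hp hmin
  have harc : ∀ i j, i < j → j < n →
      (∃ q : G.Walk (p.getVert i) (p.getVert j), q.length = j - i) ∧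
      ∃ q : G.Walk (p.getVert j) (p.getVert i), q.length = n - (j - i) := by
    intro i j hij hj
    constructor
    · have := exists_walk_getVert p i (j - i) (by omega)
      rwa [Nat.add_sub_cancel' hij.le] at this
    · obtain ⟨q, hq⟩ := exists_walk_getVert p j (n - j) (by omega)
      have h1 : p.getVert (j + (n - j)) = u := by
        rw [Nat.add_sub_cancel' hj.le, ← hp, Walk.getVert_length]
      have h2 : p.getVert 0 = u := p.getVert_zero
      obtain ⟨r, hr⟩ := exists_walk_getVert p 0 i (by omega)
      refine ⟨(q.copy rfl (h1.trans h2.symm)).append (r.copy rfl (by rw [Nat.zero_add])), ?_⟩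
      simp [hq, hr]
      omega
  rw [Nat.odd_iff] at hodd
  simp only [Nat.odd_iff] at hmin
  refine ⟨n, p.getVert, Nat.odd_iff.2 hodd, ?_, ?_⟩
  · by_contra hlt
    obtain rfl : n = 1 := by omega
    exact G.loopless.irrefl _ (Walk.adj_of_length_eq_one hp)
  · intro j hj i hij
    obtain ⟨⟨q, hq⟩, r, hr⟩ := harc i j hij hj
    refine ⟨fun heq => ?_, fun hadj => ?_, ?_⟩
    · rcases Nat.mod_two_eq_zero_or_one (j - i) with h | h
      · exact hmin (n - (j - i)) (by omega) (by omega) _ (r.copy rfl heq) (by simpa using hr)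
      · exact hmin (j - i) h (by omega) _ (q.copy rfl heq.symm) (by simpa using hq)
    · by_contra hcon
      rcases Nat.mod_two_eq_zero_or_one (j - i) with h | h
      · exact hmin (j - i + 1) (by omega) (by omega) _ (q.cons hadj.symm) (by simpa using hq)
      · exact hmin (n - (j - i) + 1) (by omega) (by omega) _ (r.cons hadj) (by simpa using hr)
    · rintro (rfl | ⟨rfl, h⟩)
      · exact p.adj_getVert_succ (by omega)
      · have := p.adj_getVert_succ (i := j) (by omega)
        rw [h, ← hp, Walk.getVert_length] at this
        simpa using this.symm

theorem IsInducedCycle.of_induce {S : Set V} {n : ℕ} {g : ℕ → S}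
    (h : IsInducedCycle (G.induce S) n g) : IsInducedCycle G n fun i => (g i : V) := by
  intro j hj i hij
  exact ⟨fun h' => (h j hj i hij).1 (Subtype.ext h'), (h j hj i hij).2⟩

/-- If `G` is not 3-colourable, then every vertex misses some induced odd cycle. -/
theorem exists_isInducedCycle_nonadj (h : ¬ G.Colorable 3) (x : V)
    (hT : ∀ a b c, G.Adj a b → G.Adj b c → ¬ G.Adj a c) :
    ∃ n g, Odd n ∧ 3 ≤ n ∧ IsInducedCycle G n g ∧ ∀ i < n, ¬ G.Adj (g i) x := by
  classical
  by_cases h2 : (G.induce {v | ¬ G.Adj v x}).Colorable 2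
  · obtain ⟨c⟩ := h2
    refine absurd ⟨Coloring.mk (fun v => if hv : G.Adj v x then (2 : Fin 3)
      else (c ⟨v, hv⟩).castSucc) ?_⟩ h
    intro u v huv
    by_cases hu : G.Adj u x <;> by_cases hv : G.Adj v x <;>
      simp only [hu, hv, dite_true, dite_false]
    · exact absurd hu (hT _ _ _ huv hv)
    · exact (Fin.castSucc_lt_last _).ne'
    · exact (Fin.castSucc_lt_last _).ne
    · have := c.valid (v := ⟨u, hu⟩) (w := ⟨v, hv⟩) huv
      simpa using this
  · obtain ⟨n, g, hn, hn3, hg⟩ := exists_isInducedCycle h2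
    exact ⟨n, _, hn, hn3, hg.of_induce, fun i _ => (g i).2⟩

theorem IsInducedCycle.represents_p2UnionP4 {n : ℕ} {g : ℕ → V} (h : IsInducedCycle G n g)
    (hn : 8 ≤ n) :
    Represents G (fun i => g ([0, 1, 3, 4, 5, 6].getD i 0)) [2, 1, 8, 20, 40, 16] := by
  intro j hj i hi
  simp only [List.length_cons, List.length_nil] at hj
  interval_cases j <;> interval_cases i <;>
    · refine ⟨(h _ (by simp; omega) _ (by simp)).1, (h _ (by simp; omega) _ (by simp)).2.trans ?_⟩
      simp [Nat.testBit] <;> omega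

theorem IsInducedCycle.represents_isolated {n : ℕ} {g : ℕ → V} (h : IsInducedCycle G n g)
    {x : V} (hx : ∀ i < n, g i ≠ x ∧ ¬ G.Adj (g i) x) {A : List ℕ} (hA : A.length = n + 1)
    (hcode : ∀ j < n, ∀ i < j, (A.getD j 0).testBit i = true ↔ j = i + 1 ∨ (i = 0 ∧ j + 1 = n))
    (hlast : ∀ i < n, (A.getD n 0).testBit i = false) :
    Represents G (Function.update g n x) A := by
  intro j hj i hi
  rw [Function.update_of_ne (by omega : i ≠ n)]
  rcases Nat.lt_succ_iff_lt_or_eq.1 (hA ▸ hj) with h' | rfl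
  · rw [Function.update_of_ne h'.ne, hcode j h' i hi]
    exact h j h' i hi
  · rw [Function.update_self, hlast i hi]
    simpa using hx i hi

/-- No graph avoiding the forbidden graphs is non-3-colourable without dominated vertices. -/
theorem not_setting [Nonempty V] : ¬ Setting G forbidden := by
  intro S₀
  have S₁ := S₀.cons checkStart_pentagonTwoIsolated
  have S₂ := S₁.cons checkStart_pentagonIsolated
  have S₃ := S₂.cons checkStart_heptagonIsolated
  obtain ⟨x⟩ := ‹Nonempty V›
  obtain ⟨n, g, hodd, hn, hg, hx⟩ := exists_isInducedCycle_nonadj S₀.not_colorable x S₀.tri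
  have hx' : ∀ i < n, g i ≠ x ∧ ¬ G.Adj (g i) x := by
    refine fun i hi => ⟨fun h => ?_, hx i hi⟩
    rcases Nat.eq_zero_or_pos i with rfl | hi0
    · exact hx 1 (by omega) (h ▸ ((hg 1 (by omega) 0 (by omega)).2.2 (by simp)).symm)
    · refine hx (i - 1) (by omega) (h ▸ (hg i hi (i - 1) (by omega)).2.2 ?_)
      omega
  obtain rfl | rfl | rfl | hn : n = 3 ∨ n = 5 ∨ n = 7 ∨ 8 ≤ n := by
    obtain ⟨k, rfl⟩ := hodd
    omega
  · exact S₀.tri (g 0) (g 1) (g 2) ((hg 1 (by omega) 0 (by omega)).2.2 (by simp))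
      ((hg 2 (by omega) 1 (by omega)).2.2 (by simp))
      ((hg 2 (by omega) 0 (by omega)).2.2 (by simp))
  · exact S₂.free pentagonIsolated (by simp) _
      (hg.represents_isolated hx' rfl (by decide) (by decide))
  · exact S₃.free heptagonIsolated (by simp) _
      (hg.represents_isolated hx' rfl (by decide) (by decide))
  · exact S₀.free _ (by simp [forbidden]) _ (hg.represents_p2UnionP4 hn)

/-! ### The Grötzsch graph -/

/-- A represented graph embeds as an induced subgraph. -/
def Represents.embedding {f : ℕ → V} {A : List ℕ} (h : Represents G f A) {n : ℕ}
    (hn : A.length = n) {H : SimpleGraph (Fin n)} (hH : ∀ i j, H.Adj i j ↔ adjB A i j = true) :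
    H ↪g G where
  toFun i := f i
  inj' i j hij := by
    by_contra hne
    exact h.ne (hn ▸ i.2) (hn ▸ j.2) (fun h' => hne (Fin.ext h')) hij
  map_rel_iff' {i j} := by
    rw [hH]
    exact h.adj_iff (hn ▸ i.2) (hn ▸ j.2)

theorem p2UnionP4_adj_iff (i j : Fin 6) :
    P2UnionP4.Adj i j ↔ adjB [2, 1, 8, 20, 40, 16] i j = true := by
  simp only [P2UnionP4, fromEdgeSet_adj, Set.mem_insert_iff, Set.mem_singleton_iff]
  revert i j
  decide

theorem triangleGraph_adj_iff (i j : Fin 3) :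
    TriangleGraph.Adj i j ↔ adjB [6, 5, 3] i j = true := by
  simp only [TriangleGraph, top_adj]
  revert i j
  decide

theorem grotzschGraph_adj_iff (i j : Fin 11) :
    GrotzschGraph.Adj i j ↔ adjB grotzschCode i j = true := by
  simp only [GrotzschGraph, fromEdgeSet_adj, Set.mem_insert_iff, Set.mem_singleton_iff]
  revert i j
  decide +kernel

set_option synthInstance.maxSize 1000 in
theorem grotzschGraph_not_colorable : ¬ GrotzschGraph.Colorable 3 := by
  rintro ⟨c⟩
  have key : ∀ a b : Fin 3, a ≠ b → ∀ c, b ≠ c → ∀ d, c ≠ d → ∀ e, d ≠ e → a ≠ e →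
      ∀ p, p ≠ a → p ≠ c → ∀ q, q ≠ b → q ≠ d → ∀ r, r ≠ c → r ≠ e → ∀ s, s ≠ d → s ≠ a →
      ∀ t, t ≠ e → t ≠ b → ∀ v, v ≠ p → v ≠ q → v ≠ r → v ≠ s → v = t := by
    decide +kernel
  have hc : ∀ i j : Fin 11, adjB grotzschCode i j = true → c i ≠ c j := fun i j h =>
    c.valid ((grotzschGraph_adj_iff i j).2 h)
  exact hc 0 5 rfl <| key (c 6) (c 7) (hc _ _ rfl) (c 8) (hc _ _ rfl) (c 9) (hc _ _ rfl) (c 10)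
    (hc _ _ rfl) (hc _ _ rfl) (c 1) (hc _ _ rfl) (hc _ _ rfl) (c 2) (hc _ _ rfl) (hc _ _ rfl)
    (c 3) (hc _ _ rfl) (hc _ _ rfl) (c 4) (hc _ _ rfl) (hc _ _ rfl) (c 5) (hc _ _ rfl)
    (hc _ _ rfl) (c 0) (hc _ _ rfl) (hc _ _ rfl) (hc _ _ rfl) (hc _ _ rfl)

theorem grotzschGraph_colorable : GrotzschGraph.Colorable 4 := by
  refine ⟨Coloring.mk (![0, 3, 3, 3, 3, 3, 0, 1, 0, 1, 2] : Fin 11 → Fin 4) ?_⟩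
  intro i j h
  rw [grotzschGraph_adj_iff] at h
  revert i j
  decide +kernel

/-- For each `r`, a colouring of the Grötzsch graph that is proper away from `r`. -/
def grotzschColoring : Fin 11 → Fin 11 → Fin 3 :=
  ![![0, 0, 0, 1, 0, 2, 2, 1, 2, 1, 0], ![0, 0, 1, 1, 2, 1, 1, 0, 2, 0, 2],
    ![0, 1, 0, 1, 1, 2, 2, 1, 0, 2, 0], ![0, 1, 1, 0, 1, 2, 2, 0, 2, 0, 1],
    ![0, 1, 2, 1, 0, 1, 2, 0, 2, 1, 0], ![0, 1, 1, 2, 1, 0, 0, 2, 0, 2, 1],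
    ![0, 1, 1, 1, 1, 1, 0, 0, 2, 0, 2], ![0, 1, 1, 1, 1, 1, 0, 0, 2, 0, 2],
    ![0, 1, 1, 1, 1, 1, 0, 2, 0, 0, 2], ![0, 1, 1, 1, 1, 1, 0, 2, 0, 0, 2],
    ![0, 1, 1, 1, 1, 1, 0, 2, 0, 2, 0]]

theorem grotzschColoring_ne {r i j : Fin 11} (hi : i ≠ r) (hj : j ≠ r)
    (h : GrotzschGraph.Adj i j) : grotzschColoring r i ≠ grotzschColoring r j := by
  rw [grotzschGraph_adj_iff] at h
  revert r i j
  decide +kernel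

theorem chromaticNumber_eq_four_iff : G.chromaticNumber = 4 ↔ G.Colorable 4 ∧ ¬ G.Colorable 3 :=
  chromaticNumber_eq_iff_colorable_not_colorable (n := 3)

theorem chromaticNumber_lt_four_iff : G.chromaticNumber < 4 ↔ G.Colorable 3 := by
  rw [← chromaticNumber_le_iff_colorable]
  exact ENat.lt_add_one_iff (n := 3) (by simp)

theorem not_adj_of_not_containsInduced (h : ¬ ContainsInduced TriangleGraph G) (a b c : V)
    (hab : G.Adj a b) (hbc : G.Adj b c) : ¬ G.Adj a c := by
  intro hac
  have hrep : Represents G (fun i => [a, b, c].getD i c) [6, 5, 3] := by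
    intro j hj i hi
    simp only [List.length_cons, List.length_nil] at hj
    interval_cases j <;> interval_cases i <;>
      simp [hab, hbc, hac, hab.ne, hbc.ne, hac.ne, Nat.testBit]
  let e := hrep.embedding rfl triangleGraph_adj_iff
  exact h ⟨e.toEmbedding, fun _ _ => e.map_rel_iff⟩

/-- In a vertex-critical graph no vertex dominates another one. -/
theorem exists_adj_not_adj (h3 : ¬ G.Colorable 3)
    (hcrit : ∀ S : Set V, S ≠ Set.univ → (G.induce S).Colorable 3) {a b : V} (hab : a ≠ b) :
    ∃ w, G.Adj a w ∧ ¬ G.Adj b w := by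
  classical
  by_contra! hdom
  obtain ⟨c⟩ := hcrit {a}ᶜ (by simp)
  have hb : ∀ w : V, ¬ w = a → w ∈ ({a}ᶜ : Set V) := fun w hw => hw
  refine h3 ⟨Coloring.mk (fun v => if hv : v = a then c ⟨b, hb b hab.symm⟩ else c ⟨v, hb v hv⟩) ?_⟩
  intro u v huv
  by_cases hu : u = a <;> by_cases hv : v = a <;> simp only [hu, hv, dite_true, dite_false]
  · exact absurd (hu.trans hv.symm) huv.ne
  · exact c.valid (hdom v (hu ▸ huv))
  · exact (c.valid (show (G.induce _).Adj ⟨b, _⟩ ⟨u, hu⟩ from hdom u (hv ▸ huv.symm))).symm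
  · exact c.valid huv

theorem nonempty_iso_grotzschGraph (hP : ¬ ContainsInduced P2UnionP4 G)
    (hC3 : ¬ ContainsInduced TriangleGraph G) (h3 : ¬ G.Colorable 3)
    (hcrit : ∀ S : Set V, S ≠ Set.univ → (G.induce S).Colorable 3) :
    Nonempty (G ≃g GrotzschGraph) := by
  by_contra hiso
  have : Nonempty V := by
    by_contra hV
    rw [not_nonempty_iff] at hV
    exact h3 (Colorable.of_isEmpty 3)
  refine not_setting (G := G) ⟨?_, not_adj_of_not_containsInduced hC3,
    fun a b => exists_adj_not_adj h3 hcrit, h3⟩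
  intro K hK f hf
  simp only [forbidden, List.mem_cons, List.not_mem_nil, or_false] at hK
  rcases hK with rfl | rfl | rfl
  · let e := hf.embedding rfl p2UnionP4_adj_iff
    exact hP ⟨e.toEmbedding, fun _ _ => e.map_rel_iff⟩
  · let e := hf.embedding rfl triangleGraph_adj_iff
    exact hC3 ⟨e.toEmbedding, fun _ _ => e.map_rel_iff⟩
  · let e : GrotzschGraph ↪g G := hf.embedding rfl grotzschGraph_adj_iff
    by_cases hS : Set.range e = Set.univ
    · exact hiso ⟨(RelIso.ofSurjective e (Set.range_eq_univ.1 hS)).symm⟩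
    · obtain ⟨c⟩ := hcrit _ hS
      exact grotzschGraph_not_colorable ⟨Coloring.mk (fun i => c ⟨e i, i, rfl⟩) fun {i j} hij =>
        c.valid (e.map_rel_iff.2 hij)⟩

theorem induce_colorable_of_iso (e : G ≃g GrotzschGraph) {S : Set V} (hS : S ≠ Set.univ) :
    (G.induce S).Colorable 3 := by
  obtain ⟨r, hr⟩ := (Set.ne_univ_iff_exists_notMem S).1 hS
  have hne : ∀ v : S, e v ≠ e r := fun v h => hr (e.injective h ▸ v.2)
  exact ⟨Coloring.mk (fun v => grotzschColoring (e r) (e v)) fun {u v} huv =>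
    grotzschColoring_ne (hne u) (hne v) (e.map_rel_iff.2 huv)⟩

end Refute

theorem statement_7 {V : Type*} [Fintype V] (G : SimpleGraph V)
    (hP : ¬ ContainsInduced P2UnionP4 G)
    (hC3 : ¬ ContainsInduced TriangleGraph G) :
    (G.chromaticNumber = 4 ∧
      ∀ S : Set V, S ≠ Set.univ → (G.induce S).chromaticNumber < 4) ↔
    Nonempty (G ≃g GrotzschGraph) := by
  constructor
  · rintro ⟨h4, hcrit⟩
    exact Refute.nonempty_iso_grotzschGraph hP hC3 (Refute.chromaticNumber_eq_four_iff.1 h4).2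
      fun S hS => Refute.chromaticNumber_lt_four_iff.1 (hcrit S hS)
  · rintro ⟨e⟩
    refine ⟨Refute.chromaticNumber_eq_four_iff.2
      ⟨Refute.grotzschGraph_colorable.of_hom e.toHom, fun h =>
        Refute.grotzschGraph_not_colorable (h.of_hom e.symm.toHom)⟩, fun S hS =>
      Refute.chromaticNumber_lt_four_iff.2 (Refute.induce_colorable_of_iso e hS)⟩
end
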